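/- arXiv:2208.07072 — 4 statements merged into one kernel-verified Lean document; each statement's English description precedes it below -/
import Mathlib

section
/- Let n ≥ 2, let U ⊆ ℝⁿ be an open connected set, and let f : U → ℝⁿ be a non-constant mapping of bounded length distortion; in particular f is continuous, discrete and open, Lipschitz, differentiable almost everywhere, and there are constants c > 0 and K_I ≥ 1 such that det Df(x) ≥ c and ‖cof Df(x)‖ⁿ ≤ K_I · (det Df(x))^{n-1} for almost every x ∈ U. Then for every point x ∈ U, every normal neighborhood D of x under f, and every y ∈ f(D), the number of preimages satisfies card(f⁻¹(y) ∩ D) ≤ K_I. (This is the multiplicity formulation of the bound i(x,f) ≤ K_I(f) on the local topological index.) -/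
open MeasureTheory Metric Set
open scoped Topology ENNReal NNReal

/-- The Jacobian matrix of `f` at `x`: the `(i,j)` entry is the partial
derivative `∂ⱼ fᵢ (x)`, so the `i`-th row is the gradient of the `i`-th
component function `fᵢ`. -/
noncomputable def jacobianMatrix {n : ℕ}
    (f : EuclideanSpace ℝ (Fin n) → EuclideanSpace ℝ (Fin n))
    (x : EuclideanSpace ℝ (Fin n)) : Matrix (Fin n) (Fin n) ℝ :=
  Matrix.of fun i j => fderiv ℝ f x (EuclideanSpace.single j (1 : ℝ)) i

/-- The gradient (as a vector of partial derivatives) of a scalar function. -/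
noncomputable def gradVec {n : ℕ}
    (η : EuclideanSpace ℝ (Fin n) → ℝ) (x : EuclideanSpace ℝ (Fin n)) : Fin n → ℝ :=
  fun j => fderiv ℝ η x (EuclideanSpace.single j (1 : ℝ))

/-- The cofactor matrix of a square matrix: the transpose of the adjugate. -/
noncomputable def cofMatrix {n : ℕ} (A : Matrix (Fin n) (Fin n) ℝ) :
    Matrix (Fin n) (Fin n) ℝ := (Matrix.adjugate A).transpose

/-- The operator norm of a matrix, viewed as a linear map between Euclidean spaces. -/
noncomputable def matOpNorm {n : ℕ} (A : Matrix (Fin n) (Fin n) ℝ) : ℝ :=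
  ‖LinearMap.toContinuousLinearMap (Matrix.toEuclideanLin A)‖

section Determinants

open Polynomial in
lemma exists_weights_coeff {n : ℕ} {v : Fin (n + 1) → ℝ} (hv : Function.Injective v) (k : ℕ) :
    ∃ w : Fin (n + 1) → ℝ, ∀ P : ℝ[X], P.natDegree ≤ n →
      P.coeff k = ∑ i, w i * P.eval (v i) := by
  refine ⟨fun i => (Lagrange.basis Finset.univ v i).coeff k, fun P hP => ?_⟩
  have hdeg : P.degree < (Finset.univ : Finset (Fin (n + 1))).card := by
    simp only [Finset.card_univ, Fintype.card_fin]
    exact lt_of_le_of_lt (degree_le_of_natDegree_le hP) (by exact_mod_cast Nat.lt_succ_self n)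
  conv_lhs => rw [Lagrange.eq_interpolate hv.injOn hdeg, Lagrange.interpolate_apply,
    finsetSum_coeff]
  exact Finset.sum_congr rfl fun i _ => by rw [coeff_C_mul, mul_comm]

variable {E : Type*} [AddCommGroup E] [Module ℝ E] [FiniteDimensional ℝ E]

open Polynomial in
lemma exists_polynomial_det_one_add_smul (T : E →ₗ[ℝ] E) :
    ∃ P : ℝ[X], P.natDegree ≤ Module.finrank ℝ E ∧
      (∀ t : ℝ, P.eval t = LinearMap.det (1 + t • T)) ∧
      P.coeff (Module.finrank ℝ E) = LinearMap.det T ∧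
      P.coeff 1 = LinearMap.trace ℝ E T := by
  classical
  let b := Module.finBasis ℝ E
  let M := LinearMap.toMatrix b b T
  refine ⟨((X : ℝ[X]) • M.map C + (1 : Matrix _ _ ℝ).map C).det, ?_, fun t => ?_, ?_, ?_⟩
  · simpa using natDegree_det_X_add_C_le M 1
  · rw [← LinearMap.det_toMatrix b, ← coe_evalRingHom, RingHom.map_det,
      map_add (LinearMap.toMatrix b b), map_smul (LinearMap.toMatrix b b), LinearMap.toMatrix_one,
      add_comm (1 : Matrix _ _ ℝ)]
    congr 1
    ext i j
    by_cases h : i = j <;> simp [M, h, mul_comm t]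
  · have := coeff_det_X_add_C_card M 1
    rw [Fintype.card_fin] at this
    rw [this, LinearMap.det_toMatrix]
  · have := Matrix.coeff_det_one_add_X_smul_one M
    rw [LinearMap.trace_eq_matrix_trace ℝ b, ← this, add_comm]
    simp

lemma exists_weights_det [Nontrivial E] {v : Fin (Module.finrank ℝ E + 1) → ℝ}
    (hv : Function.Injective v) :
    ∃ w : Fin (Module.finrank ℝ E + 1) → ℝ, ∀ T : E →ₗ[ℝ] E,
      LinearMap.det T = ∑ i, w i * (LinearMap.det (1 + v i • T) - 1) := by
  obtain ⟨w, hw⟩ := exists_weights_coeff hv (Module.finrank ℝ E)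
  refine ⟨w, fun T => ?_⟩
  obtain ⟨P, hP, hev, hdet, -⟩ := exists_polynomial_det_one_add_smul T
  have h := hw (P - 1) ((Polynomial.natDegree_sub_le _ _).trans (by simp [hP]))
  rw [Polynomial.coeff_sub, hdet, Polynomial.coeff_one,
    if_neg (Module.finrank_pos (R := ℝ) (M := E)).ne', sub_zero] at h
  simpa [hev] using h

lemma exists_weights_trace {v : Fin (Module.finrank ℝ E + 1) → ℝ}
    (hv : Function.Injective v) :
    ∃ w : Fin (Module.finrank ℝ E + 1) → ℝ, ∀ T : E →ₗ[ℝ] E,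
      LinearMap.trace ℝ E T = ∑ i, w i * LinearMap.det (1 + v i • T) := by
  obtain ⟨w, hw⟩ := exists_weights_coeff hv 1
  refine ⟨w, fun T => ?_⟩
  obtain ⟨P, hP, hev, -, htr⟩ := exists_polynomial_det_one_add_smul T
  simpa [hev, htr] using hw P hP

end Determinants

section NullLagrangian

lemma fderiv_eq_zero_of_notMem_tsupport {E G : Type*} [NormedAddCommGroup E] [NormedSpace ℝ E]
    [NormedAddCommGroup G] [NormedSpace ℝ G] {u : E → G} {x : E} (hx : x ∉ tsupport u) :
    fderiv ℝ u x = 0 := by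
  by_contra h
  exact hx (support_fderiv_subset ℝ h)

variable {E : Type*} [NormedAddCommGroup E] [NormedSpace ℝ E] [FiniteDimensional ℝ E]
  [MeasurableSpace E] [BorelSpace E] (μ : Measure E) [μ.IsAddHaarMeasure]

lemma LipschitzWith.addHaar_image_eq_zero {K : ℝ≥0} {F : E → E} (hF : LipschitzWith K F)
    {s : Set E} (hs : μ s = 0) : μ (F '' s) = 0 := by
  apply Measure.absolutelyContinuous_isAddHaarMeasure μ
    (Measure.hausdorffMeasure (Module.finrank ℝ E : ℝ))
  have h0 := Measure.absolutelyContinuous_isAddHaarMeasure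
    (Measure.hausdorffMeasure (Module.finrank ℝ E : ℝ)) μ hs
  have := hF.hausdorffMeasure_image_le (d := Module.finrank ℝ E) (by positivity) s
  rw [h0, mul_zero] at this
  exact le_antisymm this bot_le

lemma LipschitzWith.addHaar_image_inter_differentiableAt {K : ℝ≥0} {F : E → E}
    (hF : LipschitzWith K F) (s : Set E) :
    μ (F '' s) = μ (F '' (s ∩ {x | DifferentiableAt ℝ F x})) := by
  refine le_antisymm ?_ (measure_mono (image_mono inter_subset_left))
  have h0 : μ (F '' (s \ {x | DifferentiableAt ℝ F x})) = 0 :=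
    hF.addHaar_image_eq_zero μ (measure_mono_null (fun x hx => hx.2) hF.ae_differentiableAt)
  calc μ (F '' s) = μ (F '' (s ∩ {x | DifferentiableAt ℝ F x}) ∪
        F '' (s \ {x | DifferentiableAt ℝ F x})) := by
        rw [← image_union, inter_union_sdiff]
    _ ≤ _ := (measure_union_le _ _).trans (by rw [h0, add_zero])

lemma LipschitzWith.addHaar_image_le_lintegral {K : ℝ≥0} {F : E → E}
    (hF : LipschitzWith K F) {s : Set E} (hs : MeasurableSet s) :
    μ (F '' s) ≤ ∫⁻ x in s, ENNReal.ofReal |(fderiv ℝ F x).det| ∂μ := by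
  rw [hF.addHaar_image_inter_differentiableAt μ]
  refine (addHaar_image_le_lintegral_abs_det_fderiv μ
    (hs.inter (measurableSet_of_differentiableAt ℝ F))
    fun x hx => hx.2.hasFDerivAt.hasFDerivWithinAt).trans ?_
  exact lintegral_mono_set inter_subset_left

lemma LipschitzWith.lintegral_det_fderiv_eq {K : ℝ≥0} {F : E → E}
    (hF : LipschitzWith K F) {s : Set E} (hs : MeasurableSet s) (hinj : InjOn F s) :
    ∫⁻ x in s, ENNReal.ofReal |(fderiv ℝ F x).det| ∂μ = μ (F '' s) := by
  rw [hF.addHaar_image_inter_differentiableAt μ, ← lintegral_abs_det_fderiv_eq_addHaar_image μ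
    (hs.inter (measurableSet_of_differentiableAt ℝ F))
    (fun x hx => hx.2.hasFDerivAt.hasFDerivWithinAt) (hinj.mono inter_subset_left)]
  refine setLIntegral_congr ?_
  have : ∀ᵐ x ∂μ, x ∈ {x | DifferentiableAt ℝ F x} := hF.ae_differentiableAt
  filter_upwards [this] with x hx
  exact propext ⟨fun h => ⟨h, hx⟩, fun h => h.1⟩

lemma measurable_det_fderiv (F : E → E) : Measurable fun x => (fderiv ℝ F x).det :=
  ContinuousLinearMap.continuous_det.measurable.comp (measurable_fderiv ℝ F)

lemma integral_det_one_add_fderiv_sub_one [Nontrivial E] {k : ℝ≥0} (hk : k < 1) {u : E → E}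
    (hu : LipschitzWith k u) (hsupp : HasCompactSupport u)
    (hpos : ∀ x, 0 < (1 + fderiv ℝ u x).det) :
    ∫ x, ((1 + fderiv ℝ u x).det - 1) ∂μ = 0 := by
  obtain ⟨R, hR⟩ := hsupp.isCompact.isBounded.subset_closedBall (0 : E)
  set B : Set E := closedBall 0 R
  set Φ : E → E := fun x => x + u x with hΦ
  have happ : ApproximatesLinearOn Φ (ContinuousLinearEquiv.refl ℝ E : E →L[ℝ] E) univ k := by
    rw [ApproximatesLinearOn.approximatesLinearOn_iff_lipschitzOnWith, lipschitzOnWith_univ]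
    convert hu using 1
    ext x
    simp [hΦ]
  have hcond : Subsingleton E ∨
      k < ‖((ContinuousLinearEquiv.refl ℝ E).symm : E →L[ℝ] E)‖₊⁻¹ := by
    right
    have : ‖((ContinuousLinearEquiv.refl ℝ E).symm : E →L[ℝ] E)‖₊ = 1 := by
      ext
      simp
    rw [this]
    simpa using hk
  have hinj : Function.Injective Φ := injOn_univ.1 (happ.injOn hcond)
  have hsurj : Function.Surjective Φ := happ.surjective hcond
  have hout : ∀ x, x ∉ B → Φ x = x := fun x hx => by
    simp [hΦ, image_eq_zero_of_notMem_tsupport fun h => hx (hR h)]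
  have himage : Φ '' B = B := by
    apply Subset.antisymm
    · rintro _ ⟨x, hx, rfl⟩
      by_contra h
      have := hinj (hout _ h)
      exact h (by rw [this]; exact hx)
    · intro y hy
      obtain ⟨x, rfl⟩ := hsurj y
      refine ⟨x, ?_, rfl⟩
      by_contra h
      exact h (hout x h ▸ hy)
  have hΦlip : LipschitzWith (1 + k) Φ := LipschitzWith.id.add hu
  have hBm : MeasurableSet B := measurableSet_closedBall
  have hder : ∀ᵐ x ∂μ, fderiv ℝ Φ x = 1 + fderiv ℝ u x := by
    filter_upwards [hu.ae_differentiableAt] with x hx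
    exact ((hasFDerivAt_id x).add hx.hasFDerivAt).fderiv
  have key : ∫⁻ x in B, ENNReal.ofReal (1 + fderiv ℝ u x).det ∂μ = μ B := by
    conv_rhs => rw [← himage, ← hΦlip.lintegral_det_fderiv_eq μ hBm hinj.injOn]
    refine lintegral_congr_ae (ae_restrict_of_ae ?_)
    filter_upwards [hder] with x hx
    rw [hx, abs_of_pos (hpos x)]
  have hBfin : μ B ≠ ∞ := (isCompact_closedBall (0 : E) R).measure_lt_top.ne
  have hmeas : Measurable fun x => (1 + fderiv ℝ u x).det :=
    ContinuousLinearMap.continuous_det.measurable.comp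
      ((measurable_fderiv ℝ u).const_add 1)
  have hint : IntegrableOn (fun x => (1 + fderiv ℝ u x).det) B μ := by
    refine ⟨hmeas.aestronglyMeasurable, ?_⟩
    rw [hasFiniteIntegral_iff_ofReal (Filter.Eventually.of_forall fun x => (hpos x).le), key]
    exact hBfin.lt_top
  have hval : ∫ x in B, (1 + fderiv ℝ u x).det ∂μ = μ.real B := by
    rw [integral_eq_lintegral_of_nonneg_ae (Filter.Eventually.of_forall fun x => (hpos x).le)
      hmeas.aestronglyMeasurable, key, Measure.real]
  rw [← setIntegral_eq_integral_of_forall_compl_eq_zero (s := B), integral_sub hint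
    (integrableOn_const hBfin), hval]
  · simp
  · intro x hx
    rw [fderiv_eq_zero_of_notMem_tsupport fun h => hx (hR h)]
    simp [ContinuousLinearMap.det]

lemma integrable_comp_fderiv {G : Type*} [NormedAddCommGroup G] [NormedSpace ℝ G]
    [FiniteDimensional ℝ G] [MeasurableSpace G] [BorelSpace G] {K : ℝ≥0} {u : E → G}
    (hu : LipschitzWith K u) (hsupp : HasCompactSupport u) {g : (E →L[ℝ] G) → ℝ}
    (hg : Continuous g) (hg0 : g 0 = 0) : Integrable (fun x => g (fderiv ℝ u x)) μ := by
  obtain ⟨C, hC⟩ :=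
    (ProperSpace.isCompact_closedBall (0 : E →L[ℝ] G) K).exists_bound_of_continuousOn
    hg.continuousOn
  rw [← integrableOn_iff_integrable_of_support_subset (s := tsupport u)]
  · refine Measure.integrableOn_of_bounded (M := C) hsupp.isCompact.measure_lt_top.ne
      (hg.measurable.comp (measurable_fderiv ℝ u)).aestronglyMeasurable
      (Filter.Eventually.of_forall fun x => ?_)
    exact hC _ (by simpa using norm_fderiv_le_of_lipschitz ℝ hu)
  · intro x hx
    by_contra h
    apply hx
    simp [fderiv_eq_zero_of_notMem_tsupport h, hg0]

lemma integral_det_fderiv_eq_zero [Nontrivial E] {K : ℝ≥0} {u : E → E} (hu : LipschitzWith K u)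
    (hsupp : HasCompactSupport u) : ∫ x, (fderiv ℝ u x).det ∂μ = 0 := by
  have hcont : Filter.Tendsto (fun A : E →L[ℝ] E => (1 + A).det) (𝓝 0) (𝓝 1) := by
    have : Continuous fun A : E →L[ℝ] E => (1 + A).det :=
      ContinuousLinearMap.continuous_det.comp (continuous_const.add continuous_id)
    simpa [ContinuousLinearMap.det] using this.tendsto 0
  obtain ⟨δ, hδ, hball⟩ := Metric.eventually_nhds_iff_ball.1
    (hcont.eventually (lt_mem_nhds (zero_lt_one' ℝ)))
  set d := Module.finrank ℝ E
  set τ : ℝ := min δ 1 / (2 * (d + 1) * (K + 1)) with hτ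
  have hm : 0 < min δ 1 := lt_min hδ one_pos
  have hτ0 : 0 < τ := by positivity
  let v : Fin (d + 1) → ℝ := fun i => (i + 1) * τ
  have hv : Function.Injective v := by
    intro i j hij
    have : ((i : ℕ) : ℝ) = (j : ℕ) := by
      have := mul_right_cancel₀ hτ0.ne' hij
      linarith
    exact Fin.ext (by exact_mod_cast this)
  have hvpos : ∀ i, 0 < v i := fun i => by positivity
  have hvle : ∀ i, v i * K < min δ 1 := fun i => by
    have h1 : ((i : ℕ) : ℝ) + 1 ≤ d + 1 := by exact_mod_cast i.2
    calc v i * K ≤ ((d + 1) * τ) * (K + 1) := by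
          simp only [v]; gcongr; linarith
      _ = min δ 1 / 2 := by rw [hτ]; field_simp
      _ < _ := by linarith
  have hz : ∀ i, ∫ x, ((1 + v i • fderiv ℝ u x).det - 1) ∂μ = 0 := by
    intro i
    have hlip : LipschitzWith (‖v i‖₊ * K) (v i • u) :=
      (lipschitzWith_smul (v i)).comp hu
    have hk : ((‖v i‖₊ * K : ℝ≥0) : ℝ) = v i * K := by
      simp [abs_of_pos (hvpos i)]
    have hfd : ∀ x, fderiv ℝ (v i • u) x = v i • fderiv ℝ u x := fun x =>
      congrFun (fderiv_const_smul_field (v i)) x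
    have := integral_det_one_add_fderiv_sub_one μ (k := ‖v i‖₊ * K)
      (by rw [← NNReal.coe_lt_coe, hk]; exact (hvle i).trans_le (min_le_right _ _)) hlip
      (hsupp.smul_left (f := fun _ => v i)) (fun x => ?_)
    · simpa only [hfd] using this
    · apply hball
      rw [mem_ball_zero_iff]
      calc _ ≤ ((‖v i‖₊ * K : ℝ≥0) : ℝ) := norm_fderiv_le_of_lipschitz ℝ hlip
        _ < δ := by rw [hk]; exact (hvle i).trans_le (min_le_left _ _)
  obtain ⟨w, hw⟩ := exists_weights_det hv
  have hw' : ∀ x, (fderiv ℝ u x).det = ∑ i, w i * ((1 + v i • fderiv ℝ u x).det - 1) :=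
    fun x => by simpa [ContinuousLinearMap.det] using hw (fderiv ℝ u x)
  simp_rw [hw']
  rw [integral_finsetSum]
  · simp_rw [integral_const_mul, hz, mul_zero, Finset.sum_const_zero]
  · have hc : ∀ i, Continuous fun A : E →L[ℝ] E => 1 + v i • A := fun i => by fun_prop
    refine fun i _ => (integrable_comp_fderiv μ hu hsupp
      (g := fun A => (1 + v i • A).det - 1) ?_ (by simp [ContinuousLinearMap.det])).const_mul _
    exact (ContinuousLinearMap.continuous_det.comp (hc i)).sub continuous_const

end NullLagrangian

section RadialIdentity

lemma LipschitzWith.exists_smul_of_bounded {X G : Type*} [PseudoMetricSpace X]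
    [SeminormedAddCommGroup G] [NormedSpace ℝ G] {ψ : X → ℝ} {g : X → G} {K L : ℝ≥0}
    (hψ : LipschitzWith K ψ) (hg : LipschitzWith L g) {A B : ℝ} (hA : ∀ x, ‖ψ x‖ ≤ A)
    (hB : ∀ x, ψ x ≠ 0 → ‖g x‖ ≤ B) : ∃ M : ℝ≥0, LipschitzWith M fun x => ψ x • g x := by
  rcases isEmpty_or_nonempty X with hX | ⟨⟨x₀⟩⟩
  · exact ⟨0, fun x => (hX.false x).elim⟩
  have hA0 : 0 ≤ A := (norm_nonneg _).trans (hA x₀)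
  refine ⟨⟨A * L + K * |B|, by positivity⟩, LipschitzWith.of_dist_le_mul fun x y => ?_⟩
  have h1 := hψ.dist_le_mul x y
  have h2 := hg.dist_le_mul x y
  rw [dist_eq_norm] at h1 h2 ⊢
  have heq : ψ x • g x - ψ y • g y = ψ x • (g x - g y) + (ψ x - ψ y) • g y := by
    rw [smul_sub, sub_smul]; abel
  suffices ‖ψ x • g x - ψ y • g y‖ ≤ A * (L * dist x y) + (K * dist x y) * |B| from
    this.trans_eq (show _ = (A * L + K * |B|) * dist x y by ring)
  by_cases hy : ψ y = 0
  · by_cases hx : ψ x = 0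
    · rw [hx, hy, zero_smul, zero_smul, sub_zero, norm_zero]
      positivity
    · rw [hy, sub_zero] at h1
      rw [hy, zero_smul, sub_zero, norm_smul]
      have := mul_le_mul h1 ((hB x hx).trans (le_abs_self B)) (norm_nonneg _) (by positivity)
      exact this.trans (le_add_of_nonneg_left (by positivity))
  · rw [heq]
    calc _ ≤ ‖ψ x‖ * ‖g x - g y‖ + ‖ψ x - ψ y‖ * ‖g y‖ := by
          rw [← norm_smul, ← norm_smul]; exact norm_add_le _ _
      _ ≤ _ := by gcongr; exacts [hA x, (hB y hy).trans (le_abs_self B)]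

lemma LipschitzWith.exists_pow_of_bounded {X : Type*} [PseudoMetricSpace X] {g : X → ℝ} {L : ℝ≥0}
    (hg : LipschitzWith L g) {B : ℝ} (hB : ∀ x, ‖g x‖ ≤ B) (k : ℕ) :
    ∃ M : ℝ≥0, LipschitzWith M fun x => g x ^ k := by
  induction k with
  | zero => exact ⟨0, by simp⟩
  | succ k ih =>
    obtain ⟨M, hM⟩ := ih
    have := hM.exists_smul_of_bounded hg (A := B ^ k)
      (fun x => by rw [norm_pow]; gcongr; exact hB x) fun x _ => hB x
    simpa [pow_succ] using this

lemma LipschitzWith.inv_of_le {X : Type*} [PseudoMetricSpace X] {g : X → ℝ} {L : ℝ≥0}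
    (hg : LipschitzWith L g) {a : ℝ} (ha : 0 < a) (hle : ∀ x, a ≤ g x) :
    ∃ M : ℝ≥0, LipschitzWith M fun x => (g x)⁻¹ := by
  refine ⟨⟨(a * a)⁻¹ * L, by positivity⟩, LipschitzWith.of_dist_le_mul fun x y => ?_⟩
  have hx : 0 < g x := ha.trans_le (hle x)
  have hy : 0 < g y := ha.trans_le (hle y)
  have h1 := hg.dist_le_mul y x
  rw [dist_comm y x] at h1
  rw [Real.dist_eq] at h1 ⊢
  rw [inv_sub_inv hx.ne' hy.ne', abs_div, abs_of_pos (mul_pos hx hy), div_eq_inv_mul]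
  calc _ ≤ (a * a)⁻¹ * (L * dist x y) := by
        gcongr
        exacts [hle x, hle y]
    _ = (a * a)⁻¹ * L * dist x y := by ring

variable {E : Type*} [NormedAddCommGroup E] [NormedSpace ℝ E]

/-- The pullback under `F` of the radial vector field `y ↦ y - q`. -/
noncomputable def pullbackRadial (F : E → E) (q x : E) : E :=
  (fderiv ℝ F x).inverse (F x - q)

/-- Euler's identity for positively homogeneous functions, pulled back under `F`. -/
lemma fderiv_comp_apply_of_homogeneous {F : E → E} {q x z : E} (hF : DifferentiableAt ℝ F x)
    (hz : fderiv ℝ F x z = F x - q) {p : E → ℝ} {P : ℝ≥0} (hp : LipschitzWith P p)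
    (hph : ∀ t : ℝ, 0 ≤ t → ∀ v, p (t • v) = t * p v)
    (hh : DifferentiableAt ℝ (fun y => p (F y - q)) x) :
    fderiv ℝ (fun y => p (F y - q)) x z = p (F x - q) := by
  have hline : HasDerivAt (fun s : ℝ => x + s • z) z 0 := by
    simpa using ((hasDerivAt_id (0 : ℝ)).smul_const z).const_add x
  have hx0 : x + (0 : ℝ) • z = x := by simp
  have hr : HasDerivAt (fun s : ℝ => F (x + s • z) - q - (1 + s) • (F x - q)) 0 0 := by
    have h1 : HasDerivAt (fun s : ℝ => F (x + s • z)) (fderiv ℝ F x z) 0 := by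
      apply HasFDerivAt.comp_hasDerivAt (x := (0 : ℝ)) (f := fun s : ℝ => x + s • z) _ hline
      rw [hx0]; exact hF.hasFDerivAt
    have h2 : HasDerivAt (fun s : ℝ => (1 + s) • (F x - q)) (F x - q) 0 := by
      simpa using ((hasDerivAt_id (0 : ℝ)).const_add 1).smul_const (F x - q)
    have := (h1.sub_const q).sub h2
    rwa [hz, sub_self] at this
  have he : HasDerivAt (fun s : ℝ => p (F (x + s • z) - q) - (1 + s) * p (F x - q))
      (fderiv ℝ (fun y => p (F y - q)) x z - p (F x - q)) 0 := by
    have h1 : HasDerivAt (fun s : ℝ => p (F (x + s • z) - q))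
        (fderiv ℝ (fun y => p (F y - q)) x z) 0 := by
      apply HasFDerivAt.comp_hasDerivAt (x := (0 : ℝ)) (f := fun s : ℝ => x + s • z)
        (l := fun y => p (F y - q)) _ hline
      rw [hx0]; exact hh.hasFDerivAt
    have h2 : HasDerivAt (fun s : ℝ => (1 + s) * p (F x - q)) (p (F x - q)) 0 := by
      simpa using ((hasDerivAt_id (0 : ℝ)).const_add 1).mul_const (p (F x - q))
    exact h1.sub h2
  have he0 : HasDerivAt (fun s : ℝ => p (F (x + s • z) - q) - (1 + s) * p (F x - q)) 0 0 := by
    rw [hasDerivAt_iff_isLittleO] at hr ⊢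
    refine Asymptotics.IsBigO.trans_isLittleO (Asymptotics.IsBigO.of_bound P ?_) hr
    filter_upwards [lt_mem_nhds (show (-1 : ℝ) < 0 by norm_num)] with s hs
    have := hp.dist_le_mul (F (x + s • z) - q) ((1 + s) • (F x - q))
    rw [hph _ (by linarith), dist_eq_norm, dist_eq_norm] at this
    simpa using this
  exact sub_eq_zero.1 (he.unique he0)

variable [FiniteDimensional ℝ E]

lemma fderiv_pullbackRadial {F : E → E} {x : E} (q : E) (hdet : (fderiv ℝ F x).det ≠ 0) :
    fderiv ℝ F x (pullbackRadial F q x) = F x - q := by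
  have hinv : (fderiv ℝ F x).IsInvertible :=
    ⟨_, ContinuousLinearMap.coe_toContinuousLinearEquivOfDetNeZero _ hdet⟩
  exact ((hinv.inverse_apply_eq).1 rfl).symm

variable [MeasurableSpace E] [BorelSpace E] (μ : Measure E) [μ.IsAddHaarMeasure]

lemma integral_det_mul_divergence_eq_zero [Nontrivial E] {K L : ℝ≥0} {F : E → E}
    (hF : LipschitzWith K F) (hFs : HasCompactSupport F) {D : Set E} (hD : MeasurableSet D)
    (hdet : ∀ᵐ x ∂μ, x ∈ D → (fderiv ℝ F x).det ≠ 0) (q : E) {ψ : E → ℝ}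
    (hψ : LipschitzWith L ψ) (hψs : HasCompactSupport ψ) (hψD : tsupport ψ ⊆ D) :
    IntegrableOn (fun x => (fderiv ℝ F x).det * (Module.finrank ℝ E * ψ x +
      fderiv ℝ ψ x (pullbackRadial F q x))) D μ ∧
    ∫ x in D, (fderiv ℝ F x).det * (Module.finrank ℝ E * ψ x +
      fderiv ℝ ψ x (pullbackRadial F q x)) ∂μ = 0 := by
  obtain ⟨A, hA⟩ := hψs.exists_bound_of_continuous hψ.continuous
  obtain ⟨B, hB⟩ := hFs.exists_bound_of_continuous hF.continuous
  obtain ⟨M, hM⟩ := hψ.exists_smul_of_bounded (hF.sub (LipschitzWith.const q)) hA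
    (B := B + ‖q‖) (fun x _ => (norm_sub_le _ _).trans (by gcongr; exact hB x))
  set h : E → E := fun x => ψ x • (F x - q) with hh
  have hhs : HasCompactSupport h := hψs.smul_right
  set d := Module.finrank ℝ E with hd
  set v : Fin (d + 1) → ℝ := fun i => (i : ℕ) with hv
  have hvinj : Function.Injective v := fun i j hij => Fin.ext (Nat.cast_injective (R := ℝ) hij)
  obtain ⟨w, hw⟩ := exists_weights_trace (E := E) hvinj
  have hlip : ∀ i, LipschitzWith (K + ‖v i‖₊ * M) (F + v i • h) := fun i =>
    hF.add ((lipschitzWith_smul (v i)).comp hM)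
  have hcs : ∀ i, HasCompactSupport (F + v i • h) := fun i =>
    hFs.add (hhs.smul_left (f := fun _ => v i))
  have hint : ∀ i, Integrable (fun x => (fderiv ℝ (F + v i • h) x).det) μ := fun i =>
    integrable_comp_fderiv μ (hlip i) (hcs i) (g := fun A => A.det)
      ContinuousLinearMap.continuous_det (by simp [ContinuousLinearMap.det])
  have hzero : ∀ i, ∫ x, (fderiv ℝ (F + v i • h) x).det ∂μ = 0 := fun i =>
    integral_det_fderiv_eq_zero μ (hlip i) (hcs i)
  have hae : (fun x => ∑ i, w i * (fderiv ℝ (F + v i • h) x).det) =ᵐ[μ]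
      D.indicator (fun x => (fderiv ℝ F x).det * (d * ψ x +
      fderiv ℝ ψ x (pullbackRadial F q x))) := by
    filter_upwards [hF.ae_differentiableAt, hψ.ae_differentiableAt, hdet] with x hFx hψx hx
    have hder : ∀ i, fderiv ℝ (F + v i • h) x =
        fderiv ℝ F x + v i • (ψ x • fderiv ℝ F x + (fderiv ℝ ψ x).smulRight (F x - q)) := by
      intro i
      exact (hFx.hasFDerivAt.add
        ((hψx.hasFDerivAt.smul (hFx.hasFDerivAt.sub_const q)).const_smul (v i))).fderiv
    simp_rw [hder]
    by_cases hxD : x ∈ D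
    · rw [indicator_of_mem hxD]
      set z := pullbackRadial F q x with hzdef
      have hz : fderiv ℝ F x z = F x - q := fderiv_pullbackRadial q (hx hxD)
      set T : E →ₗ[ℝ] E := ψ x • 1 + ((fderiv ℝ ψ x : E →L[ℝ] ℝ) : E →ₗ[ℝ] ℝ).smulRight z
      have hTt : LinearMap.trace ℝ E T = d * ψ x + fderiv ℝ ψ x z := by
        simp [T, hd, mul_comm]
      have hdetT : ∀ i, (fderiv ℝ F x + v i • (ψ x • fderiv ℝ F x +
          (fderiv ℝ ψ x).smulRight (F x - q))).det =
          (fderiv ℝ F x).det * LinearMap.det (1 + v i • T) := by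
        intro i
        simp only [ContinuousLinearMap.det]
        rw [← LinearMap.det_comp]
        congr 1
        ext y
        simp [T, ← hz]
      simp_rw [hdetT]
      rw [← hTt, hw T, Finset.mul_sum]
      exact Finset.sum_congr rfl fun i _ => by ring
    · rw [indicator_of_notMem hxD]
      have hxs : x ∉ tsupport ψ := fun h => hxD (hψD h)
      have h0 := hw 0
      simp only [map_zero, smul_zero, add_zero, map_one, mul_one] at h0
      simp [fderiv_eq_zero_of_notMem_tsupport hxs, image_eq_zero_of_notMem_tsupport hxs,
        ← Finset.sum_mul, ← h0]
  have hsum : Integrable (fun x => ∑ i, w i * (fderiv ℝ (F + v i • h) x).det) μ :=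
    integrable_finsetSum _ fun i _ => (hint i).const_mul _
  refine ⟨(integrable_indicator_iff hD).1 (hsum.congr hae), ?_⟩
  rw [← integral_indicator hD, ← integral_congr_ae hae,
    integral_finsetSum _ fun i _ => (hint i).const_mul _]
  simp [integral_const_mul, hzero]

lemma ae_divergence_radial [Nontrivial E] {K L P : ℝ≥0} {F : E → E}
    (hF : LipschitzWith K F) {D : Set E}
    (hdet : ∀ᵐ x ∂μ, x ∈ D → (fderiv ℝ F x).det ≠ 0) (q : E) {p : E → ℝ} (hp : LipschitzWith P p)
    (hph : ∀ t : ℝ, 0 ≤ t → ∀ v, p (t • v) = t * p v) {a : ℝ} (ha : 0 < a) {η : E → ℝ}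
    (hη : LipschitzWith L η) :
    ∀ᵐ x ∂μ, x ∈ D → Module.finrank ℝ E * (η x * (max a (p (F x - q)))⁻¹ ^ Module.finrank ℝ E) +
      fderiv ℝ (fun x => η x * (max a (p (F x - q)))⁻¹ ^ Module.finrank ℝ E) x
        (pullbackRadial F q x) =
      (if p (F x - q) < a then Module.finrank ℝ E * a⁻¹ ^ Module.finrank ℝ E * η x else 0) +
      (max a (p (F x - q)))⁻¹ ^ Module.finrank ℝ E * fderiv ℝ η x (pullbackRadial F q x) := by
  set h : E → ℝ := fun x => p (F x - q) with hh
  have hlip : LipschitzWith (P * (K + 0)) h := hp.comp (hF.sub (LipschitzWith.const q))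
  set g : E → ℝ := fun x => max a (h x) with hg
  have hglip : LipschitzWith (P * (K + 0)) g := hlip.const_max a
  set d := Module.finrank ℝ E with hd
  filter_upwards [hF.ae_differentiableAt, hlip.ae_differentiableAt, hglip.ae_differentiableAt,
    hη.ae_differentiableAt, hdet] with x hFx hhx hgx hηx hx hxD
  set z := pullbackRadial F q x
  have hz : fderiv ℝ F x z = F x - q := fderiv_pullbackRadial q (hx hxD)
  have hhz : fderiv ℝ h x z = h x := fderiv_comp_apply_of_homogeneous hFx hz hp hph hhx
  have hgpos : 0 < g x := ha.trans_le (le_max_left _ _)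
  have hpow : HasDerivAt (fun t : ℝ => t⁻¹ ^ d) (-(d * (g x)⁻¹ ^ d * (g x)⁻¹)) (g x) := by
    have hval : -(d * (g x)⁻¹ ^ d * (g x)⁻¹) = d * (g x)⁻¹ ^ (d - 1) * -((g x) ^ 2)⁻¹ := by
      obtain ⟨k, hk⟩ : ∃ k, d = k + 1 := Nat.exists_eq_succ_of_ne_zero Module.finrank_pos.ne'
      rw [hk, Nat.add_sub_cancel, pow_succ]
      field_simp
    rw [hval]
    exact (hasDerivAt_inv hgpos.ne').fun_pow d
  have hψ : fderiv ℝ (fun x => η x * (g x)⁻¹ ^ d) x z =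
      (g x)⁻¹ ^ d * fderiv ℝ η x z - d * η x * (g x)⁻¹ ^ d * ((g x)⁻¹ * fderiv ℝ g x z) := by
    have h2 : HasFDerivAt (fun x => (g x)⁻¹ ^ d)
        (-(d * (g x)⁻¹ ^ d * (g x)⁻¹) • fderiv ℝ g x) x :=
      hpow.comp_hasFDerivAt x hgx.hasFDerivAt
    rw [(hηx.hasFDerivAt.fun_mul h2).fderiv]
    simp
    ring
  have hcont : ContinuousAt h x := hlip.continuous.continuousAt
  have hmax : max a (p (F x - q)) = g x := rfl
  rw [hψ, hmax]
  rcases lt_trichotomy (h x) a with hlt | heq | hgt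
  · have hga : g x = a := max_eq_left hlt.le
    have : fderiv ℝ g x = 0 := by
      have : g =ᶠ[𝓝 x] fun _ => a := by
        filter_upwards [hcont.eventually (gt_mem_nhds hlt)] with y hy using max_eq_left hy.le
      rw [this.fderiv_eq]; simp
    rw [if_pos hlt, this, hga]
    simp
    ring
  · exfalso
    have hga : g x = a := by simp [hg, heq]
    have hg0 : fderiv ℝ g x = 0 := by
      apply IsLocalMin.fderiv_eq_zero
      exact Filter.Eventually.of_forall fun y => by rw [hga]; exact le_max_left _ _
    have hhg : fderiv ℝ (fun y => h y - g y) x = 0 := by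
      apply IsLocalMax.fderiv_eq_zero
      exact Filter.Eventually.of_forall fun y => by
        simp only [hga, heq, sub_self, sub_nonpos]; exact le_max_right _ _
    rw [fderiv_fun_sub hhx hgx, hg0, sub_zero] at hhg
    rw [hhg] at hhz
    simp only [zero_apply] at hhz
    linarith
  · have hga : g x = h x := max_eq_right hgt.le
    have : fderiv ℝ g x = fderiv ℝ h x := by
      have : g =ᶠ[𝓝 x] h := by
        filter_upwards [hcont.eventually (lt_mem_nhds hgt)] with y hy using max_eq_right hy.le
      exact this.fderiv_eq
    rw [if_neg (not_lt.2 hgt.le), this, hhz, hga, inv_mul_cancel₀ (ha.trans hgt).ne']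
    ring

/-- Testing the pullback of the field `y ↦ max(a, p(y - q))⁻ᵈ (y - q)`, which is divergence free
outside `{p(y - q) < a}`, against a Lipschitz function supported in `D`. -/
lemma integral_det_mul_radial_eq_zero [Nontrivial E] {K L P : ℝ≥0} {F : E → E}
    (hF : LipschitzWith K F) (hFs : HasCompactSupport F) {D : Set E} (hD : MeasurableSet D)
    (hdet : ∀ᵐ x ∂μ, x ∈ D → (fderiv ℝ F x).det ≠ 0) (q : E) {p : E → ℝ} (hp : LipschitzWith P p)
    (hph : ∀ t : ℝ, 0 ≤ t → ∀ v, p (t • v) = t * p v) {a : ℝ} (ha : 0 < a) {η : E → ℝ}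
    (hη : LipschitzWith L η) (hηs : HasCompactSupport η) (hηD : tsupport η ⊆ D) :
    IntegrableOn (fun x => (fderiv ℝ F x).det *
      ((if p (F x - q) < a then Module.finrank ℝ E * a⁻¹ ^ Module.finrank ℝ E * η x else 0) +
      (max a (p (F x - q)))⁻¹ ^ Module.finrank ℝ E * fderiv ℝ η x (pullbackRadial F q x))) D μ ∧
    ∫ x in D, (fderiv ℝ F x).det *
      ((if p (F x - q) < a then Module.finrank ℝ E * a⁻¹ ^ Module.finrank ℝ E * η x else 0) +
      (max a (p (F x - q)))⁻¹ ^ Module.finrank ℝ E * fderiv ℝ η x (pullbackRadial F q x)) ∂μ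
      = 0 := by
  have hle : ∀ x, a ≤ max a (p (F x - q)) := fun x => le_max_left _ _
  obtain ⟨M₁, hM₁⟩ := ((hp.comp (hF.sub (LipschitzWith.const q))).const_max a).inv_of_le ha hle
  have hb : ∀ x, ‖(max a (p (F x - q)))⁻¹‖ ≤ a⁻¹ := fun x => by
    rw [norm_inv, Real.norm_of_nonneg (ha.le.trans (hle x))]
    exact inv_anti₀ ha (hle x)
  obtain ⟨M₂, hM₂⟩ := hM₁.exists_pow_of_bounded hb (Module.finrank ℝ E)
  obtain ⟨A, hA⟩ := hηs.exists_bound_of_continuous hη.continuous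
  obtain ⟨M₃, hM₃⟩ := hη.exists_smul_of_bounded hM₂ hA (B := a⁻¹ ^ Module.finrank ℝ E)
    (fun x _ => by simp only [norm_pow]; gcongr; exact hb x)
  simp only [smul_eq_mul, Function.comp_apply] at hM₃
  have hs : tsupport (fun x => η x * (max a (p (F x - q)))⁻¹ ^ Module.finrank ℝ E) ⊆ tsupport η :=
    closure_mono (Function.support_mul_subset_left _ _)
  obtain ⟨h1, h2⟩ := integral_det_mul_divergence_eq_zero μ hF hFs hD hdet q hM₃
    (hηs.mul_right) (hs.trans hηD)
  have hae := ae_divergence_radial μ hF hdet q hp hph ha hη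
  rw [← ae_restrict_iff' hD] at hae
  have hae' := hae.mono fun x hx => congrArg (fun t => (fderiv ℝ F x).det * t) hx
  exact ⟨h1.congr hae', (integral_congr_ae hae').symm.trans h2⟩

end RadialIdentity

section LocalDegree

variable {E : Type*} [NormedAddCommGroup E] [NormedSpace ℝ E] [FiniteDimensional ℝ E]

lemma exists_lipschitz_cutoff {K D : Set E} (hK : IsCompact K) (hD : IsOpen D) (hKD : K ⊆ D) :
    ∃ (L : ℝ≥0) (η : E → ℝ), LipschitzWith L η ∧ HasCompactSupport η ∧ tsupport η ⊆ D ∧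
      ∀ x ∈ K, η =ᶠ[𝓝 x] 1 := by
  obtain ⟨K', hK', hKK', hK'D⟩ := exists_compact_between hK hD hKD
  obtain ⟨η, h1, h0, -⟩ := exists_contMDiffMap_one_nhds_of_subset_interior
    (n := 1) (modelWithCornersSelf ℝ E) hK.isClosed hKK'
  have hsub : tsupport η ⊆ K' := closure_minimal
    (fun x hx => by_contra fun h => hx (h0 x h)) hK'.isClosed
  have hcs : HasCompactSupport η := hK'.of_isClosed_subset (isClosed_tsupport _) hsub
  obtain ⟨L, hL⟩ := η.contMDiff.contDiff.lipschitzWith_of_hasCompactSupport hcs (by simp)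
  exact ⟨L, η, hL, hcs, hsub.trans hK'D, fun x hx =>
    (Filter.eventually_iff_exists_mem.1 h1).elim fun V hV =>
      Filter.mem_of_superset (mem_nhdsSet_iff_forall.1 hV.1 x hx) hV.2⟩

variable [MeasurableSpace E] [BorelSpace E] (μ : Measure E) [μ.IsAddHaarMeasure]

lemma integrable_det_fderiv [Nontrivial E] {M : ℝ≥0} {F : E → E} (hF : LipschitzWith M F)
    (hFs : HasCompactSupport F) : Integrable (fun x => (fderiv ℝ F x).det) μ :=
  integrable_comp_fderiv μ hF hFs (g := fun A => A.det)
      ContinuousLinearMap.continuous_det (by simp [ContinuousLinearMap.det])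

lemma setIntegral_det_sublevel_eq [Nontrivial E] {M P : ℝ≥0} {F : E → E}
    (hF : LipschitzWith M F)
    (hFs : HasCompactSupport F) {D : Set E} (hD : IsOpen D) (hDc : IsCompact (closure D))
    (hdet : ∀ᵐ x ∂μ, x ∈ D → (fderiv ℝ F x).det ≠ 0) (q : E) {p : E → ℝ} (hp : LipschitzWith P p)
    (hph : ∀ t : ℝ, 0 ≤ t → ∀ v, p (t • v) = t * p v)
    (hfr : ∀ x ∈ frontier D, 1 < p (F x - q)) {t : ℝ} (ht : 0 < t) (ht1 : t ≤ 1) :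
    t⁻¹ ^ Module.finrank ℝ E * ∫ x in D ∩ {x | p (F x - q) < t}, (fderiv ℝ F x).det ∂μ =
      ∫ x in D ∩ {x | p (F x - q) < 1}, (fderiv ℝ F x).det ∂μ := by
  set d := Module.finrank ℝ E with hd
  have hcont : Continuous fun x => p (F x - q) :=
    hp.continuous.comp (hF.continuous.sub continuous_const)
  set K := closure D ∩ {x | p (F x - q) ≤ 1} with hKdef
  have hK : IsCompact K := hDc.inter_right (isClosed_le hcont continuous_const)
  have hKD : K ⊆ D := fun x hx => by_contra fun hxD =>
    (hfr x ⟨hx.1, by rwa [hD.interior_eq]⟩).not_ge hx.2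
  obtain ⟨L, η, hη, hηs, hηD, hη1⟩ := exists_lipschitz_cutoff hK hD hKD
  obtain ⟨i1, e1⟩ := integral_det_mul_radial_eq_zero μ hF hFs hD.measurableSet hdet q hp hph ht
    hη hηs hηD
  obtain ⟨i2, e2⟩ := integral_det_mul_radial_eq_zero μ hF hFs hD.measurableSet hdet q hp hph
    one_pos hη hηs hηD
  have hJ : IntegrableOn (fun x => (fderiv ℝ F x).det) D μ :=
    (integrable_det_fderiv μ hF hFs).integrableOn
  have hmeas : ∀ r : ℝ, MeasurableSet {x | p (F x - q) < r} := fun r =>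
    (isOpen_lt hcont continuous_const).measurableSet
  have key : ∫ x in D, (d * (t⁻¹ ^ d * {x | p (F x - q) < t}.indicator
      (fun x => (fderiv ℝ F x).det) x - {x | p (F x - q) < 1}.indicator
      (fun x => (fderiv ℝ F x).det) x)) ∂μ = 0 := by
    refine Eq.trans ?_ ((integral_sub i1 i2).trans ((congrArg₂ (· - ·) e1 e2).trans (sub_self 0)))
    refine setIntegral_congr_fun hD.measurableSet fun x hx => ?_
    rcases le_or_gt (p (F x - q)) 1 with h1 | h1
    · have hxK : x ∈ K := ⟨subset_closure hx, h1⟩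
      have hd0 : fderiv ℝ η x = 0 := by
        rw [(hη1 x hxK).fderiv_eq]; exact fderiv_const_apply _
      have hη1x : η x = 1 := (hη1 x hxK).eq_of_nhds
      simp only [indicator, mem_ofPred_eq, hd0, zero_apply, mul_zero, add_zero, hη1x, mul_one,
        inv_one, one_pow]
      split_ifs <;> ring
    · have ht : t < p (F x - q) := ht1.trans_lt h1
      simp [indicator, h1.not_gt, ht.not_gt, max_eq_right h1.le, max_eq_right ht.le]
  rw [integral_const_mul, integral_sub ((hJ.indicator (hmeas _)).const_mul _)
    (hJ.indicator (hmeas _)), integral_const_mul, setIntegral_indicator (hmeas _),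
    setIntegral_indicator (hmeas _)] at key
  have hd0 : (d : ℝ) ≠ 0 := by exact_mod_cast Module.finrank_pos.ne'
  exact sub_eq_zero.1 ((mul_eq_zero.1 key).resolve_left hd0)

lemma setIntegral_det_ball_eq [Nontrivial E] {M : ℝ≥0} {F : E → E}
    (hF : LipschitzWith M F)
    (hFs : HasCompactSupport F) {D : Set E} (hD : IsOpen D) (hDc : IsCompact (closure D))
    (hdet : ∀ᵐ x ∂μ, x ∈ D → (fderiv ℝ F x).det ≠ 0) {y y₁ : E} {a b : ℝ}
    (ha : 0 < a) (hab : a < b) (hy : ‖y - y₁‖ < b - a)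
    (hfr : ∀ x ∈ frontier D, F x ∉ closedBall y₁ b) :
    a⁻¹ ^ Module.finrank ℝ E * ∫ x in D ∩ F ⁻¹' ball y a, (fderiv ℝ F x).det ∂μ =
      b⁻¹ ^ Module.finrank ℝ E * ∫ x in D ∩ F ⁻¹' ball y₁ b, (fderiv ℝ F x).det ∂μ := by
  have hb : 0 < b := ha.trans hab
  set t : ℝ := a / b with ht
  have ht0 : 0 < t := div_pos ha hb
  have ht1 : t < 1 := (div_lt_one hb).2 hab
  have hta : t * b = a := div_mul_cancel₀ _ hb.ne'
  have h1t : 0 < 1 - t := by linarith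
  set q : E := (1 - t)⁻¹ • (y - t • y₁) with hq
  have hyq : y - t • y₁ = (1 - t) • q := by rw [hq, smul_inv_smul₀ h1t.ne']
  have hqy : q - y₁ = (1 - t)⁻¹ • (y - y₁) := by
    rw [eq_inv_smul_iff₀ h1t.ne', smul_sub, ← hyq, sub_smul, one_smul]; abel
  have hqb : q ∈ ball y₁ b := by
    rw [mem_ball_iff_norm, hqy, norm_smul, norm_inv, Real.norm_of_nonneg h1t.le,
      inv_mul_lt_iff₀ h1t]
    calc _ < b - a := hy
      _ = (1 - t) * b := by rw [← hta]; ring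
  set s : Set E := ball (y₁ - q) b with hs
  have hsc : Convex ℝ s := convex_ball _ _
  have h0s : (0 : E) ∈ s := by
    rw [hs, mem_ball_comm, mem_ball_iff_norm, sub_zero, ← neg_sub, norm_neg]
    exact mem_ball_iff_norm.1 hqb
  have hsn : s ∈ 𝓝 (0 : E) := isOpen_ball.mem_nhds h0s
  obtain ⟨P, hP⟩ := hsc.lipschitz_gauge hsn
  have hph : ∀ r : ℝ, 0 ≤ r → ∀ v, gauge s (r • v) = r * gauge s v := fun r hr v =>
    gauge_smul_of_nonneg hr v
  have hlt1 : ∀ v, gauge s v < 1 ↔ v ∈ s := fun v => by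
    rw [gauge_lt_one_iff_mem_interior hsc hsn, isOpen_ball.interior_eq]
  have hltt : ∀ v, gauge s v < t ↔ t⁻¹ • v ∈ s := fun v => by
    rw [← hlt1, hph _ (inv_nonneg.2 ht0.le), inv_mul_lt_iff₀ ht0, mul_one]
  have hset1 : {x | gauge s (F x - q) < 1} = F ⁻¹' ball y₁ b := by
    ext x
    rw [mem_ofPred_eq, hlt1, mem_preimage, hs, mem_ball_iff_norm, mem_ball_iff_norm,
      sub_sub_sub_cancel_right]
  have hsett : {x | gauge s (F x - q) < t} = F ⁻¹' ball y a := by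
    ext x
    rw [mem_ofPred_eq, hltt, mem_preimage, hs, mem_ball_iff_norm, mem_ball_iff_norm]
    have : F x - y = t • (t⁻¹ • (F x - q) - (y₁ - q)) := by
      rw [smul_sub, smul_inv_smul₀ ht0.ne', smul_sub]
      have : y = t • y₁ + (1 - t) • q := by rw [← hyq]; abel
      rw [this, sub_smul, one_smul]; abel
    rw [this, norm_smul, Real.norm_of_nonneg ht0.le, ← hta, mul_lt_mul_iff_right₀ ht0]
  have hfr' : ∀ x ∈ frontier D, 1 < gauge s (F x - q) := fun x hx => by
    by_contra! h
    rw [gauge_le_one_iff_mem_closure hsc hsn] at h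
    have := closure_ball_subset_closedBall h
    apply hfr x hx
    simpa [dist_eq_norm] using this
  have := setIntegral_det_sublevel_eq μ hF hFs hD hDc hdet q hP hph hfr' ht0 ht1.le
  rw [hset1, hsett] at this
  rw [← this, ← mul_assoc, ← mul_pow, ht]
  congr 2
  field_simp

/-- The weighted preimage of a ball under a proper map with nonvanishing Jacobian is a constant
multiple of the volume of the ball. -/
lemma exists_setIntegral_det_ball_eq_mul [Nontrivial E] {M : ℝ≥0} {F : E → E}
    (hF : LipschitzWith M F)
    (hFs : HasCompactSupport F) {D : Set E} (hD : IsOpen D) (hDc : IsCompact (closure D))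
    (hdet : ∀ᵐ x ∂μ, x ∈ D → (fderiv ℝ F x).det ≠ 0) {Ω : Set E} (hΩ : IsOpen Ω)
    (hΩc : IsPreconnected Ω) (hfr : ∀ x ∈ frontier D, F x ∉ Ω) :
    ∃ m : ℝ, ∀ y a, 0 < a → closedBall y a ⊆ Ω →
      ∫ x in D ∩ F ⁻¹' ball y a, (fderiv ℝ F x).det ∂μ = m * a ^ Module.finrank ℝ E := by
  set d := Module.finrank ℝ E
  set N : E → ℝ → ℝ := fun y a =>
    a⁻¹ ^ d * ∫ x in D ∩ F ⁻¹' ball y a, (fderiv ℝ F x).det ∂μ with hN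
  have hN1 : ∀ {y y₁ a b}, 0 < a → a < b → ‖y - y₁‖ < b - a → closedBall y₁ b ⊆ Ω →
      N y a = N y₁ b := fun ha hab hy hb =>
    setIntegral_det_ball_eq μ hF hFs hD hDc hdet ha hab hy fun x hx h => hfr x hx (hb h)
  have hN2 : ∀ {y a b}, 0 < a → a ≤ b → closedBall y b ⊆ Ω → N y a = N y b := by
    intro y a b ha hab hb
    rcases hab.eq_or_lt with rfl | hab
    · rfl
    · exact hN1 ha hab (by simpa using hab) hb
  have hr : ∀ y : E, ∃ r : ℝ, y ∈ Ω → 0 < r ∧ closedBall y r ⊆ Ω := fun y => by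
    by_cases hy : y ∈ Ω
    · obtain ⟨r, hr, h⟩ := nhds_basis_closedBall.mem_iff.1 (hΩ.mem_nhds hy)
      exact ⟨r, fun _ => ⟨hr, h⟩⟩
    · exact ⟨0, fun h => (hy h).elim⟩
  choose r hr using hr
  have hconst : ∀ y ∈ Ω, ∀ z ∈ Ω, N y (r y) = N z (r z) := by
    intro y hy z hz
    refine hΩc.induction₂' (fun y z => N y (r y) = N z (r z)) (fun y₁ hy₁ => ?_)
      (fun _ _ _ _ _ _ => Eq.trans) hy hz
    obtain ⟨h1, h2⟩ := hr y₁ hy₁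
    filter_upwards [self_mem_nhdsWithin,
      mem_nhdsWithin_of_mem_nhds (ball_mem_nhds y₁ (half_pos h1))] with y hy hyb
    obtain ⟨h3, h4⟩ := hr y hy
    have hpos : 0 < min (r y) (r y₁ / 2) := lt_min h3 (half_pos h1)
    have hle : min (r y) (r y₁ / 2) ≤ r y₁ / 2 := min_le_right _ _
    have : N y (r y) = N y₁ (r y₁) := (hN2 hpos (min_le_left _ _) h4).symm.trans
      (hN1 hpos (by linarith) (by linarith [mem_ball_iff_norm.1 hyb]) h2)
    exact ⟨this.symm, this⟩
  rcases Ω.eq_empty_or_nonempty with rfl | ⟨y₀, hy₀⟩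
  · exact ⟨0, fun y a ha h => (h (mem_closedBall_self ha.le)).elim⟩
  · refine ⟨N y₀ (r y₀), fun y a ha h => ?_⟩
    have hy : y ∈ Ω := h (mem_closedBall_self ha.le)
    obtain ⟨h3, h4⟩ := hr y hy
    have h5 : N y a = N y (r y) := by
      rcases le_total a (r y) with h' | h'
      · exact hN2 ha h' h4
      · exact (hN2 h3 h' h).symm
    rw [hconst y₀ hy₀ y hy, ← h5]
    simp only [hN]
    rw [inv_pow, mul_right_comm, inv_mul_cancel₀ (by positivity),
      one_mul]

end LocalDegree

section LogIntegral

lemma lintegral_Ioc_inv_pow_succ {d : ℕ} {u b : ℝ} (hu : 0 < u) (hub : u ≤ b) :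
    ∫⁻ ρ in Ioc u b, ENNReal.ofReal (d * ρ⁻¹ ^ (d + 1)) =
      ENNReal.ofReal (u⁻¹ ^ d - b⁻¹ ^ d) := by
  have hpos : ∀ ρ ∈ uIcc u b, 0 < ρ := fun ρ hρ => by
    rw [uIcc_of_le hub] at hρ; exact hu.trans_le hρ.1
  have hder : ∀ ρ ∈ uIcc u b, HasDerivAt (fun ρ : ℝ => -ρ⁻¹ ^ d) (d * ρ⁻¹ ^ (d + 1)) ρ := by
    intro ρ hρ
    have h1 := ((hasDerivAt_inv (hpos ρ hρ).ne').fun_pow d).fun_neg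
    have hval : d * ρ⁻¹ ^ (d + 1) = -(d * ρ⁻¹ ^ (d - 1) * -(ρ ^ 2)⁻¹) := by
      cases d with
      | zero => simp
      | succ k => simp only [Nat.add_sub_cancel]; ring
    rw [hval]
    exact h1
  have hint : IntervalIntegrable (fun ρ : ℝ => d * ρ⁻¹ ^ (d + 1)) volume u b := by
    apply ContinuousOn.intervalIntegrable
    exact continuousOn_const.mul ((continuousOn_inv₀.mono fun ρ hρ => (hpos ρ hρ).ne').pow _)
  rw [← ofReal_integral_eq_lintegral_ofReal
      ((intervalIntegrable_iff_integrableOn_Ioc_of_le hub).1 hint)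
      ((ae_restrict_iff' measurableSet_Ioc).2 (Filter.Eventually.of_forall fun ρ hρ => by
        have : 0 < ρ := hu.trans hρ.1
        positivity)),
    ← intervalIntegral.integral_of_le hub,
    intervalIntegral.integral_eq_sub_of_hasDerivAt hder hint]
  congr 1
  ring

lemma lintegral_inv_max_pow_le {X : Type*} [MeasurableSpace X] (ν : Measure X) [SFinite ν]
    {r : X → ℝ} (hr : Measurable r) {d : ℕ} {A s b : ℝ} (hA0 : 0 ≤ A) (hs : 0 < s)
    (hsb : s ≤ b)
    (hA : ∀ ρ, 0 < ρ → ρ ≤ b → ν {x | r x < ρ} ≤ ENNReal.ofReal (A * ρ ^ d)) :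
    ∫⁻ x in {x | r x < b}, ENNReal.ofReal ((max s (r x))⁻¹ ^ d) ∂ν ≤
      ENNReal.ofReal A + ENNReal.ofReal (d * A * Real.log (b / s)) := by
  have hb : 0 < b := hs.trans_le hsb
  set k : ℝ → ℝ≥0∞ := fun ρ => ENNReal.ofReal (d * ρ⁻¹ ^ (d + 1)) with hk
  have hkm : Measurable k := by fun_prop
  have hset : MeasurableSet {x | r x < b} := hr measurableSet_Iio
  have hpt : ∀ x ∈ {x | r x < b}, ENNReal.ofReal ((max s (r x))⁻¹ ^ d) =
      ENNReal.ofReal (b⁻¹ ^ d) + ∫⁻ ρ in Ioc s b, (Ioi (r x)).indicator k ρ := by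
    intro x hx
    have hmb : max s (r x) ≤ b := max_le hsb (le_of_lt hx)
    have hm0 : 0 < max s (r x) := hs.trans_le (le_max_left _ _)
    rw [lintegral_indicator measurableSet_Ioi, Measure.restrict_restrict measurableSet_Ioi,
      inter_comm, Ioc_inter_Ioi, lintegral_Ioc_inv_pow_succ hm0 hmb,
      ← ENNReal.ofReal_add (by positivity), add_sub_cancel]
    exact sub_nonneg.2 (pow_le_pow_left₀ (by positivity) (inv_anti₀ hm0 hmb) _)
  rw [setLIntegral_congr_fun hset hpt, lintegral_add_left measurable_const]
  gcongr ?_ + ?_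
  · rw [setLIntegral_const]
    calc _ ≤ ENNReal.ofReal (b⁻¹ ^ d) * ENNReal.ofReal (A * b ^ d) := by
          gcongr; exact hA b hb le_rfl
      _ = _ := by
          rw [← ENNReal.ofReal_mul (by positivity), inv_pow, mul_comm A, ← mul_assoc,
            inv_mul_cancel₀ (by positivity), one_mul]
  · have hmeas : Measurable (Function.uncurry fun (x : X) (ρ : ℝ) =>
        (Ioi (r x)).indicator k ρ) := by
      have : (Function.uncurry fun (x : X) (ρ : ℝ) => (Ioi (r x)).indicator k ρ) =
          {z : X × ℝ | r z.1 < z.2}.indicator fun z => k z.2 := by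
        ext ⟨x, ρ⟩; simp [indicator]
      rw [this]
      exact (hkm.comp measurable_snd).indicator
        (measurableSet_lt (hr.comp measurable_fst) measurable_snd)
    rw [lintegral_lintegral_swap hmeas.aemeasurable]
    have hstep : ∀ ρ ∈ Ioc s b, ∫⁻ x in {x | r x < b}, (Ioi (r x)).indicator k ρ ∂ν ≤
        ENNReal.ofReal (d * A * ρ⁻¹) := by
      intro ρ hρ
      have hρ0 : 0 < ρ := hs.trans hρ.1
      calc _ ≤ ∫⁻ x, (Ioi (r x)).indicator k ρ ∂ν := setLIntegral_le_lintegral _ _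
        _ = ∫⁻ x, {x | r x < ρ}.indicator (fun _ => k ρ) x ∂ν := by
            simp [indicator]
        _ = k ρ * ν {x | r x < ρ} := lintegral_indicator_const (hr measurableSet_Iio) _
        _ ≤ k ρ * ENNReal.ofReal (A * ρ ^ d) := by gcongr; exact hA ρ hρ0 hρ.2
        _ = _ := by
            rw [hk, ← ENNReal.ofReal_mul (by positivity)]
            congr 1
            rw [inv_pow, pow_succ]
            field_simp
    refine (setLIntegral_mono (by fun_prop) hstep).trans_eq ?_
    have hint : IntervalIntegrable (fun ρ : ℝ => d * A * ρ⁻¹) volume s b := by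
      apply ContinuousOn.intervalIntegrable
      refine continuousOn_const.mul (continuousOn_inv₀.mono fun ρ hρ => ?_)
      rw [uIcc_of_le hsb] at hρ
      exact (hs.trans_le hρ.1).ne'
    rw [← ofReal_integral_eq_lintegral_ofReal
        ((intervalIntegrable_iff_integrableOn_Ioc_of_le hsb).1 hint)
        ((ae_restrict_iff' measurableSet_Ioc).2 (Filter.Eventually.of_forall fun ρ hρ => by
          have : 0 < ρ := hs.trans hρ.1
          positivity)),
      ← intervalIntegral.integral_of_le hsb, intervalIntegral.integral_const_mul,
      integral_inv_of_pos hs hb]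

end LogIntegral

section Multiplicity

variable {E : Type*} [NormedAddCommGroup E] [NormedSpace ℝ E]

/-- Over a ball in the complement of `F '' frontier D`, each point of `D` whose image lies in the
ball is joined to the fibre over the centre through all intermediate distances. -/
lemma exists_norm_sub_eq_of_norm_lt {M : ℝ≥0} {F : E → E} (hF : LipschitzWith M F)
    {D Ω : Set E} (hD : IsOpen D) (hDc : IsCompact (closure D))
    (hfr : ∀ x ∈ frontier D, F x ∉ Ω) (hopen : ∀ V ⊆ D, IsOpen V → IsOpen (F '' V))
    {x z : E} (hx : D ∩ F ⁻¹' {F x} = {x}) {s ρ : ℝ} (hs : ball (F x) s ⊆ Ω) (hz : z ∈ D)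
    (hzs : ‖F z - F x‖ < s) (hρ : 0 < ρ) (hρz : ρ < ‖z - x‖) :
    ∃ w ∈ D, ‖F w - F x‖ < s ∧ ‖w - x‖ = ρ := by
  by_contra! hno
  set W : Set E := D ∩ {w | ρ < ‖w - x‖} ∩ F ⁻¹' ball (F x) s with hW
  set W' : Set E := closure D ∩ {w | ρ ≤ ‖w - x‖} with hW'
  have hWo : IsOpen W := (hD.inter (isOpen_lt continuous_const (by fun_prop))).inter
    (isOpen_ball.preimage hF.continuous)
  have hu : IsOpen (F '' W) := hopen W (inter_subset_left.trans inter_subset_left) hWo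
  have hc : IsClosed (F '' W') :=
    ((hDc.inter_right (isClosed_le continuous_const (by fun_prop))).image
      hF.continuous).isClosed
  have hWW' : W ⊆ W' := fun w hw => ⟨subset_closure hw.1.1, show ρ ≤ ‖w - x‖ from le_of_lt hw.1.2⟩
  have hcover : ball (F x) s ⊆ F '' W ∪ (F '' W')ᶜ := by
    intro y hy
    by_cases h : y ∈ F '' W'
    · obtain ⟨w, hw, rfl⟩ := h
      have hwD : w ∈ D := by_contra fun h =>
        hfr w ⟨hw.1, by rwa [hD.interior_eq]⟩ (hs hy)
      have hws : ‖F w - F x‖ < s := mem_ball_iff_norm.1 hy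
      exact Or.inl ⟨w, ⟨⟨hwD, lt_of_le_of_ne hw.2 (hno w hwD hws).symm⟩, hy⟩, rfl⟩
    · exact Or.inr h
  have hsub := (convex_ball (F x) s).isPreconnected.subset_left_of_subset_union hu
    hc.isOpen_compl (disjoint_compl_right.mono_left (image_mono hWW')) hcover
    ⟨F z, mem_ball_iff_norm.2 hzs, z, ⟨⟨hz, hρz⟩, mem_ball_iff_norm.2 hzs⟩, rfl⟩
  obtain ⟨w, hw, hwx⟩ := hsub (mem_ball_self ((norm_nonneg _).trans_lt hzs))
  have : w ∈ D ∩ F ⁻¹' {F x} := ⟨hw.1.1, hwx⟩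
  rw [hx] at this
  have h2 : ρ < ‖w - x‖ := hw.1.2
  rw [this, sub_self, norm_zero] at h2
  linarith

variable [FiniteDimensional ℝ E] [MeasurableSpace E] [BorelSpace E] (μ : Measure E)
  [μ.IsAddHaarMeasure]

lemma card_mul_addHaar_ball_le [Nontrivial E] {M : ℝ≥0} {F : E → E} (hF : LipschitzWith M F)
    (hFs : HasCompactSupport F) {D Ω : Set E} (hD : IsOpen D)
    (hJ : ∀ᵐ x ∂μ, x ∈ D → 0 ≤ (fderiv ℝ F x).det) (hΩ : IsOpen Ω)
    (hopen : ∀ V ⊆ D, IsOpen V → IsOpen (F '' V)) {m : ℝ}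
    (hm : ∀ y a, 0 < a → closedBall y a ⊆ Ω →
      ∫ x in D ∩ F ⁻¹' ball y a, (fderiv ℝ F x).det ∂μ = m * a ^ Module.finrank ℝ E)
    {y : E} (hy : y ∈ Ω) (S : Finset E) (hS : ∀ x ∈ S, x ∈ D ∧ F x = y) :
    S.card * μ.real (ball 0 1) ≤ m := by
  obtain ⟨u, hu, hdisj⟩ := S.finite_toSet.t2_separation
  have hO : ∀ x ∈ S, F '' (u x ∩ D) ∈ 𝓝 y := fun x hx =>
    (hopen _ inter_subset_right ((hu x).2.inter hD)).mem_nhds ⟨x, ⟨(hu x).1, (hS x hx).1⟩,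
      (hS x hx).2⟩
  have hmem : (Ω ∩ ⋂ x ∈ S, F '' (u x ∩ D)) ∈ 𝓝 y :=
    Filter.inter_mem (hΩ.mem_nhds hy) ((Filter.biInter_finset_mem S).2 hO)
  obtain ⟨a, ha, hsub⟩ := nhds_basis_closedBall.mem_iff.1 hmem
  have hJm : Measurable fun x => (fderiv ℝ F x).det := measurable_det_fderiv F
  have hball : MeasurableSet (F ⁻¹' ball y a) := (isOpen_ball.preimage hF.continuous).measurableSet
  have hle : ∀ x ∈ S, μ (ball y a) ≤
      ∫⁻ x in u x ∩ D ∩ F ⁻¹' ball y a, ENNReal.ofReal |(fderiv ℝ F x).det| ∂μ := by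
    intro x hx
    refine (measure_mono ?_).trans (hF.addHaar_image_le_lintegral μ
      (((hu x).2.inter hD).measurableSet.inter hball))
    intro w hw
    obtain ⟨v, hv, rfl⟩ := mem_iInter₂.1 (hsub (ball_subset_closedBall hw)).2 x hx
    exact ⟨v, ⟨hv, hw⟩, rfl⟩
  have hsum : S.card * μ (ball y a) ≤ ENNReal.ofReal (m * a ^ Module.finrank ℝ E) := by
    rw [← hm y a ha (hsub.trans inter_subset_left)]
    calc (S.card : ℝ≥0∞) * μ (ball y a) = ∑ x ∈ S, μ (ball y a) := by simp
      _ ≤ ∑ x ∈ S, ∫⁻ x in u x ∩ D ∩ F ⁻¹' ball y a, ENNReal.ofReal |(fderiv ℝ F x).det| ∂μ :=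
          Finset.sum_le_sum hle
      _ = ∫⁻ x in ⋃ z ∈ S, (u z ∩ D ∩ F ⁻¹' ball y a), ENNReal.ofReal |(fderiv ℝ F x).det| ∂μ :=
          (lintegral_biUnion_finset
            (hdisj.mono fun x => inter_subset_left.trans inter_subset_left)
            (fun x _ => ((hu x).2.inter hD).measurableSet.inter hball) _).symm
      _ ≤ ∫⁻ x in D ∩ F ⁻¹' ball y a, ENNReal.ofReal |(fderiv ℝ F x).det| ∂μ :=
          lintegral_mono_set (iUnion₂_subset fun x _ => by gcongr; exact inter_subset_right)
      _ = ENNReal.ofReal (∫ x in D ∩ F ⁻¹' ball y a, (fderiv ℝ F x).det ∂μ) := by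
          have h0 : 0 ≤ᵐ[μ.restrict (D ∩ F ⁻¹' ball y a)] fun x => (fderiv ℝ F x).det :=
            (ae_restrict_iff' (hD.measurableSet.inter hball)).2
              (hJ.mono fun x hx h => hx h.1)
          rw [ofReal_integral_eq_lintegral_ofReal
            (integrable_det_fderiv μ hF hFs).integrableOn h0]
          exact lintegral_congr_ae (h0.mono fun x hx => by simp only [abs_of_nonneg hx])
  rw [Measure.addHaar_ball μ y ha.le] at hsum
  have hpow : 0 < a ^ Module.finrank ℝ E := by positivity
  have hreal : (S.card : ℝ≥0∞) * (ENNReal.ofReal (a ^ Module.finrank ℝ E) * μ (ball 0 1)) =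
      ENNReal.ofReal (S.card * μ.real (ball 0 1) * a ^ Module.finrank ℝ E) := by
    rw [ENNReal.ofReal_mul (by positivity), ENNReal.ofReal_mul (by positivity),
      ofReal_measureReal measure_ball_lt_top.ne, ENNReal.ofReal_natCast]
    ring
  rw [hreal] at hsum
  rcases S.eq_empty_or_nonempty with rfl | hSne
  · have : 0 ≤ m * a ^ Module.finrank ℝ E := by
      rw [← hm y a ha (hsub.trans inter_subset_left)]
      exact setIntegral_nonneg_ae (hD.measurableSet.inter hball)
        (hJ.mono fun x hx h => hx h.1)
    simpa using nonneg_of_mul_nonneg_left this hpow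
  · have hα : 0 < μ.real (ball (0 : E) 1) :=
      ENNReal.toReal_pos (measure_ball_pos μ _ one_pos).ne' measure_ball_lt_top.ne
    have hc : (0 : ℝ) < S.card := by exact_mod_cast hSne.card_pos
    exact le_of_mul_le_mul_right ((ENNReal.ofReal_le_ofReal_iff' .. |>.1 hsum).resolve_right
      (by simpa using not_le.2 (by positivity))) hpow

lemma exists_norm_sub_lt_mul_of_norm_lt [Nontrivial E] {M : ℝ≥0} {F : E → E}
    (hF : LipschitzWith M F) (hFs : HasCompactSupport F)
    {D Ω : Set E} (hD : IsOpen D) (hDc : IsCompact (closure D))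
    {c : ℝ} (hc : 0 < c) (hJ : ∀ᵐ x ∂μ, x ∈ D → c ≤ (fderiv ℝ F x).det)
    (hfr : ∀ x ∈ frontier D, F x ∉ Ω) (hopen : ∀ V ⊆ D, IsOpen V → IsOpen (F '' V)) {m : ℝ}
    (hm : ∀ y a, 0 < a → closedBall y a ⊆ Ω →
      ∫ x in D ∩ F ⁻¹' ball y a, (fderiv ℝ F x).det ∂μ = m * a ^ Module.finrank ℝ E)
    {x : E} (hx : D ∩ F ⁻¹' {F x} = {x}) :
    ∃ C : ℝ, 0 < C ∧ ∀ s : ℝ, 0 < s → closedBall (F x) (2 * s) ⊆ Ω →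
      ∀ z ∈ D, ‖F z - F x‖ < s → ‖z - x‖ < C * s := by
  set d := Module.finrank ℝ E
  set A : ℝ := M + 1 with hA
  have hA0 : 0 < A := by positivity
  have hα : 0 < μ.real (ball (0 : E) 1) :=
    ENNReal.toReal_pos (measure_ball_pos μ _ one_pos).ne' measure_ball_lt_top.ne
  obtain ⟨k, hk⟩ := exists_nat_gt (m * (2 * A) ^ d / (c * μ.real (ball (0 : E) 1)))
  refine ⟨2 * k / A + 1, by positivity, fun s hs hsΩ z hz hzs => ?_⟩
  by_contra! hfar
  set δ := s / A with hδ
  have hδ0 : 0 < δ := div_pos hs hA0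
  have hkz : 2 * k * δ < ‖z - x‖ := by
    refine lt_of_lt_of_le ?_ hfar
    rw [hδ, add_mul, one_mul, div_mul_eq_mul_div, mul_div_assoc]
    linarith
  have hw : ∀ j : ℕ, ∃ w, j ∈ Finset.Icc 1 k → w ∈ D ∧ ‖F w - F x‖ < s ∧
      ‖w - x‖ = 2 * j * δ := fun j => by
    by_cases hj : j ∈ Finset.Icc 1 k
    · obtain ⟨h1, h2⟩ := Finset.mem_Icc.1 hj
      have h1' : (1 : ℝ) ≤ j := by exact_mod_cast h1
      have h2' : (j : ℝ) ≤ k := by exact_mod_cast h2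
      obtain ⟨w, hw⟩ := exists_norm_sub_eq_of_norm_lt hF hD hDc hfr hopen hx
        ((ball_subset_ball (by linarith)).trans (ball_subset_closedBall.trans hsΩ)) hz hzs
        (show 0 < 2 * j * δ by positivity)
        (lt_of_le_of_lt (by gcongr) hkz)
      exact ⟨w, fun _ => hw⟩
    · exact ⟨0, fun h => (hj h).elim⟩
  choose w hw using hw
  have hmaps : ∀ j ∈ Finset.Icc 1 k, ball (w j) δ ⊆ F ⁻¹' ball (F x) (2 * s) := by
    intro j hj v hv
    obtain ⟨h1, h2, h3⟩ := hw j hj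
    have h4 := hF.dist_le_mul v (w j)
    have h5 : M * dist v (w j) ≤ A * δ :=
      mul_le_mul (by simp [hA]) (mem_ball.1 hv).le dist_nonneg hA0.le
    rw [hδ, mul_div_cancel₀ _ hA0.ne'] at h5
    have := dist_triangle (F v) (F (w j)) (F x)
    rw [← dist_eq_norm] at h2
    rw [mem_preimage, mem_ball]
    linarith
  have hsubD : ∀ j ∈ Finset.Icc 1 k, ball (w j) δ ⊆ D := by
    intro j hj
    obtain ⟨h1, h2, h3⟩ := hw j hj
    refine (convex_ball (w j) δ).isPreconnected.subset_left_of_subset_union hD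
      isClosed_closure.isOpen_compl (disjoint_compl_right.mono_left subset_closure)
      (fun v hv => ?_) ⟨w j, mem_ball_self hδ0, h1⟩
    by_contra h
    rw [mem_union, not_or, mem_compl_iff, not_not] at h
    exact hfr v ⟨h.2, by rw [hD.interior_eq]; exact h.1⟩
      (hsΩ (ball_subset_closedBall (hmaps j hj hv)))
  have hdisj : (Finset.Icc 1 k : Set ℕ).PairwiseDisjoint fun j => ball (w j) δ := by
    intro i hi j hj hij
    apply ball_disjoint_ball
    obtain ⟨-, -, h3⟩ := hw i hi
    obtain ⟨-, -, h4⟩ := hw j hj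
    have h5 := abs_norm_sub_norm_le (w i - x) (w j - x)
    rw [sub_sub_sub_cancel_right, h3, h4, ← dist_eq_norm, ← sub_mul, ← mul_sub, abs_mul,
      abs_mul, abs_of_pos hδ0, abs_two] at h5
    have h6 : (1 : ℝ) ≤ |(i : ℝ) - j| := by
      have : (1 : ℤ) ≤ |(i : ℤ) - j| := Int.one_le_abs (sub_ne_zero.2 (by exact_mod_cast hij))
      exact_mod_cast this
    nlinarith
  set G : Set E := ⋃ j ∈ Finset.Icc 1 k, ball (w j) δ with hG
  have hGm : MeasurableSet G := Finset.measurableSet_biUnion _ fun j _ => measurableSet_ball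
  have hGsub : G ⊆ D ∩ F ⁻¹' ball (F x) (2 * s) :=
    iUnion₂_subset fun j hj => subset_inter (hsubD j hj) (hmaps j hj)
  have hDG : MeasurableSet (D ∩ F ⁻¹' ball (F x) (2 * s)) :=
    hD.measurableSet.inter (isOpen_ball.preimage hF.continuous).measurableSet
  have hμG : μ.real G = k * (δ ^ d * μ.real (ball 0 1)) := by
    rw [hG, measureReal_biUnion_finset hdisj (fun j _ => measurableSet_ball)
      (fun j _ => measure_ball_lt_top.ne)]
    simp [measureReal_def, Measure.addHaar_ball μ _ hδ0.le, ENNReal.toReal_ofReal, hδ0.le, d]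
  have hGfin : μ G ≠ ∞ :=
    (measure_mono (hGsub.trans (inter_subset_left.trans subset_closure))).trans_lt
      hDc.measure_lt_top |>.ne
  have hJi := integrable_det_fderiv μ hF hFs
  have hle : c * μ.real G ≤ m * (2 * s) ^ d := by
    rw [← hm (F x) (2 * s) (by positivity) hsΩ]
    calc c * μ.real G = ∫ _ in G, c ∂μ := by simp [mul_comm]
      _ ≤ ∫ x in G, (fderiv ℝ F x).det ∂μ :=
          setIntegral_mono_on_ae (integrableOn_const hGfin) hJi.integrableOn hGm
            (hJ.mono fun x hx h => hx (hGsub h).1)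
      _ ≤ _ := setIntegral_mono_set hJi.integrableOn
          ((ae_restrict_iff' hDG).2 (hJ.mono fun x hx h => hc.le.trans (hx h.1)))
          hGsub.eventuallyLE
  rw [hμG, div_lt_iff₀ (by positivity)] at *
  have hsA : s = δ * A := (div_mul_cancel₀ _ hA0.ne').symm
  have : m * (2 * s) ^ d = m * (2 * A) ^ d * δ ^ d := by
    rw [hsA, mul_pow, mul_pow, mul_pow]; ring
  rw [this] at hle
  have h7 : k * (c * μ.real (ball (0 : E) 1)) * δ ^ d ≤ m * (2 * A) ^ d * δ ^ d := by
    linarith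
  exact absurd (le_of_mul_le_mul_right h7 (by positivity)) (not_le.2 hk)

end Multiplicity

section LogCutoff

lemma mul_le_add_of_pow_le_mul_pow {d : ℕ} (hd : d ≠ 0) {T X Y : ℝ} (hT : 0 ≤ T) (hX : 0 ≤ X)
    (hY : 0 ≤ Y) (h : T ^ d ≤ X * Y ^ (d - 1)) : d * T ≤ X + (d - 1) * Y := by
  have hd0 : (0 : ℝ) < d := by exact_mod_cast hd.bot_lt
  have hd1 : (1 : ℝ) ≤ d := by exact_mod_cast Nat.one_le_iff_ne_zero.2 hd
  have h1 : T ≤ X ^ ((d : ℝ)⁻¹) * Y ^ ((d - 1 : ℝ) * (d : ℝ)⁻¹) := by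
    rw [Real.rpow_mul hY, ← Real.mul_rpow hX (by positivity)]
    rw [show ((d : ℝ) - 1) = ((d - 1 : ℕ) : ℝ) by
      rw [Nat.cast_sub (Nat.one_le_iff_ne_zero.2 hd), Nat.cast_one], Real.rpow_natCast]
    calc T = (T ^ d) ^ ((d : ℝ)⁻¹) := (Real.pow_rpow_inv_natCast hT hd).symm
      _ ≤ _ := by gcongr
  have h2 := Real.geom_mean_le_arith_mean2_weighted (w₁ := (d : ℝ)⁻¹)
    (w₂ := (d - 1 : ℝ) * (d : ℝ)⁻¹) (by positivity)
    (mul_nonneg (by linarith) (by positivity)) hX hY (by field_simp; ring)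
  calc d * T ≤ d * ((d : ℝ)⁻¹ * X + (d - 1 : ℝ) * (d : ℝ)⁻¹ * Y) := by
        gcongr; exact h1.trans h2
    _ = _ := by field_simp

lemma abs_log_sub_log_le {t u v : ℝ} (ht : 0 < t) (hu : t ≤ u) (hv : t ≤ v) :
    |Real.log u - Real.log v| ≤ t⁻¹ * |u - v| := by
  wlog huv : v ≤ u generalizing u v
  · rw [abs_sub_comm, abs_sub_comm u]
    exact this hv hu (le_of_not_ge huv)
  have hv0 : 0 < v := ht.trans_le hv
  have hu0 : 0 < u := ht.trans_le hu
  rw [abs_of_nonneg (sub_nonneg.2 (Real.log_le_log hv0 huv)), abs_of_nonneg (sub_nonneg.2 huv),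
    ← Real.log_div hu0.ne' hv0.ne']
  calc _ ≤ u / v - 1 := Real.log_le_sub_one_of_pos (div_pos hu0 hv0)
    _ = v⁻¹ * (u - v) := by field_simp
    _ ≤ _ := by gcongr

variable {E : Type*} [NormedAddCommGroup E]

/-- The function `x' ↦ log (R / ‖x' - x‖)`, truncated to be constant for `‖x' - x‖ ≤ r` and zero
for `‖x' - x‖ ≥ R`. -/
noncomputable def logCutoff (x : E) (r R : ℝ) (x' : E) : ℝ :=
  Real.log R - Real.log (max r (min R ‖x' - x‖))

variable {x x' : E} {r R : ℝ}

lemma logCutoff_of_le (hrR : r ≤ R) (h : ‖x' - x‖ ≤ r) :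
    logCutoff x r R x' = Real.log R - Real.log r := by
  rw [logCutoff, min_eq_right (h.trans hrR), max_eq_left h]

lemma logCutoff_of_ge (hrR : r ≤ R) (h : R ≤ ‖x' - x‖) : logCutoff x r R x' = 0 := by
  rw [logCutoff, min_eq_left h, max_eq_right hrR, sub_self]

lemma lipschitzWith_max_min_norm_sub (x : E) (r R : ℝ) :
    LipschitzWith 1 fun x' : E => max r (min R ‖x' - x‖) := by
  have : LipschitzWith 1 fun x' : E => ‖x' - x‖ := by
    simpa [dist_eq_norm] using LipschitzWith.dist_left x
  exact (this.const_min R).const_max r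

lemma lipschitzWith_logCutoff (x : E) (hr : 0 < r) (R : ℝ) :
    LipschitzWith ⟨r⁻¹, by positivity⟩ (logCutoff x r R) := by
  refine LipschitzWith.of_dist_le_mul fun y z => ?_
  rw [Real.dist_eq, logCutoff, logCutoff, sub_sub_sub_cancel_left, abs_sub_comm]
  refine (abs_log_sub_log_le hr (le_max_left _ _) (le_max_left _ _)).trans ?_
  have := (lipschitzWith_max_min_norm_sub x r R).dist_le_mul y z
  rw [Real.dist_eq, NNReal.coe_one, one_mul] at this
  exact mul_le_mul_of_nonneg_left this (by positivity)

lemma tsupport_logCutoff_subset (x : E) (hrR : r ≤ R) :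
    tsupport (logCutoff x r R) ⊆ closedBall x R :=
  closure_minimal (fun y hy => by
    by_contra h
    rw [mem_closedBall_iff_norm, not_le] at h
    exact hy (logCutoff_of_ge hrR h.le)) isClosed_closedBall

variable [NormedSpace ℝ E]

lemma fderiv_logCutoff_of_lt (hrR : r ≤ R) (h : R < ‖x' - x‖) :
    fderiv ℝ (logCutoff x r R) x' = 0 :=
  fderiv_eq_zero_of_notMem_tsupport fun hx => by
    have := mem_closedBall_iff_norm.1 (tsupport_logCutoff_subset x hrR hx)
    linarith

lemma norm_fderiv_logCutoff_le (hr : 0 < r) (h : ‖x' - x‖ ≤ R) :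
    ‖fderiv ℝ (logCutoff x r R) x'‖ ≤ (max r ‖x' - x‖)⁻¹ := by
  set u : E → ℝ := fun y => max r (min R ‖y - x‖) with hu
  have hux : u x' = max r ‖x' - x‖ := by simp [hu, min_eq_right h]
  have hu0 : 0 < u x' := hr.trans_le (le_max_left _ _)
  rw [← hux]
  have hlip := lipschitzWith_max_min_norm_sub x r R
  have key : ∀ t, 0 < t → t < u x' → ‖fderiv ℝ (logCutoff x r R) x'‖ ≤ t⁻¹ := by
    intro t ht htu
    apply norm_fderiv_le_of_lip' ℝ (by positivity)
    filter_upwards [hlip.continuous.continuousAt.eventually (lt_mem_nhds htu)] with y hy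
    rw [Real.norm_eq_abs, logCutoff, logCutoff, sub_sub_sub_cancel_left, abs_sub_comm]
    refine (abs_log_sub_log_le ht (le_of_lt hy) htu.le).trans ?_
    have := hlip.dist_le_mul y x'
    rw [Real.dist_eq, NNReal.coe_one, one_mul, dist_eq_norm] at this
    exact mul_le_mul_of_nonneg_left this (by positivity)
  refine ge_of_tendsto (((continuousAt_inv₀ hu0.ne').tendsto).mono_left
    (nhdsWithin_le_nhds (s := Iio (u x')))) ?_
  filter_upwards [self_mem_nhdsWithin, mem_nhdsWithin_of_mem_nhds (lt_mem_nhds hu0)] with t h1 h2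
  exact key t h2 h1

end LogCutoff

section DegreeBound

variable {E : Type*} [NormedAddCommGroup E] [NormedSpace ℝ E] [FiniteDimensional ℝ E]
  [MeasurableSpace E] [BorelSpace E] (μ : Measure E) [μ.IsAddHaarMeasure]

lemma lintegral_ball_inv_max_norm_pow_le [Nontrivial E] (x : E) {s b : ℝ} (hs : 0 < s)
    (hsb : s ≤ b) :
    ∫⁻ x' in {x' | ‖x' - x‖ < b},
      ENNReal.ofReal ((max s ‖x' - x‖)⁻¹ ^ Module.finrank ℝ E) ∂μ ≤
      ENNReal.ofReal (μ.real (ball (0 : E) 1)) + ENNReal.ofReal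
        (Module.finrank ℝ E * μ.real (ball (0 : E) 1) * Real.log (b / s)) := by
  refine lintegral_inv_max_pow_le μ (by fun_prop) measureReal_nonneg hs hsb fun ρ hρ _ => ?_
  have : {x' | ‖x' - x‖ < ρ} = ball x ρ := by ext; simp [dist_eq_norm]
  rw [this, Measure.addHaar_ball μ x hρ.le, ENNReal.ofReal_mul measureReal_nonneg,
    ofReal_measureReal measure_ball_lt_top.ne, mul_comm]

lemma lintegral_det_mul_inv_max_norm_pow_le [Nontrivial E] {M : ℝ≥0} {F : E → E}
    (hF : LipschitzWith M F) (hFs : HasCompactSupport F) {D Ω : Set E} (hD : IsOpen D)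
    (hJ : ∀ᵐ x ∂μ, x ∈ D → 0 ≤ (fderiv ℝ F x).det) {m : ℝ} (hm0 : 0 ≤ m)
    (hm : ∀ y a, 0 < a → closedBall y a ⊆ Ω →
      ∫ x in D ∩ F ⁻¹' ball y a, (fderiv ℝ F x).det ∂μ = m * a ^ Module.finrank ℝ E)
    {q : E} {s b : ℝ} (hb : closedBall q b ⊆ Ω) (hs : 0 < s) (hsb : s ≤ b) :
    ∫⁻ x' in {x' | ‖F x' - q‖ < b} ∩ D, ENNReal.ofReal ((fderiv ℝ F x').det *
      (max s ‖F x' - q‖)⁻¹ ^ Module.finrank ℝ E) ∂μ ≤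
      ENNReal.ofReal m + ENNReal.ofReal (Module.finrank ℝ E * m * Real.log (b / s)) := by
  have hJm : Measurable fun x => ENNReal.ofReal (fderiv ℝ F x).det :=
    (measurable_det_fderiv F).ennreal_ofReal
  have hr : Measurable fun x' => ‖F x' - q‖ := (hF.continuous.sub continuous_const).norm.measurable
  have hset : ∀ ρ : ℝ, MeasurableSet {x' | ‖F x' - q‖ < ρ} := fun ρ => hr measurableSet_Iio
  have := lintegral_inv_max_pow_le
    ((μ.restrict D).withDensity fun x => ENNReal.ofReal (fderiv ℝ F x).det) hr
    (d := Module.finrank ℝ E) hm0 hs hsb fun ρ hρ hρb => by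
      have hset' : {x' | ‖F x' - q‖ < ρ} = F ⁻¹' ball q ρ := by ext; simp [dist_eq_norm]
      rw [withDensity_apply _ (hset ρ), Measure.restrict_restrict (hset ρ), inter_comm, hset',
        ← hm q ρ hρ ((closedBall_subset_closedBall hρb).trans hb),
        ofReal_integral_eq_lintegral_ofReal (integrable_det_fderiv μ hF hFs).integrableOn]
      exact (ae_restrict_iff' (hD.measurableSet.inter (hset' ▸ hset ρ))).2
        (hJ.mono fun x hx h => hx h.1)
  rw [setLIntegral_withDensity_eq_setLIntegral_mul _ hJm (by fun_prop) (hset b),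
    Measure.restrict_restrict (hset b)] at this
  refine le_trans (le_of_eq ?_) this
  refine setLIntegral_congr_fun_ae ((hset b).inter hD.measurableSet) ?_
  filter_upwards [hJ] with x' hx' h
  rw [Pi.mul_apply, ENNReal.ofReal_mul (hx' h.2)]

lemma mul_log_le_of_cofactor_bound [Nontrivial E] {M : ℝ≥0} {F : E → E}
    (hF : LipschitzWith M F) (hFs : HasCompactSupport F) {D Ω : Set E} (hD : IsOpen D)
    (hJ : ∀ᵐ x ∂μ, x ∈ D → 0 < (fderiv ℝ F x).det) {m : ℝ} (hm0 : 0 ≤ m)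
    (hm : ∀ y a, 0 < a → closedBall y a ⊆ Ω →
      ∫ x in D ∩ F ⁻¹' ball y a, (fderiv ℝ F x).det ∂μ = m * a ^ Module.finrank ℝ E)
    {x : E} {K : ℝ} (hK : 0 ≤ K) {N : E → ℝ} (hN0 : ∀ x, 0 ≤ N x)
    (hN : ∀ᵐ x' ∂μ, x' ∈ D → N x' ^ Module.finrank ℝ E ≤
      K * (fderiv ℝ F x').det ^ (Module.finrank ℝ E - 1))
    (hNz : ∀ᵐ x' ∂μ, x' ∈ D → ∀ l : E →L[ℝ] ℝ,
      |(fderiv ℝ F x').det * l (pullbackRadial F (F x) x')| ≤ N x' * ‖l‖ * ‖F x' - F x‖)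
    {s r b R : ℝ} (hs : 0 < s) (hr : 0 < r) (hrR : r ≤ R) (hsb : s ≤ b)
    (hR : closedBall x R ⊆ D) (hb : closedBall (F x) b ⊆ Ω)
    (hRb : ∀ x' ∈ closedBall x R, ‖F x' - F x‖ < b)
    (hsr : ∀ x' ∈ D, ‖F x' - F x‖ < s → ‖x' - x‖ < r) :
    Module.finrank ℝ E * (Module.finrank ℝ E * m * Real.log (R / r)) ≤
      K * (μ.real (ball (0 : E) 1) + Module.finrank ℝ E * μ.real (ball (0 : E) 1) *
        Real.log (R / r)) +
      (Module.finrank ℝ E - 1) * (m + Module.finrank ℝ E * m * Real.log (b / s)) := by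
  set d := Module.finrank ℝ E with hd
  have hd0 : d ≠ 0 := Module.finrank_pos.ne'
  have hdr : (0 : ℝ) < d := by exact_mod_cast hd0.bot_lt
  have hd1 : (1 : ℝ) ≤ d := by exact_mod_cast Nat.one_le_iff_ne_zero.2 hd0
  set α := μ.real (ball (0 : E) 1) with hα
  have hα0 : 0 ≤ α := measureReal_nonneg
  set η := logCutoff x r R with hη
  have hR0 : 0 < R := hr.trans_le hrR
  have hηts : tsupport η ⊆ closedBall x R := tsupport_logCutoff_subset x hrR
  have hηs : HasCompactSupport η :=
    (isCompact_closedBall x R).of_isClosed_subset (isClosed_tsupport _) hηts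
  have hLR : 0 ≤ Real.log (R / r) := Real.log_nonneg ((one_le_div hr).2 hrR)
  have hLb : 0 ≤ Real.log (b / s) := Real.log_nonneg ((one_le_div hs).2 hsb)
  obtain ⟨hi, he⟩ := integral_det_mul_radial_eq_zero μ hF hFs hD.measurableSet
    (hJ.mono fun x hx h => (hx h).ne') (F x) lipschitzWith_one_norm
    (fun t ht v => by rw [norm_smul, Real.norm_of_nonneg ht]) hs (lipschitzWith_logCutoff x hr R)
    hηs (hηts.trans hR)
  set h : E → ℝ := fun x' => (fderiv ℝ F x').det *
    ((max s ‖F x' - F x‖)⁻¹ ^ d * fderiv ℝ η x' (pullbackRadial F (F x) x')) with hh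
  have hJi := integrable_det_fderiv μ hF hFs
  have hsm : MeasurableSet (F ⁻¹' ball (F x) s) :=
    (isOpen_ball.preimage hF.continuous).measurableSet
  have hcongr : ∀ x' ∈ D, (fderiv ℝ F x').det *
      ((if ‖F x' - F x‖ < s then d * s⁻¹ ^ d * η x' else 0) +
      (max s ‖F x' - F x‖)⁻¹ ^ d * fderiv ℝ η x' (pullbackRadial F (F x) x')) =
      (F ⁻¹' ball (F x) s).indicator
        (fun x' => d * s⁻¹ ^ d * Real.log (R / r) * (fderiv ℝ F x').det) x' + h x' := by
    intro x' hx'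
    by_cases hlt : ‖F x' - F x‖ < s
    · rw [indicator_of_mem (show x' ∈ F ⁻¹' ball (F x) s from mem_ball_iff_norm.2 hlt),
        if_pos hlt, hη, logCutoff_of_le hrR (hsr x' hx' hlt).le, Real.log_div hR0.ne' hr.ne', hh]
      ring
    · rw [indicator_of_notMem (show x' ∉ F ⁻¹' ball (F x) s from fun h' =>
        hlt (mem_ball_iff_norm.1 h')), if_neg hlt, hh]
      ring
  rw [setIntegral_congr_fun hD.measurableSet hcongr] at he
  have hi1 : IntegrableOn ((F ⁻¹' ball (F x) s).indicator
      fun x' => d * s⁻¹ ^ d * Real.log (R / r) * (fderiv ℝ F x').det) D μ :=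
    ((hJi.const_mul _).integrableOn).indicator hsm
  have hi2 : IntegrableOn h D μ := by
    refine (((integrableOn_congr_fun hcongr hD.measurableSet).1 hi).sub hi1).congr
      (Filter.Eventually.of_forall fun x' => ?_)
    simp
  have hint : ∫ x' in D, h x' ∂μ = -(d * m * Real.log (R / r)) := by
    rw [integral_add hi1 hi2, setIntegral_indicator hsm, integral_const_mul,
      hm (F x) s hs ((closedBall_subset_closedBall hsb).trans hb)] at he
    have : d * s⁻¹ ^ d * Real.log (R / r) * (m * s ^ d) = d * m * Real.log (R / r) := by
      rw [inv_pow]; field_simp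
    linarith
  have hpt : ∀ᵐ x' ∂μ.restrict D, d * |h x'| ≤
      {x' | ‖x' - x‖ < R}.indicator (fun x' => K * (max r ‖x' - x‖)⁻¹ ^ d) x' +
      {x' | ‖F x' - F x‖ < b}.indicator (fun x' => (d - 1) * ((fderiv ℝ F x').det *
        (max s ‖F x' - F x‖)⁻¹ ^ d)) x' := by
    rw [ae_restrict_iff' hD.measurableSet]
    filter_upwards [hJ, hN, hNz, measure_eq_zero_iff_ae_notMem.1 (Measure.addHaar_sphere μ x R)]
      with x' h1 h2 h3 h4 hx'
    have hJ0 := h1 hx'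
    rcases lt_or_ge ‖x' - x‖ R with hlt | hge
    · rw [indicator_of_mem (show x' ∈ {x' | ‖x' - x‖ < R} from hlt), indicator_of_mem
        (show x' ∈ {x' | ‖F x' - F x‖ < b} from hRb x' (mem_closedBall_iff_norm.2 hlt.le))]
      set v := max s ‖F x' - F x‖ with hv
      set u := max r ‖x' - x‖ with hu
      have hv0 : 0 < v := hs.trans_le (le_max_left _ _)
      have hu0 : 0 < u := hr.trans_le (le_max_left _ _)
      have hle : |h x'| ≤ N x' * u⁻¹ * v⁻¹ ^ (d - 1) := by
        have : h x' = v⁻¹ ^ d * ((fderiv ℝ F x').det *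
            fderiv ℝ η x' (pullbackRadial F (F x) x')) := by
          simp only [hh]; ring
        rw [this, abs_mul, abs_of_nonneg (by positivity)]
        calc _ ≤ v⁻¹ ^ d * (N x' * ‖fderiv ℝ η x'‖ * ‖F x' - F x‖) := by
              gcongr; exact h3 hx' _
          _ ≤ v⁻¹ ^ d * (N x' * u⁻¹ * v) := by
              gcongr
              · exact mul_nonneg (hN0 _) (by positivity)
              · exact hN0 _
              · exact norm_fderiv_logCutoff_le hr hlt.le
              · exact le_max_right _ _
          _ = _ := by
              rw [← pow_sub_one_mul hd0]
              field_simp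
      have hyoung := mul_le_add_of_pow_le_mul_pow hd0 (T := N x' * u⁻¹ * v⁻¹ ^ (d - 1))
        (X := K * u⁻¹ ^ d) (Y := (fderiv ℝ F x').det * v⁻¹ ^ d)
        (mul_nonneg (mul_nonneg (hN0 _) (by positivity)) (by positivity)) (by positivity)
        (by positivity) (by
          calc _ = N x' ^ d * (u⁻¹ ^ d * (v⁻¹ ^ d) ^ (d - 1)) := by
                rw [mul_pow, mul_pow, ← pow_mul, ← pow_mul, mul_comm d]; ring
            _ ≤ K * (fderiv ℝ F x').det ^ (d - 1) * (u⁻¹ ^ d * (v⁻¹ ^ d) ^ (d - 1)) := by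
                gcongr; exact h2 hx'
            _ = _ := by rw [mul_pow _ (v⁻¹ ^ d)]; ring)
      exact (mul_le_mul_of_nonneg_left hle hdr.le).trans hyoung
    · have hgt : R < ‖x' - x‖ := lt_of_le_of_ne hge fun h' => h4 (mem_sphere_iff_norm.2 h'.symm)
      have : h x' = 0 := by simp only [hh, hη, fderiv_logCutoff_of_lt hrR hgt]; simp
      rw [this, abs_zero, mul_zero]
      refine add_nonneg (indicator_nonneg (fun y _ => ?_) _) ?_
      · have : 0 < max r ‖y - x‖ := hr.trans_le (le_max_left _ _)
        positivity
      · refine indicator_apply_nonneg fun _ => mul_nonneg (by linarith) ?_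
        have : 0 < max s ‖F x' - F x‖ := hs.trans_le (le_max_left _ _)
        positivity
  have hm1 : MeasurableSet {x' | ‖x' - x‖ < R} :=
    (isOpen_lt (by fun_prop) continuous_const).measurableSet
  have hm2 : MeasurableSet {x' | ‖F x' - F x‖ < b} :=
    (isOpen_lt (hF.continuous.sub continuous_const).norm continuous_const).measurableSet
  have hmain : ENNReal.ofReal (d * (d * m * Real.log (R / r))) ≤
      ENNReal.ofReal K * (ENNReal.ofReal α + ENNReal.ofReal (d * α * Real.log (R / r))) +
      ENNReal.ofReal (d - 1) * (ENNReal.ofReal m + ENNReal.ofReal (d * m * Real.log (b / s))) := by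
    calc ENNReal.ofReal (d * (d * m * Real.log (R / r)))
        = ENNReal.ofReal d * ‖∫ x' in D, h x' ∂μ‖ₑ := by
          rw [hint, enorm_neg, Real.enorm_of_nonneg (by positivity),
            ENNReal.ofReal_mul (by positivity)]
      _ ≤ ENNReal.ofReal d * ∫⁻ x' in D, ‖h x'‖ₑ ∂μ := by
          gcongr; exact enorm_integral_le_lintegral_enorm _
      _ = ∫⁻ x' in D, ENNReal.ofReal (d * |h x'|) ∂μ := by
          rw [← lintegral_const_mul' _ _ ENNReal.ofReal_ne_top]
          refine lintegral_congr fun x' => ?_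
          rw [ENNReal.ofReal_mul hdr.le, Real.enorm_eq_ofReal_abs]
      _ ≤ ∫⁻ x' in D, ({x' | ‖x' - x‖ < R}.indicator
            (fun x' => ENNReal.ofReal K * ENNReal.ofReal ((max r ‖x' - x‖)⁻¹ ^ d)) x' +
          {x' | ‖F x' - F x‖ < b}.indicator (fun x' => ENNReal.ofReal (d - 1) *
            ENNReal.ofReal ((fderiv ℝ F x').det * (max s ‖F x' - F x‖)⁻¹ ^ d)) x') ∂μ := by
          refine lintegral_mono_ae (hpt.mono fun x' hx' => ?_)
          refine (ENNReal.ofReal_le_ofReal hx').trans (ENNReal.ofReal_add_le.trans (le_of_eq ?_))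
          congr 1
          · simp only [indicator]
            split_ifs
            · rw [ENNReal.ofReal_mul hK]
            · simp
          · simp only [indicator]
            split_ifs
            · rw [ENNReal.ofReal_mul (by linarith)]
            · simp
      _ = ENNReal.ofReal K * ∫⁻ x' in {x' | ‖x' - x‖ < R} ∩ D,
            ENNReal.ofReal ((max r ‖x' - x‖)⁻¹ ^ d) ∂μ +
          ENNReal.ofReal (d - 1) * ∫⁻ x' in {x' | ‖F x' - F x‖ < b} ∩ D,
            ENNReal.ofReal ((fderiv ℝ F x').det * (max s ‖F x' - F x‖)⁻¹ ^ d) ∂μ := by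
          rw [lintegral_add_left (Measurable.indicator (by fun_prop) hm1),
            lintegral_indicator hm1, lintegral_indicator hm2, Measure.restrict_restrict hm1,
            Measure.restrict_restrict hm2, lintegral_const_mul' _ _ ENNReal.ofReal_ne_top,
            lintegral_const_mul' _ _ ENNReal.ofReal_ne_top]
      _ ≤ _ := by
          gcongr
          · exact (lintegral_mono_set inter_subset_left).trans
              (lintegral_ball_inv_max_norm_pow_le μ x hr hrR)
          · exact lintegral_det_mul_inv_max_norm_pow_le μ hF hFs hD
              (hJ.mono fun x hx h => (hx h).le) hm0 hm hb hs hsb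
  rw [← ENNReal.ofReal_add hα0 (by positivity), ← ENNReal.ofReal_add hm0 (by positivity),
    ← ENNReal.ofReal_mul hK, ← ENNReal.ofReal_mul (by linarith),
    ← ENNReal.ofReal_add (by positivity) (mul_nonneg (by linarith) (by positivity))] at hmain
  exact (ENNReal.ofReal_le_ofReal_iff
    (add_nonneg (by positivity) (mul_nonneg (by linarith) (by positivity)))).1 hmain

end DegreeBound

section Multiplicity

variable {E : Type*} [NormedAddCommGroup E] [NormedSpace ℝ E] [FiniteDimensional ℝ E]
  [MeasurableSpace E] [BorelSpace E] (μ : Measure E) [μ.IsAddHaarMeasure]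

/-- Letting `s → 0` with `r = C * s` in the integral estimate compares the leading logarithmic
terms. -/
lemma le_mul_of_mul_log_le {d m K α C b R : ℝ} (hd : 0 < d) (hC : 0 < C) (hb : 0 < b) (hR : 0 < R)
    (h : ∀ s, 0 < s → s ≤ b → C * s ≤ R →
      d * (d * m * Real.log (R / (C * s))) ≤ K * (α + d * α * Real.log (R / (C * s))) +
        (d - 1) * (m + d * m * Real.log (b / s))) :
    m ≤ K * α := by
  by_contra! hlt
  have hδ : 0 < d * (m - K * α) := mul_pos hd (sub_pos.2 hlt)
  set A := Real.log (R / C) with hA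
  set B := Real.log b with hB
  set Q := K * (α + d * α * A) + (d - 1) * (m + d * m * B) - d * (d * m * A) with hQ
  obtain ⟨l, hl1, hl2, hl3⟩ : ∃ l, -A ≤ l ∧ -B ≤ l ∧ Q / (d * (m - K * α)) < l :=
    ⟨max (-A) (max (-B) (Q / (d * (m - K * α)) + 1)), le_max_left _ _,
      (le_max_left _ _).trans (le_max_right _ _),
      (lt_add_one _).trans_le ((le_max_right _ _).trans (le_max_right _ _))⟩
  have hs := Real.exp_pos (-l)
  have h1 : Real.log (R / (C * Real.exp (-l))) = A + l := by
    rw [← div_div, Real.log_div (by positivity) hs.ne', Real.log_exp, sub_neg_eq_add]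
  have h2 : Real.log (b / Real.exp (-l)) = B + l := by
    rw [Real.log_div hb.ne' hs.ne', Real.log_exp, sub_neg_eq_add]
  have h3 : Real.exp (-l) ≤ b := by
    rw [← Real.exp_log hb]
    exact Real.exp_le_exp.2 (by linarith)
  have h4 : C * Real.exp (-l) ≤ R := by
    rw [← le_div_iff₀' hC, ← Real.exp_log (show 0 < R / C by positivity)]
    exact Real.exp_le_exp.2 (by linarith)
  have := h _ hs h3 h4
  rw [h1, h2] at this
  rw [div_lt_iff₀ hδ] at hl3
  nlinarith

lemma card_le_of_cofactor_bound [Nontrivial E] {M : ℝ≥0} {F : E → E}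
    (hF : LipschitzWith M F) (hFs : HasCompactSupport F) {D : Set E} (hD : IsOpen D)
    (hDc : IsCompact (closure D)) (hDconn : IsPreconnected D)
    {c : ℝ} (hc : 0 < c) (hJ : ∀ᵐ x ∂μ, x ∈ D → c ≤ (fderiv ℝ F x).det)
    (hfr : ∀ x ∈ frontier D, F x ∉ F '' D) (hopen : ∀ V ⊆ D, IsOpen V → IsOpen (F '' V))
    {x : E} (hx : D ∩ F ⁻¹' {F x} = {x}) {K : ℝ} (hK : 0 ≤ K) {N : E → ℝ} (hN0 : ∀ x, 0 ≤ N x)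
    (hN : ∀ᵐ x' ∂μ, x' ∈ D → N x' ^ Module.finrank ℝ E ≤
      K * (fderiv ℝ F x').det ^ (Module.finrank ℝ E - 1))
    (hNz : ∀ᵐ x' ∂μ, x' ∈ D → ∀ l : E →L[ℝ] ℝ,
      |(fderiv ℝ F x').det * l (pullbackRadial F (F x) x')| ≤ N x' * ‖l‖ * ‖F x' - F x‖)
    {y : E} (S : Finset E) (hS : ∀ z ∈ S, z ∈ D ∧ F z = y) :
    (S.card : ℝ) ≤ K := by
  have hxD : x ∈ D := (hx.symm.subset rfl).1
  rcases S.eq_empty_or_nonempty with rfl | ⟨z, hz⟩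
  · simpa using hK
  have hy : y ∈ F '' D := ⟨z, hS z hz⟩
  have hΩ : IsOpen (F '' D) := hopen D subset_rfl hD
  have hJpos : ∀ᵐ x ∂μ, x ∈ D → 0 < (fderiv ℝ F x).det :=
    hJ.mono fun x h hx => hc.trans_le (h hx)
  obtain ⟨m, hm⟩ := exists_setIntegral_det_ball_eq_mul μ hF hFs hD hDc
    (hJpos.mono fun x h hx => (h hx).ne') hΩ (hDconn.image F hF.continuous.continuousOn) hfr
  have hcard := card_mul_addHaar_ball_le μ hF hFs hD (hJpos.mono fun x h hx => (h hx).le) hΩ hopen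
    hm hy S hS
  have hα : 0 < μ.real (ball (0 : E) 1) :=
    ENNReal.toReal_pos (measure_ball_pos μ _ one_pos).ne' measure_ball_lt_top.ne
  have hm0 : 0 ≤ m := le_trans (by positivity) hcard
  obtain ⟨C, hC, hCs⟩ := exists_norm_sub_lt_mul_of_norm_lt μ hF hFs hD hDc hc hJ hfr hopen hm hx
  obtain ⟨b, hb, hbΩ⟩ := nhds_basis_closedBall.mem_iff.1 (hΩ.mem_nhds (mem_image_of_mem F hxD))
  obtain ⟨R, hR, hRD⟩ := nhds_basis_closedBall.mem_iff.1 (Filter.inter_mem (hD.mem_nhds hxD)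
    (hF.continuous.continuousAt.preimage_mem_nhds (ball_mem_nhds (F x) (half_pos hb))))
  refine le_of_mul_le_mul_right (hcard.trans ?_) hα
  refine le_mul_of_mul_log_le (d := Module.finrank ℝ E) (by exact_mod_cast Module.finrank_pos)
    hC (half_pos hb) hR fun s hs hsb hsR => ?_
  have hs2 : closedBall (F x) (2 * s) ⊆ F '' D :=
    (closedBall_subset_closedBall (by linarith)).trans hbΩ
  refine mul_log_le_of_cofactor_bound μ hF hFs hD hJpos hm0 hm hK hN0 hN hNz hs (by positivity)
    hsR hsb (hRD.trans inter_subset_left)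
    ((closedBall_subset_closedBall (half_le_self hb.le)).trans hbΩ)
    (fun x' hx' => mem_ball_iff_norm.1 (hRD hx').2) (hCs s hs hs2)

end Multiplicity

section Main

lemma LipschitzOnWith.exists_hasCompactSupport_eqOn {E : Type*} [NormedAddCommGroup E]
    [NormedSpace ℝ E] [FiniteDimensional ℝ E] {M : ℝ≥0} {f : E → E} {U K : Set E}
    (hf : LipschitzOnWith M f U) (hK : IsCompact K) (hKU : K ⊆ U) :
    ∃ (L : ℝ≥0) (F : E → E), LipschitzWith L F ∧ HasCompactSupport F ∧ EqOn F f K := by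
  obtain ⟨G, hG, hGf⟩ := hf.extend_finite_dimension
  obtain ⟨L, χ, hχ, hχs, -, hχ1⟩ := exists_lipschitz_cutoff hK isOpen_univ (subset_univ K)
  obtain ⟨A, hA⟩ := hχ.continuous.bounded_above_of_compact_support hχs
  obtain ⟨B, hB⟩ := hχs.isCompact.exists_bound_of_continuousOn hG.continuous.continuousOn
  obtain ⟨M', hM'⟩ := hχ.exists_smul_of_bounded hG hA
    fun x hx => hB x (subset_tsupport χ (Function.mem_support.2 hx))
  refine ⟨M', _, hM', hχs.smul_right, fun x hx => ?_⟩
  simp [(hχ1 x hx).eq_of_nhds, hGf (hKU hx)]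

variable {n : ℕ}

lemma jacobianMatrix_eq_toMatrix (f : EuclideanSpace ℝ (Fin n) → EuclideanSpace ℝ (Fin n))
    (x : EuclideanSpace ℝ (Fin n)) :
    jacobianMatrix f x = LinearMap.toMatrix (EuclideanSpace.basisFun (Fin n) ℝ).toBasis
      (EuclideanSpace.basisFun (Fin n) ℝ).toBasis (fderiv ℝ f x) := by
  ext i j
  simp [jacobianMatrix, LinearMap.toMatrix_apply]

lemma det_jacobianMatrix (f : EuclideanSpace ℝ (Fin n) → EuclideanSpace ℝ (Fin n))
    (x : EuclideanSpace ℝ (Fin n)) : (jacobianMatrix f x).det = (fderiv ℝ f x).det := by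
  rw [jacobianMatrix_eq_toMatrix, LinearMap.det_toMatrix]

lemma toEuclideanLin_jacobianMatrix
    (f : EuclideanSpace ℝ (Fin n) → EuclideanSpace ℝ (Fin n)) (x : EuclideanSpace ℝ (Fin n)) :
    Matrix.toEuclideanLin (jacobianMatrix f x) = fderiv ℝ f x := by
  rw [jacobianMatrix_eq_toMatrix, Matrix.toEuclideanLin_eq_toLin_orthonormal, Matrix.toLin_toMatrix]

lemma abs_det_mul_apply_le (A : Matrix (Fin n) (Fin n) ℝ) (u : EuclideanSpace ℝ (Fin n))
    (l : EuclideanSpace ℝ (Fin n) →L[ℝ] ℝ) :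
    |A.det * l u| ≤ matOpNorm (cofMatrix A) * ‖l‖ * ‖Matrix.toEuclideanLin A u‖ := by
  set w := (InnerProductSpace.toDual ℝ _).symm l with hw
  set v := Matrix.toEuclideanLin A u with hv
  have hadj : A.det • u = Matrix.toEuclideanLin A.adjugate v := by
    rw [hv]
    ext i
    simp [Matrix.toLpLin_apply, Matrix.mulVec_mulVec, Matrix.adjugate_mul, Matrix.smul_mulVec]
  have h1 : A.det * l u = inner ℝ (Matrix.toEuclideanLin (cofMatrix A) w) v := by
    have : Matrix.toEuclideanLin (cofMatrix A) =
        LinearMap.adjoint (Matrix.toEuclideanLin A.adjugate) := by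
      rw [← Matrix.toEuclideanLin_conjTranspose_eq_adjoint,
        Matrix.conjTranspose_eq_transpose_of_trivial]
      rfl
    rw [this, LinearMap.adjoint_inner_left, ← hadj, hw, InnerProductSpace.toDual_symm_apply,
      map_smul, smul_eq_mul]
  rw [h1]
  refine (abs_real_inner_le_norm _ _).trans ?_
  gcongr
  have := (LinearMap.toContinuousLinearMap (Matrix.toEuclideanLin (cofMatrix A))).le_opNorm w
  rwa [hw, LinearIsometryEquiv.norm_map] at this

end Main

/-- A non-constant BLD-mapping `f : U → ℝⁿ` (n ≥ 2, `U` open and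
connected) with `det Df ≥ c > 0` a.e. and `‖cof Df‖ⁿ ≤ K_I (det Df)^{n-1}` a.e.
satisfies, for every `x ∈ U`, every normal neighborhood `D` of `x` and every
`y ∈ f(D)`: `card (f⁻¹(y) ∩ D) ≤ K_I`. -/
theorem stmt0 (n : ℕ) (hn : 2 ≤ n)
    (U : Set (EuclideanSpace ℝ (Fin n))) (hUopen : IsOpen U) (hUconn : IsConnected U)
    (f : EuclideanSpace ℝ (Fin n) → EuclideanSpace ℝ (Fin n))
    -- f is continuous on U
    (hcont : ContinuousOn f U)
    -- f is non-constant on U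
    (hnonconst : ¬ ∃ c₀, ∀ x ∈ U, f x = c₀)
    -- f is discrete: every fiber is a discrete subset of U
    (hdisc : ∀ y : EuclideanSpace ℝ (Fin n), ∀ x ∈ U ∩ f ⁻¹' {y},
      ∃ ε > 0, ∀ z ∈ U ∩ f ⁻¹' {y}, z ∈ ball x ε → z = x)
    -- f is open: it maps open subsets of U to open sets
    (hopen : ∀ V ⊆ U, IsOpen V → IsOpen (f '' V))
    -- f is Lipschitz on U
    (hlip : ∃ M : ℝ≥0, LipschitzOnWith M f U)
    -- f is differentiable almost everywhere on U
    (hdiff : ∀ᵐ x ∂(volume.restrict U), DifferentiableAt ℝ f x)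
    (c K_I : ℝ) (hc : 0 < c) (hK : 1 ≤ K_I)
    -- a.e. on U : det Df(x) ≥ c and ‖cof Df(x)‖ⁿ ≤ K_I (det Df(x))^(n-1)
    (hJac : ∀ᵐ x ∂(volume.restrict U),
      c ≤ (jacobianMatrix f x).det ∧
      matOpNorm (cofMatrix (jacobianMatrix f x)) ^ n ≤ K_I * (jacobianMatrix f x).det ^ (n - 1))
    -- a point x ∈ U and a normal neighborhood D of x under f
    (x : EuclideanSpace ℝ (Fin n)) (hx : x ∈ U)
    (D : Set (EuclideanSpace ℝ (Fin n)))
    (hDopen : IsOpen D) (hDconn : IsConnected D)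
    (hDcpt : IsCompact (closure D)) (hDU : closure D ⊆ U)
    (hDnormal : f '' frontier D = frontier (f '' D))
    (hDneigh : D ∩ f ⁻¹' {f x} = {x})
    -- a point y in the image f(D)
    (y : EuclideanSpace ℝ (Fin n)) (hy : y ∈ f '' D) :
    (Nat.card ↥(f ⁻¹' {y} ∩ D) : ℝ) ≤ K_I := by
  obtain ⟨M, hM⟩ := hlip
  obtain ⟨L, F, hF, hFs, hFf⟩ := hM.exists_hasCompactSupport_eqOn hDcpt hDU
  have hFD : EqOn F f D := hFf.mono subset_closure
  have hfin : Module.finrank ℝ (EuclideanSpace ℝ (Fin n)) = n := finrank_euclideanSpace_fin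
  have : Nontrivial (EuclideanSpace ℝ (Fin n)) :=
    Module.nontrivial_of_finrank_pos (R := ℝ) (by rw [hfin]; lia)
  have hxD : x ∈ D := (hDneigh.symm.subset rfl).1
  have himage : ∀ V ⊆ D, F '' V = f '' V := fun V hV => (hFD.mono hV).image_eq
  have hDU' : D ⊆ U := subset_closure.trans hDU
  have hfd : ∀ z ∈ D, fderiv ℝ f z = fderiv ℝ F z := fun z hz =>
    ((hFD.eventuallyEq_of_mem (hDopen.mem_nhds hz)).fderiv_eq).symm
  have hJac' := (ae_restrict_iff' hUopen.measurableSet).1 hJac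
  have hJ : ∀ᵐ z, z ∈ D → c ≤ (fderiv ℝ F z).det := hJac'.mono fun z h hz => by
    rw [← hfd z hz, ← det_jacobianMatrix]
    exact (h (hDU' hz)).1
  have hopen' : ∀ V ⊆ D, IsOpen V → IsOpen (F '' V) := fun V hV hVo => by
    rw [himage V hV]
    exact hopen V (hV.trans hDU') hVo
  have hfr : ∀ z ∈ frontier D, F z ∉ F '' D := fun z hz h => by
    rw [hFf (frontier_subset_closure hz), himage D subset_rfl] at h
    have := hDnormal.subset (mem_image_of_mem f hz)
    rw [(hopen D hDU' hDopen).frontier_eq] at this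
    exact this.2 h
  have hx' : D ∩ F ⁻¹' {F x} = {x} := by
    rw [← hDneigh]
    ext z
    refine and_congr_right fun hz => ?_
    rw [mem_preimage, mem_preimage, mem_singleton_iff, mem_singleton_iff, hFD hz, hFD hxD]
  rcases (f ⁻¹' {y} ∩ D).finite_or_infinite with hfib | hfib
  swap
  · have := hfib.to_subtype
    rw [Nat.card_eq_zero_of_infinite]
    exact_mod_cast zero_le_one.trans hK
  rw [Nat.card_coe_set_eq, ncard_eq_toFinset_card _ hfib]
  refine card_le_of_cofactor_bound volume hF hFs hDopen hDcpt hDconn.isPreconnected hc hJ hfr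
    hopen' hx' (zero_le_one.trans hK) (N := fun z => matOpNorm (cofMatrix (jacobianMatrix f z)))
    (fun z => norm_nonneg _) (hJac'.mono fun z h hz => ?_) (hJ.mono fun z h hz l => ?_)
    (y := y) hfib.toFinset fun z hz => ?_
  · rw [hfin, ← hfd z hz, ← det_jacobianMatrix]
    exact (h (hDU' hz)).2
  · have := abs_det_mul_apply_le (jacobianMatrix f z) (pullbackRadial F (F x) z) l
    rw [det_jacobianMatrix, toEuclideanLin_jacobianMatrix, hfd z hz] at this
    have hz' : fderiv ℝ F z (pullbackRadial F (F x) z) = F z - F x :=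
      fderiv_pullbackRadial (F x) (hc.trans_le (h hz)).ne'
    rwa [ContinuousLinearMap.coe_coe, hz'] at this
  · obtain ⟨h1, h2⟩ := hfib.mem_toFinset.1 hz
    exact ⟨h2, (hFD h2).trans h1⟩
end

section
/- Let n ≥ 2, let U ⊆ ℝⁿ be open, and let f : U → ℝⁿ be a continuous, discrete, and open map for which there exists a constant L ≥ 1 such that every rectifiable path γ in U satisfies ℓ(γ)/L ≤ ℓ(f ∘ γ) ≤ L·ℓ(γ), where ℓ denotes the length (total variation) of a path. Then for every x ∈ U there exists r_x > 0 such that for every 0 < r ≤ r_x one has the inclusion B(f(x), r/L) ⊆ f(B(x, r)). -/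
open MeasureTheory Metric Set
open scoped Topology ENNReal NNReal

section PathLifting

variable {E F : Type*} [NormedAddCommGroup E] [NormedAddCommGroup F]
  {U : Set E} {f : E → F}

/-- An isolated point `q` of its fiber is surrounded by a compact annulus on which `f` stays away
from `f q`. -/
lemma exists_annulus_dist_ge [ProperSpace E] (hU : IsOpen U) (hf : ContinuousOn f U)
    {q : E} (hq : q ∈ U)
    (hdisc : ∃ ε > 0, ∀ z ∈ U ∩ f ⁻¹' {f q}, z ∈ ball q ε → z = q) {ρ : ℝ} (hρ : 0 < ρ) :
    ∃ σ > 0, σ ≤ ρ ∧ closedBall q σ ⊆ U ∧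
      ∃ δ > 0, ∀ w ∈ closedBall q σ, σ / 2 ≤ dist w q → δ ≤ dist (f w) (f q) := by
  obtain ⟨ε, hε, hiso⟩ := hdisc
  obtain ⟨R, hR, hRU⟩ := Metric.isOpen_iff.1 hU q hq
  set σ := min ρ (min (ε / 2) (R / 2)) with hσdef
  have hσ : 0 < σ := by positivity
  have h1 : σ ≤ ε / 2 := (min_le_right _ _).trans (min_le_left _ _)
  have h2 : σ ≤ R / 2 := (min_le_right _ _).trans (min_le_right _ _)
  have hsub : closedBall q σ ⊆ U := (closedBall_subset_ball (by linarith)).trans hRU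
  refine ⟨σ, hσ, min_le_left _ _, hsub, ?_⟩
  set A := closedBall q σ ∩ {w | σ / 2 ≤ dist w q} with hA
  have hAc : IsCompact A :=
    (isCompact_closedBall q σ).inter_right
      (isClosed_le continuous_const (continuous_id.dist continuous_const))
  rcases A.eq_empty_or_nonempty with hemp | hne
  · refine ⟨1, one_pos, fun w hw hw' => ?_⟩
    have : w ∈ A := ⟨hw, hw'⟩
    simp [hemp] at this
  · obtain ⟨w0, hw0, hmin⟩ := hAc.exists_isMinOn hne
      (f := fun w => dist (f w) (f q))
      (continuous_dist.comp_continuousOn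
        ((hf.mono (inter_subset_left.trans hsub)).prodMk continuousOn_const))
    refine ⟨dist (f w0) (f q), dist_pos.2 fun h => ?_, fun w hw hw' => hmin ⟨hw, hw'⟩⟩
    have hball : w0 ∈ ball q ε := closedBall_subset_ball (by linarith) hw0.1
    have := hiso w0 ⟨hsub hw0.1, h⟩ hball
    have h3 : σ / 2 ≤ dist w0 q := hw0.2
    rw [this, dist_self] at h3
    linarith

/-- Openness of `f` is uniform on compact sets. -/
lemma exists_uniform_ball_subset_image (hU : IsOpen U) (hf : ContinuousOn f U)
    (hopen : ∀ V ⊆ U, IsOpen V → IsOpen (f '' V)) {K : Set E} (hK : IsCompact K) (hKU : K ⊆ U)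
    {ε : ℝ} (hε : 0 < ε) :
    ∃ d > 0, ∀ w ∈ K, ball (f w) d ⊆ f '' (U ∩ ball w ε) := by
  refine hK.induction_on (p := fun S => ∃ d > 0, ∀ w ∈ S, ball (f w) d ⊆ f '' (U ∩ ball w ε))
    ⟨1, one_pos, by simp⟩ ?_ ?_ ?_
  · rintro s t hst ⟨d, hd, h⟩
    exact ⟨d, hd, fun w hw => h w (hst hw)⟩
  · rintro s t ⟨d, hd, h⟩ ⟨d', hd', h'⟩
    refine ⟨min d d', lt_min hd hd', ?_⟩
    rintro w (hw | hw)
    · exact (ball_subset_ball (min_le_left _ _)).trans (h w hw)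
    · exact (ball_subset_ball (min_le_right _ _)).trans (h' w hw)
  · intro w0 hw0
    have ho := hopen (U ∩ ball w0 (ε / 2)) inter_subset_left (hU.inter isOpen_ball)
    obtain ⟨d, hd, hsub⟩ := Metric.isOpen_iff.1 ho (f w0)
      ⟨w0, ⟨hKU hw0, mem_ball_self (by positivity)⟩, rfl⟩
    have hc : ContinuousAt f w0 := hf.continuousAt (hU.mem_nhds (hKU hw0))
    refine ⟨_, mem_nhdsWithin_of_mem_nhds
      (Filter.inter_mem (hc (ball_mem_nhds (f w0) (half_pos hd)))
        (ball_mem_nhds w0 (half_pos hε))), d / 2, half_pos hd, ?_⟩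
    rintro w ⟨hw1, hw2⟩ y hy
    have hw1' : dist (f w) (f w0) < d / 2 := hw1
    have hy0 : y ∈ ball (f w0) d := by
      rw [mem_ball] at hy ⊢
      linarith [dist_triangle y (f w) (f w0)]
    obtain ⟨u, ⟨huU, hu⟩, rfl⟩ := hsub hy0
    refine ⟨u, ⟨huU, ?_⟩, rfl⟩
    rw [mem_ball] at hu hw2 ⊢
    linarith [dist_triangle u w0 w, dist_comm w w0]

/-- A chain with small steps cannot cross an annulus on which `f` stays away from `f q`. -/
lemma chain_mem_ball {q : E} {σ δ : ℝ}
    (hann : ∀ w ∈ closedBall q σ, σ / 2 ≤ dist w q → δ ≤ dist (f w) (f q)) {w w' : E}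
    (hw : w ∈ ball q (σ / 2)) (hww : dist w w' < σ / 2) (hfw : dist (f w') (f q) < δ) :
    w' ∈ ball q (σ / 2) := by
  rw [mem_ball] at hw ⊢
  by_contra hcon
  have : w' ∈ closedBall q σ := by
    rw [mem_closedBall]
    linarith [dist_triangle w' w q, dist_comm w w']
  linarith [hann w' this (not_lt.1 hcon)]

variable [NormedSpace ℝ F]

/-- Short segments starting at `f z` lift approximately, by chains with arbitrarily small steps. -/
lemma exists_chain_lift [ProperSpace E] (hU : IsOpen U) (hf : ContinuousOn f U)
    (hopen : ∀ V ⊆ U, IsOpen V → IsOpen (f '' V)) {z : E} {σ δ : ℝ} (hσ : 0 < σ)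
    (hσU : closedBall z σ ⊆ U)
    (hann : ∀ w ∈ closedBall z σ, σ / 2 ≤ dist w z → δ ≤ dist (f w) (f z)) {v : F}
    (hv : ‖v‖ < δ) {ε : ℝ} (hε : 0 < ε) :
    ∃ N : ℕ, 0 < N ∧ 1 / (N : ℝ) < ε ∧ ∃ s : ℕ → E, s 0 = z ∧
      (∀ j ≤ N, s j ∈ ball z (σ / 2) ∧ f (s j) = f z + ((j : ℝ) / N) • v) ∧
      ∀ j < N, dist (s j) (s (j + 1)) < ε := by
  have hε' : 0 < min ε (σ / 2) := lt_min hε (half_pos hσ)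
  obtain ⟨d, hd, hball⟩ := exists_uniform_ball_subset_image hU hf hopen
    (isCompact_closedBall z σ) hσU hε'
  obtain ⟨N, hN⟩ := exists_nat_gt (max (1 / ε) (‖v‖ / d))
  have hN1 : 1 / ε < N := (le_max_left _ _).trans_lt hN
  have hN2 : ‖v‖ / d < N := (le_max_right _ _).trans_lt hN
  have hN0 : (0 : ℝ) < N := lt_trans (by positivity) hN1
  have hstep : ∀ (j : ℕ) (w : E), ∃ w', j < N → w ∈ ball z (σ / 2) →
      f w = f z + ((j : ℝ) / N) • v →
      w' ∈ ball z (σ / 2) ∧ f w' = f z + (((j + 1 : ℕ) : ℝ) / N) • v ∧ dist w w' < ε := by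
    intro j w
    by_cases hyp : j < N ∧ w ∈ ball z (σ / 2) ∧ f w = f z + ((j : ℝ) / N) • v
    · obtain ⟨hj, hw, hfw⟩ := hyp
      have hmem : f z + (((j + 1 : ℕ) : ℝ) / N) • v ∈ ball (f w) d := by
        have : f z + (((j + 1 : ℕ) : ℝ) / N) • v - (f z + ((j : ℝ) / N) • v)
            = (1 / (N : ℝ)) • v := by
          rw [add_sub_add_left_eq_sub, ← sub_smul]
          congr 1
          push_cast
          ring
        rw [mem_ball, dist_eq_norm, hfw, this, norm_smul, Real.norm_of_nonneg (by positivity)]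
        rw [div_lt_iff₀ hd] at hN2
        rw [one_div, inv_mul_lt_iff₀ hN0]
        exact hN2
      obtain ⟨w', ⟨-, hw'⟩, hfw'⟩ :=
        hball w (ball_subset_closedBall (ball_subset_ball (by linarith) hw)) hmem
      have hdist : dist w w' < min ε (σ / 2) := by rwa [dist_comm]
      refine ⟨w', fun _ _ _ => ⟨?_, hfw', hdist.trans_le (min_le_left _ _)⟩⟩
      refine chain_mem_ball hann hw (hdist.trans_le (min_le_right _ _)) ?_
      rw [hfw', dist_eq_norm, add_sub_cancel_left, norm_smul,
        Real.norm_of_nonneg (by positivity)]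
      have : ((j + 1 : ℕ) : ℝ) / N ≤ 1 := by
        rw [div_le_one hN0]
        exact_mod_cast hj
      nlinarith [norm_nonneg v]
    · exact ⟨w, fun h1 h2 h3 => absurd ⟨h1, h2, h3⟩ hyp⟩
  choose Φ hΦ using hstep
  let s : ℕ → E := fun j => Nat.rec z Φ j
  have hs : ∀ j ≤ N, s j ∈ ball z (σ / 2) ∧ f (s j) = f z + ((j : ℝ) / N) • v := by
    intro j
    induction j with
    | zero => intro _; exact ⟨mem_ball_self (half_pos hσ), by simp [s]⟩
    | succ j ih =>
      intro hj
      obtain ⟨h1, h2⟩ := ih (by omega)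
      have := hΦ j (s j) (by omega) h1 h2
      exact ⟨this.1, this.2.1⟩
  refine ⟨N, by exact_mod_cast hN0, ?_, s, rfl, hs, fun j hj => ?_⟩
  · rw [div_lt_iff₀ hε] at hN1
    rw [div_lt_iff₀ hN0]
    linarith
  · obtain ⟨h1, h2⟩ := hs j hj.le
    exact (hΦ j (s j) hj h1 h2).2.2

/-- A property of natural numbers that passes between neighbours in an interval holds at one
endpoint as soon as it holds at the other. -/
lemma Nat.of_forall_mem_uIcc {P : ℕ → Prop} {a b : ℕ}
    (hup : ∀ i ∈ uIcc a b, i + 1 ∈ uIcc a b → P i → P (i + 1))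
    (hdown : ∀ i ∈ uIcc a b, i + 1 ∈ uIcc a b → P (i + 1) → P i) (ha : P a) : P b := by
  simp only [mem_uIcc] at hup hdown
  rcases le_total a b with hab | hab
  · have : ∀ i, a ≤ i → i ≤ b → P i := by
      intro i hi
      induction i, hi using Nat.le_induction with
      | base => exact fun _ => ha
      | succ i hi ih => exact fun h => hup i (by omega) (by omega) (ih (by omega))
    exact this b hab le_rfl
  · have : ∀ k, k ≤ a - b → P (a - k) := by
      intro k
      induction k with
      | zero => exact fun _ => ha
      | succ k ih =>
        intro h
        have h' : a - k = a - (k + 1) + 1 := by omega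
        exact hdown _ (by omega) (by omega) (h' ▸ ih (by omega))
    have := this (a - b) le_rfl
    rwa [show a - (a - b) = b by omega] at this

/-- Short segments starting at `f z` lift to paths starting at `z`. -/
lemma exists_segment_lift [ProperSpace E] (hU : IsOpen U) (hf : ContinuousOn f U)
    (hdisc : ∀ q ∈ U, ∃ ε > 0, ∀ z ∈ U ∩ f ⁻¹' {f q}, z ∈ ball q ε → z = q)
    (hopen : ∀ V ⊆ U, IsOpen V → IsOpen (f '' V)) {z : E} (hz : z ∈ U) :
    ∃ δ > 0, ∀ v : F, ‖v‖ < δ → ∃ γ : ℝ → E, ContinuousOn γ (Icc 0 1) ∧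
      MapsTo γ (Icc 0 1) U ∧ γ 0 = z ∧ ∀ t ∈ Icc (0 : ℝ) 1, f (γ t) = f z + t • v := by
  obtain ⟨σ, hσ, -, hσU, δ, hδ, hann⟩ := exists_annulus_dist_ge hU hf hz (hdisc z hz) one_pos
  refine ⟨δ, hδ, fun v hv => ?_⟩
  have hex := fun k : ℕ => exists_chain_lift hU hf hopen hσ hσU hann hv
    (ε := 1 / ((k : ℝ) + 1)) (by positivity)
  choose N hN0 hN s hs0 hs hstep using hex
  let g : ℕ → ℝ → E := fun k t => s k ⌊t * N k⌋₊
  have hfloor : ∀ k, ∀ t ∈ Icc (0 : ℝ) 1, ⌊t * N k⌋₊ ≤ N k := fun k t ht =>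
    Nat.floor_le_of_le (mul_le_of_le_one_left (Nat.cast_nonneg _) ht.2)
  have hfloor_dist : ∀ k, ∀ t ∈ Icc (0 : ℝ) 1,
      (⌊t * N k⌋₊ : ℝ) / N k ≤ t ∧ t ≤ (⌊t * N k⌋₊ : ℝ) / N k + 1 / ((k : ℝ) + 1) := by
    intro k t ht
    have hNk : (0 : ℝ) < N k := by exact_mod_cast hN0 k
    have h1 := Nat.floor_le (mul_nonneg ht.1 hNk.le)
    have h2 := Nat.lt_floor_add_one (t * N k)
    refine ⟨(div_le_iff₀ hNk).2 h1, ?_⟩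
    have h3 : t ≤ (⌊t * N k⌋₊ : ℝ) / N k + 1 / N k := by
      rw [← add_div, le_div_iff₀ hNk]
      exact h2.le
    linarith [hN k]
  have hlim : ∀ t : ℝ, ∃ y, t ∈ Icc (0 : ℝ) 1 → y ∈ closedBall z (σ / 2) ∧
      Filter.Tendsto (fun k => g k t) (Filter.hyperfilter ℕ) (𝓝 y) := by
    intro t
    by_cases ht : t ∈ Icc (0 : ℝ) 1
    · obtain ⟨y, hy, hle⟩ := (isCompact_closedBall z (σ / 2)).ultrafilter_le_nhds
        ((Filter.hyperfilter ℕ).map fun k => g k t) (by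
          rw [Filter.le_principal_iff, Ultrafilter.coe_map, Filter.mem_map]
          exact Filter.univ_mem' fun k =>
            ball_subset_closedBall (hs k _ (hfloor k t ht)).1)
      exact ⟨y, fun _ => ⟨hy, hle⟩⟩
    · exact ⟨z, fun h => absurd h ht⟩
  choose γ hγ using hlim
  have hγU : MapsTo γ (Icc 0 1) U := fun t ht =>
    hσU (closedBall_subset_closedBall (by linarith) (hγ t ht).1)
  have hzero : Filter.Tendsto (fun k : ℕ => 1 / ((k : ℝ) + 1)) (Filter.hyperfilter ℕ) (𝓝 0) :=
    tendsto_one_div_add_atTop_nhds_zero_nat.mono_left Nat.hyperfilter_le_atTop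
  have hfγ : ∀ t ∈ Icc (0 : ℝ) 1, f (γ t) = f z + t • v := by
    intro t ht
    have hc : ContinuousAt f (γ t) := hf.continuousAt (hU.mem_nhds (hγU ht))
    have h1 := hc.tendsto.comp (hγ t ht).2
    have h2 : Filter.Tendsto (fun k => (⌊t * N k⌋₊ : ℝ) / N k) (Filter.hyperfilter ℕ) (𝓝 t) := by
      refine tendsto_of_tendsto_of_tendsto_of_le_of_le (g := fun k : ℕ => t - 1 / ((k : ℝ) + 1))
        (by simpa using hzero.const_sub t) tendsto_const_nhds
        (fun k => ?_) fun k => (hfloor_dist k t ht).1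
      simp only
      linarith [(hfloor_dist k t ht).2]
    have h3 : Filter.Tendsto (fun k => f (g k t)) (Filter.hyperfilter ℕ) (𝓝 (f z + t • v)) := by
      refine ((h2.smul_const v).const_add (f z)).congr fun k => ?_
      exact (hs k _ (hfloor k t ht)).2.symm
    exact tendsto_nhds_unique h1 h3
  refine ⟨γ, ?_, hγU, ?_, hfγ⟩
  · intro t ht
    rw [Metric.continuousWithinAt_iff]
    intro η hη
    obtain ⟨τ, hτ, hτη, -, d, hd, hann'⟩ :=
      exists_annulus_dist_ge hU hf (hγU ht) (hdisc _ (hγU ht)) hη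
    have hvpos : 0 < ‖v‖ + 1 := by positivity
    refine ⟨d / 2 / (‖v‖ + 1), by positivity, fun u hu hut => ?_⟩
    have hmem : ∀ᶠ k in (Filter.hyperfilter ℕ : Filter ℕ), g k u ∈ ball (γ t) (τ / 2) := by
      have e1 : ∀ᶠ k in (Filter.hyperfilter ℕ : Filter ℕ), g k t ∈ ball (γ t) (τ / 2) :=
        (hγ t ht).2 (ball_mem_nhds _ (half_pos hτ))
      have e2 := hzero.eventually_lt_const (half_pos hτ)
      have e3 := hzero.eventually_lt_const (show 0 < d / 2 / (‖v‖ + 1) by positivity)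
      filter_upwards [e1, e2, e3] with k hk1 hk2 hk3
      have hNk : (0 : ℝ) < N k := by exact_mod_cast hN0 k
      have hclose : ∀ i ∈ uIcc ⌊t * N k⌋₊ ⌊u * N k⌋₊,
          i ≤ N k ∧ dist (f (s k i)) (f (γ t)) < d := by
        intro i hi
        have hiN : i ≤ N k := by
          have := hfloor k t ht
          have := hfloor k u hu
          rw [mem_uIcc] at hi
          omega
        refine ⟨hiN, ?_⟩
        have habs : |(i : ℝ) / N k - t| < d / (‖v‖ + 1) := by
          obtain ⟨t1, t2⟩ := hfloor_dist k t ht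
          obtain ⟨u1, u2⟩ := hfloor_dist k u hu
          rw [Real.dist_eq, abs_lt] at hut
          have hdd : d / (‖v‖ + 1) = d / 2 / (‖v‖ + 1) + d / 2 / (‖v‖ + 1) := by ring
          rw [hdd]
          have mono : ∀ a b : ℕ, a ≤ b → (a : ℝ) / N k ≤ (b : ℝ) / N k := fun a b h => by
            gcongr
          rw [mem_uIcc] at hi
          rw [abs_lt]
          rcases hi with ⟨h1, h2⟩ | ⟨h1, h2⟩
          · have := mono _ _ h1
            have := mono _ _ h2
            constructor <;> linarith
          · have := mono _ _ h1
            have := mono _ _ h2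
            constructor <;> linarith
        rw [(hs k i hiN).2, hfγ t ht, dist_eq_norm, add_sub_add_left_eq_sub, ← sub_smul,
          norm_smul, Real.norm_eq_abs]
        rw [lt_div_iff₀ hvpos] at habs
        nlinarith [abs_nonneg ((i : ℝ) / N k - t)]
      refine Nat.of_forall_mem_uIcc (P := fun i => s k i ∈ ball (γ t) (τ / 2))
        (fun i _ hi' hP => ?_) (fun i hi hi' hP => ?_) hk1
      · obtain ⟨h1, h2⟩ := hclose _ hi'
        exact chain_mem_ball hann' hP ((hstep k i (by omega)).trans hk2) h2
      · obtain ⟨h1, -⟩ := hclose _ hi'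
        refine chain_mem_ball hann' hP ?_ (hclose _ hi).2
        rw [dist_comm]
        exact (hstep k i (by omega)).trans hk2
    have hcl : γ u ∈ closedBall (γ t) (τ / 2) :=
      isClosed_closedBall.mem_of_tendsto (hγ u hu).2
        (hmem.mono fun k hk => ball_subset_closedBall hk)
    exact lt_of_le_of_lt hcl (by linarith)
  · have h0 : (0 : ℝ) ∈ Icc (0 : ℝ) 1 := ⟨le_rfl, zero_le_one⟩
    refine tendsto_nhds_unique (hγ 0 h0).2 (tendsto_const_nhds.congr fun k => ?_)
    simp [g, hs0]

end PathLifting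

/-- The length of a segment parametrized on the unit interval is at most the norm of its
direction. -/
lemma eVariationOn_segment_le {F : Type*} [NormedAddCommGroup F] [NormedSpace ℝ F] (c v : F) :
    eVariationOn (fun t : ℝ => c + t • v) (Icc 0 1) ≤ ENNReal.ofReal ‖v‖ := by
  have hlip : LipschitzOnWith ‖v‖₊ (fun t : ℝ => c + t • v) (Icc 0 1) := by
    refine LipschitzOnWith.of_dist_le_mul fun s _ t _ => ?_
    rw [dist_add_left, dist_eq_norm, ← sub_smul, norm_smul, dist_eq_norm, mul_comm]
    rfl
  have h1 := hlip.comp_eVariationOn_le (g := (id : ℝ → ℝ)) (s := Icc 0 1) (mapsTo_id _)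
  have h2 := (monotone_id.monotoneOn (Icc (0 : ℝ) 1)).eVariationOn_eq
    (left_mem_Icc.2 zero_le_one) (right_mem_Icc.2 zero_le_one)
  simp only [inter_self, id, sub_zero, ENNReal.ofReal_one] at h2
  calc _ ≤ _ := h1
    _ ≤ (‖v‖₊ : ℝ≥0∞) * 1 := by gcongr; exact h2.le
    _ = _ := by rw [mul_one, ofReal_norm]; rfl

/-- If `f : U → ℝⁿ` (n ≥ 2, `U ⊆ ℝⁿ` open) is continuous,
discrete and open, and there is `L ≥ 1` such that every path `γ` in `U`
satisfies `ℓ(γ)/L ≤ ℓ(f ∘ γ) ≤ L ℓ(γ)` (length = total variation), then for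
every `x ∈ U` there is `r_x > 0` such that for all `0 < r ≤ r_x` one has
`B(f(x), r/L) ⊆ f(B(x,r))`. -/
theorem stmt1 (n : ℕ) (hn : 2 ≤ n)
    (U : Set (EuclideanSpace ℝ (Fin n))) (hUopen : IsOpen U)
    (f : EuclideanSpace ℝ (Fin n) → EuclideanSpace ℝ (Fin n))
    -- f is continuous on U
    (hcont : ContinuousOn f U)
    -- f is discrete: every fiber is a discrete subset of U
    (hdisc : ∀ y : EuclideanSpace ℝ (Fin n), ∀ x ∈ U ∩ f ⁻¹' {y},
      ∃ ε > 0, ∀ z ∈ U ∩ f ⁻¹' {y}, z ∈ ball x ε → z = x)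
    -- f is open: it maps open subsets of U to open sets
    (hopen : ∀ V ⊆ U, IsOpen V → IsOpen (f '' V))
    (L : ℝ) (hL : 1 ≤ L)
    -- two-sided length distortion bounds for all paths in U
    (hlen : ∀ (a b : ℝ) (γ : ℝ → EuclideanSpace ℝ (Fin n)), a ≤ b →
      ContinuousOn γ (Set.Icc a b) → MapsTo γ (Set.Icc a b) U →
      eVariationOn γ (Set.Icc a b) / ENNReal.ofReal L ≤ eVariationOn (f ∘ γ) (Set.Icc a b) ∧
      eVariationOn (f ∘ γ) (Set.Icc a b) ≤ ENNReal.ofReal L * eVariationOn γ (Set.Icc a b)) :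
    ∀ x ∈ U, ∃ rx > (0:ℝ), ∀ r : ℝ, 0 < r → r ≤ rx →
      ball x r ⊆ U ∧ ball (f x) (r / L) ⊆ f '' ball x r := by
  have hL0 : 0 < L := by linarith
  -- lifting of short segments with control of the distance
  have hlocal : ∀ z ∈ U, ∃ δ > 0, ∀ v, ‖v‖ < δ →
      ∃ z' ∈ U, f z' = f z + v ∧ dist z' z ≤ L * ‖v‖ := by
    intro z hz
    obtain ⟨δ, hδ, hlift⟩ := exists_segment_lift hUopen hcont
      (fun q hq => hdisc (f q) q ⟨hq, rfl⟩) hopen hz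
    refine ⟨δ, hδ, fun v hv => ?_⟩
    obtain ⟨γ, hγc, hγU, hγ0, hγ⟩ := hlift v hv
    have h0 : (0 : ℝ) ∈ Icc (0 : ℝ) 1 := left_mem_Icc.2 zero_le_one
    have h1 : (1 : ℝ) ∈ Icc (0 : ℝ) 1 := right_mem_Icc.2 zero_le_one
    refine ⟨γ 1, hγU h1, by simpa using hγ 1 h1, ?_⟩
    have hvar := (hlen 0 1 γ zero_le_one hγc hγU).1
    have heq : eVariationOn (f ∘ γ) (Icc 0 1)
        = eVariationOn (fun t : ℝ => f z + t • v) (Icc 0 1) := eVariationOn.congr hγ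
    rw [heq] at hvar
    have hLne : ENNReal.ofReal L ≠ 0 := by simpa using hL0
    have hvar' := (ENNReal.div_le_iff hLne ENNReal.ofReal_ne_top).1
      (hvar.trans (eVariationOn_segment_le (f z) v))
    have hed := (eVariationOn.edist_le γ h1 h0).trans hvar'
    rw [hγ0, edist_dist, ← ENNReal.ofReal_mul (norm_nonneg _),
      ENNReal.ofReal_le_ofReal_iff (by positivity), mul_comm] at hed
    exact hed
  intro x hx
  obtain ⟨R, hR, hRU⟩ := Metric.isOpen_iff.1 hUopen x hx
  refine ⟨R, hR, fun r hr hrR => ?_⟩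
  have hrU : ball x r ⊆ U := (ball_subset_ball hrR).trans hRU
  refine ⟨hrU, fun y hy => ?_⟩
  set v := y - f x with hv
  have hD : L * ‖v‖ < r := by
    rw [mem_ball, dist_eq_norm, lt_div_iff₀ hL0] at hy
    linarith
  set K := closedBall x (L * ‖v‖) with hKdef
  have hKU : K ⊆ U := (closedBall_subset_ball hD).trans hrU
  set S : Set ℝ := {t | ∃ w ∈ K, dist w x ≤ L * ‖v‖ * t ∧ f w = f x + t • v} with hS
  have hclosed : IsClosed (S ∩ Icc 0 1) := by
    have hC : IsClosed ((Icc (0 : ℝ) 1 ×ˢ K) ∩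
        (fun p : ℝ × EuclideanSpace ℝ (Fin n) => (dist p.2 x - L * ‖v‖ * p.1,
          f p.2 - (f x + p.1 • v))) ⁻¹' (Iic 0 ×ˢ {0})) := by
      refine ContinuousOn.preimage_isClosed_of_isClosed ?_
        (isClosed_Icc.prod isClosed_closedBall) (isClosed_Iic.prod isClosed_singleton)
      refine ContinuousOn.prodMk (by fun_prop) (ContinuousOn.sub ?_ (by fun_prop))
      exact hcont.comp continuousOn_snd fun p hp => hKU hp.2
    have hcomp := ((isCompact_Icc (a := (0 : ℝ)) (b := 1)).prod
      (isCompact_closedBall x (L * ‖v‖))).of_isClosed_subset hC inter_subset_left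
    convert (hcomp.image continuous_fst).isClosed using 1
    ext t
    constructor
    · rintro ⟨⟨w, hw, hd, hfw⟩, ht⟩
      exact ⟨(t, w), ⟨⟨ht, hw⟩, by simpa using hd, by simp [hfw]⟩, rfl⟩
    · rintro ⟨⟨t', w⟩, ⟨⟨ht, hw⟩, hd, hfw⟩, rfl⟩
      exact ⟨⟨w, hw, by simpa using hd, sub_eq_zero.1 hfw⟩, ht⟩
  have hLv : 0 ≤ L * ‖v‖ := by positivity
  have hall : Icc (0 : ℝ) 1 ⊆ S := by
    refine hclosed.Icc_subset_of_forall_exists_gt ⟨x, mem_closedBall_self hLv, by simp, by simp⟩ ?_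
    rintro t ⟨⟨w, hw, hd, hfw⟩, ht⟩ b hb
    obtain ⟨δ, hδ, hlift⟩ := hlocal w (hKU hw)
    have hvpos : 0 < ‖v‖ + 1 := by positivity
    set h := min (min (b - t) (1 - t)) (δ / 2 / (‖v‖ + 1)) with hh
    have hhpos : 0 < h := lt_min (lt_min (sub_pos.2 hb) (sub_pos.2 ht.2)) (by positivity)
    have hhb : h ≤ b - t := (min_le_left _ _).trans (min_le_left _ _)
    have hh1 : h ≤ 1 - t := (min_le_left _ _).trans (min_le_right _ _)
    have hhδ : h * (‖v‖ + 1) ≤ δ / 2 := (le_div_iff₀ hvpos).1 (min_le_right _ _)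
    have hnorm : ‖h • v‖ = h * ‖v‖ := by rw [norm_smul, Real.norm_of_nonneg hhpos.le]
    obtain ⟨w', -, hfw', hd'⟩ := hlift (h • v) (by rw [hnorm]; linarith)
    have hdist : dist w' x ≤ L * ‖v‖ * (t + h) := by
      rw [hnorm] at hd'
      linarith [dist_triangle w' w x]
    refine ⟨t + h, ⟨w', ?_, hdist, ?_⟩, by linarith, by linarith⟩
    · exact hdist.trans (mul_le_of_le_one_right hLv (by linarith))
    · rw [hfw', hfw, add_smul, add_assoc]
  obtain ⟨w, hw, -, hfw⟩ := hall (right_mem_Icc.2 zero_le_one)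
  exact ⟨w, closedBall_subset_ball hD hw, by simp [hfw, hv]⟩
end

section
/- Let n ≥ 2, let U ⊆ ℝⁿ be open, let f ∈ C^∞(U, ℝⁿ), let g ∈ C_c^∞(U, ℝ) be smooth with compact support in U, and fix i ∈ {1, …, n}. Define h : U → ℝⁿ by replacing the i-th component of f with g, i.e. h = (f₁, …, f_{i-1}, g, f_{i+1}, …, f_n). Then ∫_U det Dh(x) dx = 0. -/
open MeasureTheory Metric Set
open scoped Topology ENNReal NNReal

namespace Matrix

/-- Jacobi's formula for the derivative of a determinant, in terms of the derivatives of the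
entries. -/
theorem hasFDerivAt_det {E ι : Type*} [NormedAddCommGroup E] [NormedSpace ℝ E]
    [Fintype ι] [DecidableEq ι] {A : E → Matrix ι ι ℝ} {A' : ι → ι → E →L[ℝ] ℝ} {x : E}
    (hA : ∀ k l, HasFDerivAt (fun y => A y k l) (A' k l) x) :
    HasFDerivAt (fun y => (A y).det)
      (∑ k, ∑ l, (A x).adjugate l k • A' k l) x := by
  let D : ContinuousMultilinearMap ℝ (fun _ : ι => ι → ℝ) ℝ :=
    ⟨(detRowAlternating (R := ℝ) (n := ι)).toMultilinearMap, Continuous.matrix_det continuous_id⟩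
  let R' : E →L[ℝ] (ι → ι → ℝ) :=
    ContinuousLinearMap.pi fun k => ContinuousLinearMap.pi fun l => A' k l
  have hR : HasFDerivAt (fun y => (fun k l => A y k l : ι → ι → ℝ)) R' x :=
    hasFDerivAt_pi.2 fun k => hasFDerivAt_pi.2 fun l => hA k l
  have h := (D.hasFDerivAt (fun k l => A x k l)).comp x hR
  refine h.congr_fderiv ?_
  ext v
  rw [ContinuousLinearMap.comp_apply, ContinuousMultilinearMap.linearDeriv_apply]
  simp only [_root_.sum_apply, _root_.smul_apply]
  refine Finset.sum_congr rfl fun k _ => ?_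
  change ((A x).updateRow k (R' v k)).det = _
  rw [det_eq_sum_mul_adjugate_row _ k]
  refine Finset.sum_congr rfl fun l _ => ?_
  rw [adjugate_apply, adjugate_apply, updateRow_idem, updateRow_self, mul_comm]
  rfl

theorem det_updateRow_eq_sum_mul_adjugate {ι R : Type*} [Fintype ι] [DecidableEq ι] [CommRing R]
    (A : Matrix ι ι R) (i : ι) (v : ι → R) :
    (A.updateRow i v).det = ∑ j, v j * A.adjugate j i := by
  rw [det_eq_sum_mul_adjugate_row _ i]
  simp [adjugate_apply, updateRow_idem]

/-- Contracting a symmetric array with the second-order minors of a matrix along two distinct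
rows gives zero. -/
theorem sum_mul_det_updateRow_updateRow_eq_zero {ι : Type*} [Fintype ι] [DecidableEq ι]
    (A : Matrix ι ι ℝ) {i k : ι} (hik : k ≠ i) {S : ι → ι → ℝ} (hS : ∀ j l, S j l = S l j) :
    ∑ j, ∑ l, ((A.updateRow i (Pi.single j 1)).updateRow k (Pi.single l 1)).det * S j l = 0 := by
  have hanti : ∀ j l, ((A.updateRow i (Pi.single l 1)).updateRow k (Pi.single j 1)).det
      = -((A.updateRow i (Pi.single j 1)).updateRow k (Pi.single l 1)).det := by
    intro j l
    refine Eq.trans (congrArg det ?_) ((detRowAlternating (R := ℝ)).map_swap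
      ((A.updateRow i (Pi.single j 1)).updateRow k (Pi.single l 1)) hik)
    funext m
    change _ = ((A.updateRow i (Pi.single j 1)).updateRow k (Pi.single l 1)) (Equiv.swap k i m)
    rcases eq_or_ne m k with rfl | hmk
    · simp [updateRow_ne hik.symm]
    rcases eq_or_ne m i with rfl | hmi
    · simp [updateRow_ne hmk]
    · simp [updateRow_ne hmk, updateRow_ne hmi, Equiv.swap_apply_of_ne_of_ne hmk hmi]
  have h : ∑ j, ∑ l, ((A.updateRow i (Pi.single j 1)).updateRow k (Pi.single l 1)).det * S j l
      = -∑ j, ∑ l, ((A.updateRow i (Pi.single j 1)).updateRow k (Pi.single l 1)).det * S j l := by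
    conv_lhs => rw [Finset.sum_comm]
    simp only [← Finset.sum_neg_distrib]
    refine Finset.sum_congr rfl fun j _ => Finset.sum_congr rfl fun l _ => ?_
    rw [hanti, hS l j, neg_mul]
  linarith

end Matrix

section Piola

variable {n : ℕ} {f : EuclideanSpace ℝ (Fin n) → EuclideanSpace ℝ (Fin n)}
  {x : EuclideanSpace ℝ (Fin n)}

theorem hasFDerivAt_jacobianMatrix_apply (hf : ContDiffAt ℝ 2 f x) (k l : Fin n) :
    HasFDerivAt (fun y => jacobianMatrix f y k l)
      ((EuclideanSpace.proj k : EuclideanSpace ℝ (Fin n) →L[ℝ] ℝ).comp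
        ((fderiv ℝ (fderiv ℝ f) x).flip (EuclideanSpace.single l 1))) x := by
  have h : HasFDerivAt (fderiv ℝ f) (fderiv ℝ (fderiv ℝ f) x) x :=
    ((hf.fderiv_right (m := 1) (by norm_num)).differentiableAt (by norm_num)).hasFDerivAt
  have h' := h.clm_apply (hasFDerivAt_const (EuclideanSpace.single l (1 : ℝ)) x)
  refine ((EuclideanSpace.proj k : EuclideanSpace ℝ (Fin n) →L[ℝ] ℝ).hasFDerivAt.comp x
    h').congr_fderiv ?_
  ext v
  simp

theorem contDiffAt_adjugate_jacobianMatrix (hf : ContDiffAt ℝ 2 f x) (i j : Fin n) :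
    ContDiffAt ℝ 1 (fun y => (jacobianMatrix f y).adjugate j i) x := by
  have hJ : ∀ k l, ContDiffAt ℝ 1 (fun y => jacobianMatrix f y k l) x := fun k l =>
    (EuclideanSpace.proj k : EuclideanSpace ℝ (Fin n) →L[ℝ] ℝ).contDiff.contDiffAt.comp x
      ((hf.fderiv_right (m := 1) (by norm_num)).clm_apply contDiffAt_const)
  simp only [Matrix.adjugate_apply, Matrix.det_apply]
  refine ContDiffAt.sum fun σ _ => ContDiffAt.const_smul _ (contDiffAt_prod fun k _ => ?_)
  by_cases hk : σ k = i
  · simpa only [hk, Matrix.updateRow_self] using contDiffAt_const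
  · simpa only [Matrix.updateRow_ne hk] using hJ _ _

/-- **Piola's identity**: the rows of the cofactor matrix of a Jacobian matrix are
divergence free. -/
theorem sum_fderiv_adjugate_jacobianMatrix_eq_zero (hf : ContDiffAt ℝ 2 f x) (i : Fin n) :
    ∑ j, fderiv ℝ (fun y => (jacobianMatrix f y).adjugate j i) x (EuclideanSpace.single j 1)
      = 0 := by
  let A' : Fin n → Fin n → EuclideanSpace ℝ (Fin n) →L[ℝ] ℝ := fun k l =>
    (EuclideanSpace.proj k : EuclideanSpace ℝ (Fin n) →L[ℝ] ℝ).comp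
      ((fderiv ℝ (fderiv ℝ f) x).flip (EuclideanSpace.single l 1))
  have hderiv : ∀ j, HasFDerivAt (fun y => (jacobianMatrix f y).adjugate j i)
      (∑ k, ∑ l, ((jacobianMatrix f x).updateRow i (Pi.single j 1)).adjugate l k •
        (if k = i then 0 else A' k l)) x := by
    intro j
    simp only [Matrix.adjugate_apply _ j i]
    refine Matrix.hasFDerivAt_det
      (A := fun y => (jacobianMatrix f y).updateRow i (Pi.single j 1)) fun k l => ?_
    split_ifs with hk
    · subst hk
      simpa only [Matrix.updateRow_self] using hasFDerivAt_const _ x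
    · simpa only [Matrix.updateRow_ne hk] using hasFDerivAt_jacobianMatrix_apply hf k l
  simp only [(hderiv _).fderiv, _root_.sum_apply, _root_.smul_apply, smul_eq_mul]
  rw [Finset.sum_comm]
  refine Finset.sum_eq_zero fun k _ => ?_
  by_cases hk : k = i
  · simp [hk]
  simp only [if_neg hk, Matrix.adjugate_apply]
  refine Matrix.sum_mul_det_updateRow_updateRow_eq_zero _ hk
    (S := fun j l => A' k l (EuclideanSpace.single j 1)) fun j l => ?_
  have hsymm := hf.isSymmSndFDerivAt (by simp)
  simp [A', hsymm.eq (EuclideanSpace.single j 1) (EuclideanSpace.single l 1)]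

end Piola

/-- The integral of a directional derivative of a compactly supported `C¹` function vanishes. -/
theorem integral_fderiv_apply_eq_zero {E : Type*} [NormedAddCommGroup E] [NormedSpace ℝ E]
    [FiniteDimensional ℝ E] [MeasurableSpace E] [BorelSpace E] (μ : Measure E)
    [μ.IsAddHaarMeasure] {V : E → ℝ} (hV : ContDiff ℝ 1 V) (hc : HasCompactSupport V) (v : E) :
    Integrable (fun x => fderiv ℝ V x v) μ ∧ ∫ x, fderiv ℝ V x v ∂μ = 0 := by
  have hint : Integrable (fun x => fderiv ℝ V x v) μ :=
    ((hV.continuous_fderiv (by norm_num)).clm_apply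
      continuous_const).integrable_of_hasCompactSupport (hc.fderiv_apply ℝ v)
  refine ⟨hint, ?_⟩
  have h := integral_mul_fderiv_eq_neg_fderiv_mul_of_integrable (μ := μ) (𝕜 := ℝ)
    (f := fun _ : E => (1 : ℝ)) (g := V) (v := v) (by simp) (by simpa using hint)
    (by simpa using hV.continuous.integrable_of_hasCompactSupport hc)
    (fun _ _ => differentiableAt_const _)
    (fun x _ => hV.contDiffAt.differentiableAt (by norm_num))
  simpa using h

/-- (Null-Lagrangian property.) For `f ∈ C^∞(U,ℝⁿ)`,
`g ∈ C_c^∞(U,ℝ)` and `i ∈ {1,…,n}`, the map `h = (f₁,…,f_{i-1},g,f_{i+1},…,f_n)`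
— whose Jacobian matrix at `x` is `Df(x)` with `i`-th row replaced by `∇g(x)` —
satisfies `∫_U det Dh(x) dx = 0`. -/
theorem stmt6 (n : ℕ) (hn : 2 ≤ n)
    (U : Set (EuclideanSpace ℝ (Fin n))) (hUopen : IsOpen U)
    (f : EuclideanSpace ℝ (Fin n) → EuclideanSpace ℝ (Fin n))
    (hf : ContDiffOn ℝ (⊤ : ℕ∞) f U)
    (g : EuclideanSpace ℝ (Fin n) → ℝ)
    (hg : ContDiff ℝ (⊤ : ℕ∞) g) (hgsupp : HasCompactSupport g) (hgU : tsupport g ⊆ U)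
    (i : Fin n) :
    ∫ x in U, ((jacobianMatrix f x).updateRow i (gradVec g x)).det = 0 := by
  have hf2 : ∀ x ∈ U, ContDiffAt ℝ 2 f x := fun x hx =>
    (hf.contDiffAt (hUopen.mem_nhds hx)).of_le (WithTop.coe_le_coe.2 (le_top : (2 : ℕ∞) ≤ ⊤))
  let V : Fin n → EuclideanSpace ℝ (Fin n) → ℝ :=
    fun j x => g x * (jacobianMatrix f x).adjugate j i
  have hsupp : ∀ j, tsupport (V j) ⊆ tsupport g := fun j => tsupport_mul_subset_left
  have hVc : ∀ j, HasCompactSupport (V j) := fun j => hgsupp.mul_right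
  have hV : ∀ j, ContDiff ℝ 1 (V j) := fun j =>
    contMDiff_iff_contDiff.1 <| contMDiff_of_tsupport fun x hx => ContDiffAt.contMDiffAt <|
      (hg.contDiffAt.of_le (WithTop.coe_le_coe.2 (le_top : (1 : ℕ∞) ≤ ⊤))).mul
        (contDiffAt_adjugate_jacobianMatrix (hf2 x (hgU (hsupp j hx))) i j)
  have hdiv : ∀ x ∈ U, ((jacobianMatrix f x).updateRow i (gradVec g x)).det
      = ∑ j, fderiv ℝ (V j) x (EuclideanSpace.single j 1) := by
    intro x hx
    have hVj : ∀ j, fderiv ℝ (V j) x (EuclideanSpace.single j 1)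
        = g x * fderiv ℝ (fun y => (jacobianMatrix f y).adjugate j i) x
            (EuclideanSpace.single j 1)
          + gradVec g x j * (jacobianMatrix f x).adjugate j i := by
      intro j
      rw [show V j = fun y => g y * (jacobianMatrix f y).adjugate j i from rfl,
        fderiv_fun_mul (hg.contDiffAt.differentiableAt (by simp))
        ((contDiffAt_adjugate_jacobianMatrix (hf2 x hx) i j).differentiableAt (by norm_num))]
      simp [gradVec, mul_comm]
    simp only [hVj, Finset.sum_add_distrib, ← Finset.mul_sum]
    rw [sum_fderiv_adjugate_jacobianMatrix_eq_zero (hf2 x hx),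
      Matrix.det_updateRow_eq_sum_mul_adjugate, mul_zero, zero_add]
  rw [setIntegral_congr_fun hUopen.measurableSet hdiv,
    setIntegral_eq_integral_of_forall_compl_eq_zero]
  · rw [integral_finsetSum _ fun j _ => (integral_fderiv_apply_eq_zero volume (hV j) (hVc j) _).1]
    exact Finset.sum_eq_zero fun j _ => (integral_fderiv_apply_eq_zero volume (hV j) (hVc j) _).2
  · intro x hx
    refine Finset.sum_eq_zero fun j _ => ?_
    rw [fderiv_of_notMem_tsupport ℝ fun h => hx (hgU (hsupp j h)), _root_.zero_apply]
end

section
/- Let n ≥ 2, let U ⊆ ℝⁿ be open, let f ∈ C^∞(U, ℝⁿ), and let Ψ ∈ C¹([0,∞), [0,∞)) be a nonnegative continuously differentiable function. Then for every nonnegative test function η ∈ C_c^∞(U, [0,∞)) one has | ∫_U η(x) · [ n·Ψ(|f(x)|²) + 2·|f(x)|²·Ψ'(|f(x)|²) ] · J_f(x) dx | ≤ ∫_U |∇η(x)| · |f(x)| · Ψ(|f(x)|²) · ‖cof Df(x)‖ dx. -/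
open MeasureTheory Metric Set
open scoped Topology ENNReal NNReal

/-- The determinant, as a continuous multilinear function of the rows of a matrix. -/
noncomputable def detRowContinuousMultilinear (n : ℕ) :
    ContinuousMultilinearMap ℝ (fun _ : Fin n => Fin n → ℝ) ℝ :=
  { (Matrix.detRowAlternating : (Fin n → ℝ) [⋀^Fin n]→ₗ[ℝ] ℝ).toMultilinearMap with
    cont := Continuous.matrix_det (A := fun M : Fin n → Fin n → ℝ => Matrix.of M) continuous_id }

theorem hasFDerivAt_matrix_det {n : ℕ} {E : Type*} [NormedAddCommGroup E] [NormedSpace ℝ E]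
    {M : E → Matrix (Fin n) (Fin n) ℝ} {M' : Fin n → Fin n → E →L[ℝ] ℝ} {x : E}
    (hM : ∀ k l, HasFDerivAt (fun y => M y k l) (M' k l) x) :
    HasFDerivAt (fun y => (M y).det)
      (((detRowContinuousMultilinear n).linearDeriv (M x)).comp
        (ContinuousLinearMap.pi fun k => ContinuousLinearMap.pi (M' k))) x := by
  have hrows : HasFDerivAt (fun y => (fun k l => M y k l : Fin n → Fin n → ℝ))
      (ContinuousLinearMap.pi fun k => ContinuousLinearMap.pi (M' k)) x :=
    hasFDerivAt_pi.2 fun k => hasFDerivAt_pi.2 fun l => hM k l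
  exact ((detRowContinuousMultilinear n).hasFDerivAt (M x)).comp x hrows

theorem fderiv_matrix_det_apply {n : ℕ} {E : Type*} [NormedAddCommGroup E] [NormedSpace ℝ E]
    {M : E → Matrix (Fin n) (Fin n) ℝ} {x : E}
    (hM : ∀ k l, DifferentiableAt ℝ (fun y => M y k l) x) (v : E) :
    fderiv ℝ (fun y => (M y).det) x v =
      ∑ k, ((M x).updateRow k fun l => fderiv ℝ (fun y => M y k l) x v).det := by
  rw [(hasFDerivAt_matrix_det fun k l => (hM k l).hasFDerivAt).fderiv,
    ContinuousLinearMap.comp_apply]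
  exact (detRowContinuousMultilinear n).linearDeriv_apply _ _

/-- Contracting two rows of a determinant against a symmetric matrix gives zero. -/
theorem sum_det_updateRow_updateRow_eq_zero {n : ℕ} (A H : Matrix (Fin n) (Fin n) ℝ)
    (hH : H.IsSymm) {i k : Fin n} (hik : i ≠ k) :
    ∑ j, ((A.updateRow i (Pi.single j 1)).updateRow k (H j)).det = 0 := by
  set D : Fin n → Fin n → ℝ := fun j l =>
    ((A.updateRow i (Pi.single j 1)).updateRow k (Pi.single l 1)).det with hD
  have expand : ∀ j, ((A.updateRow i (Pi.single j 1)).updateRow k (H j)).det =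
      ∑ l, H j l * D j l := by
    intro j
    have h : H j = ∑ l, H j l • (Pi.single l 1 : Fin n → ℝ) := by
      ext m; simp [Pi.single_apply]
    have := (detRowContinuousMultilinear n).map_update_sum (α := Fin n)
      (t := Finset.univ) (i := k) (fun l => H j l • (Pi.single l 1 : Fin n → ℝ))
      (A.updateRow i (Pi.single j 1))
    rw [← h] at this
    refine this.trans (Finset.sum_congr rfl fun l _ => ?_)
    exact (detRowContinuousMultilinear n).map_update_smul (A.updateRow i (Pi.single j 1)) k
      (H j l) (Pi.single l 1)
  have anti : ∀ j l, D l j = - D j l := by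
    intro j l
    have h := (Matrix.detRowAlternating : (Fin n → ℝ) [⋀^Fin n]→ₗ[ℝ] ℝ).map_swap
      ((A.updateRow i (Pi.single j 1)).updateRow k (Pi.single l 1)) hik
    refine Eq.trans ?_ h
    change Matrix.det _ = Matrix.det _
    congr 1
    ext a b
    change _ = ((A.updateRow i (Pi.single j 1)).updateRow k (Pi.single l 1)) (Equiv.swap i k a) b
    by_cases ha : a = i
    · subst ha
      simp [Matrix.updateRow_apply, hik]
    · by_cases hk : a = k
      · subst hk
        simp [Matrix.updateRow_apply, hik]
      · simp [Matrix.updateRow_apply, ha, hk, Equiv.swap_apply_of_ne_of_ne ha hk]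
  simp_rw [expand]
  have h : ∑ j, ∑ l, H j l * D j l = - ∑ j, ∑ l, H j l * D j l := by
    conv_lhs => rw [Finset.sum_comm]
    simp_rw [← Finset.sum_neg_distrib]
    refine Finset.sum_congr rfl fun l _ => Finset.sum_congr rfl fun j _ => ?_
    rw [anti, hH.apply]; ring
  linarith

theorem ContDiff.jacobianMatrix_apply {n : ℕ}
    {f : EuclideanSpace ℝ (Fin n) → EuclideanSpace ℝ (Fin n)} (hf : ContDiff ℝ (⊤ : ℕ∞) f)
    (k l : Fin n) : ContDiff ℝ (⊤ : ℕ∞) fun x => jacobianMatrix f x k l := by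
  have h : ContDiff ℝ (⊤ : ℕ∞) (fderiv ℝ f) := hf.fderiv_right (by simp)
  exact contDiff_euclidean.1 (h.clm_apply contDiff_const) k

theorem ContDiff.matrix_det {n : ℕ} {E : Type*} [NormedAddCommGroup E] [NormedSpace ℝ E]
    {m : WithTop ℕ∞} {M : E → Matrix (Fin n) (Fin n) ℝ}
    (hM : ∀ k l, ContDiff ℝ m fun x => M x k l) : ContDiff ℝ m fun x => (M x).det := by
  simp_rw [Matrix.det_apply]
  exact ContDiff.sum fun σ _ => (contDiff_prod fun k _ => hM _ _).const_smul _

theorem contDiff_updateRow_single {n : ℕ} {E : Type*} [NormedAddCommGroup E] [NormedSpace ℝ E]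
    {m : WithTop ℕ∞} {M : E → Matrix (Fin n) (Fin n) ℝ}
    (hM : ∀ k l, ContDiff ℝ m fun x => M x k l) (i j k l : Fin n) :
    ContDiff ℝ m fun x => (M x).updateRow i (Pi.single j 1) k l := by
  simp only [Matrix.updateRow_apply]
  split_ifs
  · exact contDiff_const
  · exact hM k l

theorem ContDiff.matrix_adjugate_apply {n : ℕ} {E : Type*} [NormedAddCommGroup E]
    [NormedSpace ℝ E] {m : WithTop ℕ∞} {M : E → Matrix (Fin n) (Fin n) ℝ}
    (hM : ∀ k l, ContDiff ℝ m fun x => M x k l) (j i : Fin n) :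
    ContDiff ℝ m fun x => (M x).adjugate j i := by
  simp_rw [Matrix.adjugate_apply]
  exact ContDiff.matrix_det (contDiff_updateRow_single hM i j)

/-- **Piola's identity**: the rows of the cofactor matrix of a differential are divergence-free. -/
theorem sum_fderiv_adjugate_jacobianMatrix {n : ℕ}
    {f : EuclideanSpace ℝ (Fin n) → EuclideanSpace ℝ (Fin n)} (hf : ContDiff ℝ (⊤ : ℕ∞) f)
    (i : Fin n) (x : EuclideanSpace ℝ (Fin n)) :
    ∑ j, fderiv ℝ (fun y => (jacobianMatrix f y).adjugate j i) x
      (EuclideanSpace.single j (1 : ℝ)) = 0 := by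
  have hJ := hf.jacobianMatrix_apply
  have hsymm : ∀ k, (Matrix.of fun j l => fderiv ℝ (fun y => jacobianMatrix f y k l) x
      (EuclideanSpace.single j (1 : ℝ))).IsSymm := by
    intro k
    have hd : DifferentiableAt ℝ (fderiv ℝ f) x :=
      ((hf.fderiv_right (m := 1) (by norm_cast)).differentiable (by simp)) x
    have key : ∀ j l, fderiv ℝ (fun y => jacobianMatrix f y k l) x
        (EuclideanSpace.single j (1 : ℝ)) =
        (fderiv ℝ (fderiv ℝ f) x (EuclideanSpace.single j 1) (EuclideanSpace.single l 1)) k := by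
      intro j l
      have h1 : HasFDerivAt (fun y => fderiv ℝ f y (EuclideanSpace.single l (1 : ℝ)))
          ((fderiv ℝ (fderiv ℝ f) x).flip (EuclideanSpace.single l 1)) x := by
        simpa using hd.hasFDerivAt.clm_apply
          (hasFDerivAt_const (EuclideanSpace.single l (1 : ℝ)) x)
      have h2 := (EuclideanSpace.proj (𝕜 := ℝ) k).hasFDerivAt.comp x h1
      exact congrArg (fun L => L (EuclideanSpace.single j (1 : ℝ))) h2.fderiv
    ext j l
    have hs : IsSymmSndFDerivAt ℝ f x :=
      hf.contDiffAt.isSymmSndFDerivAt (by simp; norm_cast)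
    simp only [Matrix.transpose_apply, Matrix.of_apply, key]
    rw [hs.eq]
  have hrow : ∀ j, fderiv ℝ (fun y => (jacobianMatrix f y).adjugate j i) x
      (EuclideanSpace.single j (1 : ℝ)) =
      ∑ k, (((jacobianMatrix f x).updateRow i (Pi.single j 1)).updateRow k
        (if k = i then 0 else fun l => fderiv ℝ (fun y => jacobianMatrix f y k l) x
          (EuclideanSpace.single j (1 : ℝ)))).det := by
    intro j
    simp_rw [Matrix.adjugate_apply]
    rw [fderiv_matrix_det_apply fun k l =>
      ((contDiff_updateRow_single hJ i j k l).differentiable (by simp)) x]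
    refine Finset.sum_congr rfl fun k _ => ?_
    congr 2
    ext l
    split_ifs with hk
    · simp [Matrix.updateRow_apply, hk]
    · simp [Matrix.updateRow_apply, hk]
  simp_rw [hrow]
  rw [Finset.sum_comm]
  refine Finset.sum_eq_zero fun k _ => ?_
  by_cases hk : k = i
  · refine Finset.sum_eq_zero fun j _ => ?_
    exact Matrix.det_eq_zero_of_row_eq_zero k fun l => by simp [hk]
  · simp only [hk, if_false]
    exact sum_det_updateRow_updateRow_eq_zero _ _ (hsymm k) (Ne.symm hk)

/-- Integrating by parts against a row of the cofactor matrix. -/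
theorem integral_sum_adjugate_mul_fderiv_eq_zero {n : ℕ}
    {f : EuclideanSpace ℝ (Fin n) → EuclideanSpace ℝ (Fin n)} (hf : ContDiff ℝ (⊤ : ℕ∞) f)
    {φ : EuclideanSpace ℝ (Fin n) → ℝ} (hφ : ContDiff ℝ 1 φ) (hφc : HasCompactSupport φ)
    (i : Fin n) :
    Integrable (fun x => ∑ j, (jacobianMatrix f x).adjugate j i *
        fderiv ℝ φ x (EuclideanSpace.single j (1 : ℝ))) ∧
      ∫ x, ∑ j, (jacobianMatrix f x).adjugate j i *
        fderiv ℝ φ x (EuclideanSpace.single j (1 : ℝ)) = 0 := by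
  have ha : ∀ j, ContDiff ℝ (⊤ : ℕ∞) fun x => (jacobianMatrix f x).adjugate j i :=
    fun j => ContDiff.matrix_adjugate_apply hf.jacobianMatrix_apply j i
  have hintDφ : ∀ j, Integrable fun x => (jacobianMatrix f x).adjugate j i *
      fderiv ℝ φ x (EuclideanSpace.single j (1 : ℝ)) := fun j =>
    ((ha j).continuous.mul ((hφ.continuous_fderiv (by simp)).clm_apply
      continuous_const)).integrable_of_hasCompactSupport
      ((hφc.fderiv_apply (𝕜 := ℝ) _).mul_left)
  have hintDφφ : ∀ j, Integrable fun x => fderiv ℝ (fun y => (jacobianMatrix f y).adjugate j i) x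
      (EuclideanSpace.single j (1 : ℝ)) * φ x := fun j =>
    ((((ha j).continuous_fderiv (by simp)).clm_apply continuous_const).mul
      hφ.continuous).integrable_of_hasCompactSupport hφc.mul_left
  refine ⟨integrable_finsetSum _ fun j _ => hintDφ j, ?_⟩
  rw [integral_finsetSum _ fun j _ => hintDφ j]
  have hparts : ∀ j, ∫ x, (jacobianMatrix f x).adjugate j i *
      fderiv ℝ φ x (EuclideanSpace.single j (1 : ℝ)) =
      - ∫ x, fderiv ℝ (fun y => (jacobianMatrix f y).adjugate j i) x
      (EuclideanSpace.single j (1 : ℝ)) * φ x := fun j =>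
    integral_mul_fderiv_eq_neg_fderiv_mul_of_integrable (hintDφφ j) (hintDφ j)
      (((ha j).continuous.mul hφ.continuous).integrable_of_hasCompactSupport hφc.mul_left)
      (fun x _ => (ha j).differentiable (by simp) x) (fun x _ => hφ.differentiable (by simp) x)
  simp_rw [hparts]
  rw [Finset.sum_neg_distrib, ← integral_finsetSum _ fun j _ => hintDφφ j]
  simp_rw [← Finset.sum_mul, sum_fderiv_adjugate_jacobianMatrix hf i]
  simp

theorem matOpNorm_cofMatrix {n : ℕ} (A : Matrix (Fin n) (Fin n) ℝ) :
    matOpNorm (cofMatrix A) = matOpNorm A.adjugate := by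
  open scoped Matrix.Norms.L2Operator in
  have h := Matrix.l2_opNorm_conjTranspose A.adjugate
  rwa [Matrix.conjTranspose_eq_transpose_of_trivial, Matrix.l2_opNorm_def,
    Matrix.l2_opNorm_def] at h

theorem continuous_matOpNorm {n : ℕ} :
    Continuous (matOpNorm : Matrix (Fin n) (Fin n) ℝ → ℝ) :=
  (((LinearMap.toContinuousLinearMap (𝕜 := ℝ) (E := EuclideanSpace ℝ (Fin n))
    (F' := EuclideanSpace ℝ (Fin n))).toLinearMap ∘ₗ
    (Matrix.toEuclideanLin (𝕜 := ℝ) (m := Fin n) (n := Fin n)).toLinearMap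
    ).continuous_of_finiteDimensional).norm

/-- Pointwise expansion of the divergence of `η Ψ(|f|²) adj(Df) f`. -/
theorem sum_adjugate_mul_fderiv_eq {n : ℕ}
    {f : EuclideanSpace ℝ (Fin n) → EuclideanSpace ℝ (Fin n)}
    {Ψ : ℝ → ℝ} (hΨ : DifferentiableOn ℝ Ψ (Set.Ici 0))
    {η : EuclideanSpace ℝ (Fin n) → ℝ} {x : EuclideanSpace ℝ (Fin n)}
    (hf : DifferentiableAt ℝ f x) (hη : DifferentiableAt ℝ η x) :
    ∑ i, ∑ j, (jacobianMatrix f x).adjugate j i *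
        fderiv ℝ (fun y => η y * (f y i * Ψ (‖f y‖ ^ 2))) x (EuclideanSpace.single j (1 : ℝ)) =
      η x * ((n : ℝ) * Ψ (‖f x‖ ^ 2) +
        2 * ‖f x‖ ^ 2 * derivWithin Ψ (Set.Ici 0) (‖f x‖ ^ 2)) * (jacobianMatrix f x).det +
      Ψ (‖f x‖ ^ 2) *
        fderiv ℝ η x (Matrix.toEuclideanLin (jacobianMatrix f x).adjugate (f x)) := by
  set A := jacobianMatrix f x with hA
  set P := Ψ (‖f x‖ ^ 2) with hP
  set P' := derivWithin Ψ (Set.Ici 0) (‖f x‖ ^ 2) with hP'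
  have hcoord : ∀ i, HasFDerivAt (fun y => f y i)
      ((EuclideanSpace.proj (𝕜 := ℝ) i).comp (fderiv ℝ f x)) x := fun i =>
    (EuclideanSpace.proj (𝕜 := ℝ) i).hasFDerivAt.comp x hf.hasFDerivAt
  have hcomp := (hΨ (‖f x‖ ^ 2) (sq_nonneg ‖f x‖)).hasDerivWithinAt.comp_hasFDerivAt x
    hf.hasFDerivAt.norm_sq (Filter.Eventually.of_forall fun y => sq_nonneg ‖f y‖)
  have hterm : ∀ i j, fderiv ℝ (fun y => η y * (f y i * Ψ (‖f y‖ ^ 2))) x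
      (EuclideanSpace.single j (1 : ℝ)) =
      fderiv ℝ η x (EuclideanSpace.single j (1 : ℝ)) * (f x i * P) + η x * P * A i j +
        2 * η x * P' * f x i * ∑ k, f x k * A k j := by
    intro i j
    have h := hη.hasFDerivAt.mul ((hcoord i).mul hcomp)
    have h' := congrArg (fun L => L (EuclideanSpace.single j (1 : ℝ))) h.fderiv
    refine Eq.trans h' ?_
    have hin : inner ℝ (f x) (fderiv ℝ f x (EuclideanSpace.single j (1 : ℝ))) =
        ∑ k, f x k * A k j := by
      rw [PiLp.inner_apply]
      exact Finset.sum_congr rfl fun k _ => by simp [hA, jacobianMatrix, mul_comm]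
    have hAij : A i j = fderiv ℝ f x (EuclideanSpace.single j (1 : ℝ)) i := rfl
    simp [hin, hAij, ← hP, ← hP']
    ring
  have hgrad : fderiv ℝ η x (Matrix.toEuclideanLin A.adjugate (f x)) =
      ∑ j, ∑ i, A.adjugate j i * f x i * fderiv ℝ η x (EuclideanSpace.single j (1 : ℝ)) := by
    have hdec : Matrix.toEuclideanLin A.adjugate (f x) =
        ∑ j, (∑ i, A.adjugate j i * f x i) • EuclideanSpace.single j (1 : ℝ) := by
      ext m
      simp [Matrix.toLpLin_apply, Matrix.mulVec, dotProduct, Pi.single_apply]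
    rw [hdec, map_sum]
    simp_rw [map_smul, smul_eq_mul, Finset.sum_mul]
  have hmul : ∀ k i, ∑ j, A k j * A.adjugate j i = if k = i then A.det else 0 := by
    intro k i
    have h := congrFun (congrFun A.mul_adjugate k) i
    rw [Matrix.mul_apply] at h
    simpa [Matrix.one_apply] using h
  have hnorm : ‖f x‖ ^ 2 = ∑ i, f x i * f x i := by
    rw [EuclideanSpace.real_norm_sq_eq]
    exact Finset.sum_congr rfl fun i _ => pow_two _
  have h1 : ∑ i, ∑ j, A.adjugate j i * (η x * P * A i j) = η x * (n * P) * A.det := by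
    have : ∀ i, ∑ j, A.adjugate j i * (η x * P * A i j) = η x * P * A.det := by
      intro i
      rw [← (hmul i i).trans (if_pos rfl), Finset.mul_sum]
      exact Finset.sum_congr rfl fun j _ => by ring
    simp_rw [this]
    simp
    ring
  have h2 : ∑ i, ∑ j, A.adjugate j i * (2 * η x * P' * f x i * ∑ k, f x k * A k j) =
      η x * (2 * ‖f x‖ ^ 2 * P') * A.det := by
    have : ∀ i, ∑ j, A.adjugate j i * (2 * η x * P' * f x i * ∑ k, f x k * A k j) =
        2 * η x * P' * A.det * (f x i * f x i) := by
      intro i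
      calc _ = 2 * η x * P' * f x i * ∑ k, f x k * ∑ j, A k j * A.adjugate j i := by
            simp_rw [Finset.mul_sum]
            rw [Finset.sum_comm]
            exact Finset.sum_congr rfl fun k _ => Finset.sum_congr rfl fun j _ => by ring
        _ = _ := by
            simp_rw [hmul]
            simp
            ring
    simp_rw [this]
    rw [← Finset.mul_sum, ← hnorm]
    ring
  have h3 : ∑ i, ∑ j, A.adjugate j i *
      (fderiv ℝ η x (EuclideanSpace.single j (1 : ℝ)) * (f x i * P)) =
      P * fderiv ℝ η x (Matrix.toEuclideanLin A.adjugate (f x)) := by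
    rw [hgrad, Finset.sum_comm]
    simp_rw [Finset.mul_sum]
    exact Finset.sum_congr rfl fun j _ => Finset.sum_congr rfl fun i _ => by ring
  simp_rw [hterm, mul_add, Finset.sum_add_distrib]
  rw [h1, h2, h3]
  ring

/-- The estimate over the whole space, for a globally smooth map. -/
theorem abs_integral_le_integral_matOpNorm_cofMatrix {n : ℕ}
    {f : EuclideanSpace ℝ (Fin n) → EuclideanSpace ℝ (Fin n)} (hf : ContDiff ℝ (⊤ : ℕ∞) f)
    {Ψ : ℝ → ℝ} (hΨ : ContDiffOn ℝ 1 Ψ (Set.Ici 0)) (hΨnonneg : ∀ s ∈ Set.Ici (0 : ℝ), 0 ≤ Ψ s)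
    {η : EuclideanSpace ℝ (Fin n) → ℝ} (hη : ContDiff ℝ (⊤ : ℕ∞) η)
    (hηsupp : HasCompactSupport η) :
    |∫ x, η x *
        ((n : ℝ) * Ψ (‖f x‖ ^ 2) + 2 * ‖f x‖ ^ 2 * derivWithin Ψ (Set.Ici 0) (‖f x‖ ^ 2)) *
        (jacobianMatrix f x).det| ≤
      ∫ x, ‖fderiv ℝ η x‖ * ‖f x‖ * Ψ (‖f x‖ ^ 2) *
        matOpNorm (cofMatrix (jacobianMatrix f x)) := by
  have hΨf : ContDiff ℝ 1 fun x => Ψ (‖f x‖ ^ 2) :=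
    hΨ.comp_contDiff ((hf.norm_sq ℝ).of_le (by simp)) fun x => sq_nonneg ‖f x‖
  have hφ : ∀ i, ContDiff ℝ 1 fun x => η x * (f x i * Ψ (‖f x‖ ^ 2)) := fun i =>
    (hη.of_le (by simp)).mul (((contDiff_euclidean.1 hf i).of_le (by simp)).mul hΨf)
  have hpiola := fun i => integral_sum_adjugate_mul_fderiv_eq_zero hf (hφ i)
    hηsupp.mul_right i
  have hadj : Continuous fun x => (jacobianMatrix f x).adjugate :=
    continuous_matrix fun j i =>
      (ContDiff.matrix_adjugate_apply hf.jacobianMatrix_apply j i).continuous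
  have hDη : Continuous (fderiv ℝ η) := hη.continuous_fderiv (by simp)
  have hbound : Integrable fun x => ‖fderiv ℝ η x‖ * ‖f x‖ * Ψ (‖f x‖ ^ 2) *
      matOpNorm (cofMatrix (jacobianMatrix f x)) := by
    simp_rw [matOpNorm_cofMatrix]
    refine Continuous.integrable_of_hasCompactSupport
      (((hDη.norm.mul hf.continuous.norm).mul hΨf.continuous).mul
        (continuous_matOpNorm.comp hadj)) ?_
    exact (((hηsupp.fderiv (𝕜 := ℝ)).norm.mul_right).mul_right).mul_right
  have happ : Continuous fun x =>
      Matrix.toEuclideanLin (jacobianMatrix f x).adjugate (f x) := by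
    simp_rw [Matrix.toLpLin_apply]
    exact (PiLp.continuous_toLp 2 _).comp
      (hadj.matrix_mulVec ((PiLp.continuous_ofLp 2 _).comp hf.continuous))
  have hgrad : Integrable fun x => Ψ (‖f x‖ ^ 2) *
      fderiv ℝ η x (Matrix.toEuclideanLin (jacobianMatrix f x).adjugate (f x)) := by
    refine (hΨf.continuous.mul (hDη.clm_apply happ)).integrable_of_hasCompactSupport ?_
    refine HasCompactSupport.mul_left ((hηsupp.fderiv (𝕜 := ℝ)).mono fun x hx h => hx ?_)
    simp [h]
  have hsum : Integrable fun x => ∑ i, ∑ j, (jacobianMatrix f x).adjugate j i *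
      fderiv ℝ (fun y => η y * (f y i * Ψ (‖f y‖ ^ 2))) x (EuclideanSpace.single j (1 : ℝ)) :=
    integrable_finsetSum _ fun i _ => (hpiola i).1
  have hzero : ∫ x, ∑ i, ∑ j, (jacobianMatrix f x).adjugate j i *
      fderiv ℝ (fun y => η y * (f y i * Ψ (‖f y‖ ^ 2))) x (EuclideanSpace.single j (1 : ℝ)) = 0 := by
    rw [integral_finsetSum _ fun i _ => (hpiola i).1]
    exact Finset.sum_eq_zero fun i _ => (hpiola i).2
  have hexpand := fun x => sum_adjugate_mul_fderiv_eq (hΨ.differentiableOn (by simp))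
    (hf.differentiable (by simp) x) (hη.differentiable (by simp) x)
  have heq : ∀ x, η x * ((n : ℝ) * Ψ (‖f x‖ ^ 2) +
      2 * ‖f x‖ ^ 2 * derivWithin Ψ (Set.Ici 0) (‖f x‖ ^ 2)) * (jacobianMatrix f x).det = _ :=
    fun x => eq_sub_of_add_eq (hexpand x).symm
  simp_rw [heq]
  rw [integral_sub hsum hgrad, hzero, zero_sub, abs_neg, ← Real.norm_eq_abs]
  refine norm_integral_le_of_norm_le hbound (Filter.Eventually.of_forall fun x => ?_)
  have hP := hΨnonneg (‖f x‖ ^ 2) (sq_nonneg ‖f x‖)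
  rw [norm_mul, Real.norm_of_nonneg hP, matOpNorm_cofMatrix]
  calc _ ≤ Ψ (‖f x‖ ^ 2) * (‖fderiv ℝ η x‖ *
        (matOpNorm (jacobianMatrix f x).adjugate * ‖f x‖)) := by
        gcongr
        refine (ContinuousLinearMap.le_opNorm _ _).trans ?_
        gcongr
        exact ContinuousLinearMap.le_opNorm
          (LinearMap.toContinuousLinearMap (Matrix.toEuclideanLin (jacobianMatrix f x).adjugate)) _
    _ = _ := by ring

/-- A map smooth on an open set agrees near any closed subset with a globally smooth map. -/
theorem ContDiffOn.exists_contDiff_eventuallyEq {E F : Type*} [NormedAddCommGroup E]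
    [NormedSpace ℝ E] [FiniteDimensional ℝ E] [NormedAddCommGroup F] [NormedSpace ℝ F]
    {U K : Set E} {f : E → F} (hf : ContDiffOn ℝ (⊤ : ℕ∞) f U) (hU : IsOpen U)
    (hK : IsClosed K) (hKU : K ⊆ U) :
    ∃ g : E → F, ContDiff ℝ (⊤ : ℕ∞) g ∧ ∀ x ∈ K, g =ᶠ[𝓝 x] f := by
  obtain ⟨χ, h0, h1, -⟩ := exists_contMDiffMap_zero_one_nhds_of_isClosed
    (n := (⊤ : ℕ∞)) (modelWithCornersSelf ℝ E) hU.isClosed_compl hK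
    (disjoint_compl_left_iff_subset.2 hKU)
  have hχ : ContDiff ℝ (⊤ : ℕ∞) χ := χ.contMDiff.contDiff
  refine ⟨fun x => χ x • f x, contDiff_iff_contDiffAt.2 fun x => ?_, fun x hx => ?_⟩
  · by_cases hx : x ∈ U
    · exact hχ.contDiffAt.smul (hf.contDiffAt (hU.mem_nhds hx))
    · refine (contDiffAt_const (c := 0)).congr_of_eventuallyEq ?_
      filter_upwards [Filter.eventually_iff.1 (h0.filter_mono (nhds_le_nhdsSet hx))] with y hy
      simp [show χ y = 0 from hy]
  · filter_upwards [Filter.eventually_iff.1 (h1.filter_mono (nhds_le_nhdsSet hx))] with y hy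
    rw [show χ y = 1 from hy, one_smul]

/-- (Sharpened Onninen–Zhong estimate.) For `f ∈ C^∞(U,ℝⁿ)`,
`Ψ ∈ C¹([0,∞),[0,∞))` and every nonnegative `η ∈ C_c^∞(U,[0,∞))`:
`|∫_U η (nΨ(|f|²) + 2|f|²Ψ'(|f|²)) J_f| ≤ ∫_U |∇η| |f| Ψ(|f|²) ‖cof Df‖`. -/
theorem stmt7 (n : ℕ) (hn : 2 ≤ n)
    (U : Set (EuclideanSpace ℝ (Fin n))) (hUopen : IsOpen U)
    (f : EuclideanSpace ℝ (Fin n) → EuclideanSpace ℝ (Fin n))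
    (hf : ContDiffOn ℝ (⊤ : ℕ∞) f U)
    (Ψ : ℝ → ℝ) (hΨ : ContDiffOn ℝ 1 Ψ (Set.Ici 0))
    (hΨnonneg : ∀ s ∈ Set.Ici (0 : ℝ), 0 ≤ Ψ s)
    (η : EuclideanSpace ℝ (Fin n) → ℝ)
    (hη : ContDiff ℝ (⊤ : ℕ∞) η) (hηsupp : HasCompactSupport η) (hηU : tsupport η ⊆ U)
    (hηnonneg : ∀ x, 0 ≤ η x) :
    |∫ x in U, η x *
        ((n : ℝ) * Ψ (‖f x‖ ^ 2) + 2 * ‖f x‖ ^ 2 * derivWithin Ψ (Set.Ici 0) (‖f x‖ ^ 2)) *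
        (jacobianMatrix f x).det| ≤
      ∫ x in U, ‖fderiv ℝ η x‖ * ‖f x‖ * Ψ (‖f x‖ ^ 2) *
        matOpNorm (cofMatrix (jacobianMatrix f x)) := by
  obtain ⟨g, hg, hgf⟩ := hf.exists_contDiff_eventuallyEq hUopen (isClosed_tsupport η) hηU
  have hjac : ∀ x ∈ tsupport η, jacobianMatrix f x = jacobianMatrix g x := fun x hx => by
    simp only [jacobianMatrix, (hgf x hx).fderiv_eq]
  have hη0 : ∀ x ∉ tsupport η, η x = 0 := fun x hx => image_eq_zero_of_notMem_tsupport hx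
  have hDη0 : ∀ x ∉ tsupport η, fderiv ℝ η x = 0 := fun x hx =>
    image_eq_zero_of_notMem_tsupport fun h => hx (tsupport_fderiv_subset ℝ h)
  rw [setIntegral_eq_integral_of_forall_compl_eq_zero fun x hx => by
      simp [hη0 x fun h => hx (hηU h)],
    setIntegral_eq_integral_of_forall_compl_eq_zero fun x hx => by
      simp [hDη0 x fun h => hx (hηU h)]]
  refine le_of_eq_of_le (congrArg _ (integral_congr_ae (.of_forall fun x => ?_)))
    ((abs_integral_le_integral_matOpNorm_cofMatrix hg hΨ hΨnonneg hη hηsupp).trans_eq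
      (integral_congr_ae (.of_forall fun x => ?_)))
  · by_cases hx : x ∈ tsupport η
    · simp only [hjac x hx, (hgf x hx).eq_of_nhds]
    · simp only [hη0 x hx, zero_mul]
  · by_cases hx : x ∈ tsupport η
    · simp only [hjac x hx, (hgf x hx).eq_of_nhds]
    · simp only [hDη0 x hx, norm_zero, zero_mul]
end
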